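/- arXiv:1504.05652 — 2 statements merged into one kernel-verified Lean document; each statement's English description precedes it below -/
import Mathlib

section
/- Let n ≥ 3, α ∈ (0,1], and β ∈ (α − n/2, n/2). Then for all u ∈ C_0^∞(ℝ^n), ‖ |x|^β D^α u ‖_{L^2} ≲ ‖ |x|^β ∇u ‖_{L^2}^α · ‖ |x|^β u ‖_{L^2}^{1−α}, and consequently ‖ |x|^{β−α} u ‖_{L^2} ≲ ‖ |x|^β ∇u ‖_{L^2}^α · ‖ |x|^β u ‖_{L^2}^{1−α}. -/
open MeasureTheory Metric Set ENNReal NNReal FourierTransform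

noncomputable section

/-- Euclidean space ℝⁿ. -/
abbrev Euc (n : ℕ) := EuclideanSpace ℝ (Fin n)

/-- Surface measure on the unit sphere of ℝⁿ. -/
def sphMeas (n : ℕ) : Measure (sphere (0 : Euc n) 1) :=
  (volume : Measure (Euc n)).toSphere

/-- `L²` norm (valued in ℝ≥0∞) of a function on the unit sphere of ℝⁿ. -/
def L2sph {n : ℕ} (g : sphere (0 : Euc n) 1 → ℂ) : ℝ≥0∞ :=
  (∫⁻ ω, (‖g ω‖₊ : ℝ≥0∞) ^ (2 : ℝ) ∂(sphMeas n)) ^ (1/2 : ℝ)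

/-- Sobolev–Slobodeckij norm `H^σ` (valued in ℝ≥0∞) on the unit sphere of ℝⁿ,
defined via the Gagliardo seminorm; for `σ = 0` it is the `L²` norm. -/
def HsphNorm {n : ℕ} (σ : ℝ) (g : sphere (0 : Euc n) 1 → ℂ) : ℝ≥0∞ :=
  L2sph g + (if σ = 0 then 0 else
    (∫⁻ ω, ∫⁻ ω', (‖g ω - g ω'‖₊ : ℝ≥0∞) ^ (2:ℝ) /
        ENNReal.ofReal (dist ω ω' ^ ((n : ℝ) - 1 + 2 * σ)) ∂(sphMeas n) ∂(sphMeas n))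
      ^ (1/2 : ℝ))

/-- Homogeneous Sobolev norm `Ḣ^s` (valued in ℝ≥0∞), defined on the Fourier side. -/
def homSobNorm {n : ℕ} (s : ℝ) (f : Euc n → ℂ) : ℝ≥0∞ :=
  (∫⁻ ξ : Euc n, ENNReal.ofReal (‖ξ‖ ^ (2 * s)) * (‖𝓕 f ξ‖₊ : ℝ≥0∞) ^ (2:ℝ)) ^ (1/2 : ℝ)

/-- Weighted `L²` norm `‖ |x|^β g ‖_{L²}` (valued in ℝ≥0∞). -/
def wL2 {n : ℕ} (β : ℝ) (g : Euc n → ℝ≥0∞) : ℝ≥0∞ :=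
  (∫⁻ x : Euc n, (ENNReal.ofReal (‖x‖ ^ β) * g x) ^ (2:ℝ)) ^ (1/2 : ℝ)

/-- The fractional operator `D^α = (√(-Δ))^α`, defined as the Fourier multiplier
with symbol `|ξ|^α`. -/
def fracD {n : ℕ} (α : ℝ) (u : Euc n → ℂ) : Euc n → ℂ :=
  𝓕⁻ (fun ξ => ((‖ξ‖ ^ α : ℝ) : ℂ) * 𝓕 u ξ)


lemma fourier_flip {n : ℕ} {f g : Euc n → ℂ} (hf : Integrable f) (hg : Integrable g) :
    ∫ ξ, 𝓕 f ξ * g ξ = ∫ x, f x * 𝓕 g x := by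
  have := VectorFourier.integral_fourierIntegral_smul_eq_flip (L := innerₗ (Euc n))
    (μ := volume) (ν := volume) (e := Real.fourierChar)
    Real.continuous_fourierChar continuous_inner hf hg
  simpa [flip_innerₗ] using! this

lemma ofReal_contDiff {n : ℕ} {g : Euc n → ℝ} (hg : ContDiff ℝ (⊤ : ℕ∞) g) :
    ContDiff ℝ (⊤ : ℕ∞) (fun x => (g x : ℂ)) :=
  ContDiff.comp (g := Complex.ofRealCLM) Complex.ofRealCLM.contDiff hg

lemma exists_schwartz {n : ℕ} {g : Euc n → ℝ} (hg : ContDiff ℝ (⊤ : ℕ∞) g)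
    (hgs : HasCompactSupport g) : ∃ G : SchwartzMap (Euc n) ℂ, ∀ x, G x = (g x : ℂ) := by
  have hgcs : HasCompactSupport (fun x => (g x : ℂ)) := 
    hgs.comp_left (g := fun x : ℝ => (x : ℂ)) Complex.ofReal_zero
  exact ⟨hgcs.toSchwartzMap (ofReal_contDiff hg), fun x => rfl⟩

lemma L2_pairing {n : ℕ} {f : Euc n → ℂ} (h1 : Integrable f)
    (F : Lp ℂ 2 (volume : Measure (Euc n))) (hF : ∀ᵐ x, F x = f x) (G : SchwartzMap (Euc n) ℂ) :
    ∫ x, G x * (𝓕 F : Lp ℂ 2 (volume : Measure (Euc n))) x = ∫ x, G x * 𝓕 f x := by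
  have h := congrArg (fun T => T G) (Lp.fourier_toTemperedDistribution_eq F)
  simp only [TemperedDistribution.fourier_apply, Lp.toTemperedDistribution_apply] at h
  have h3 : ∫ x, (𝓕 G) x • F x = ∫ x, (𝓕 G) x * f x := by
    apply integral_congr_ae
    filter_upwards [hF] with x hx
    rw [smul_eq_mul, hx]
  have h4 : ∫ x, (𝓕 G) x * f x = ∫ x, G x * 𝓕 f x := by
    rw [SchwartzMap.fourier_coe]
    exact fourier_flip G.integrable h1
  rw [h3, h4] at h
  exact h.symm

lemma L2_fourier_ae {n : ℕ} {f : Euc n → ℂ} (h1 : Integrable f)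
    (F : Lp ℂ 2 (volume : Measure (Euc n))) (hF : ∀ᵐ x, F x = f x) :
    ∀ᵐ x, (𝓕 F : Lp ℂ 2 (volume : Measure (Euc n))) x = 𝓕 f x := by
  have hcont : Continuous (𝓕 f) :=
    VectorFourier.fourierIntegral_continuous Real.continuous_fourierChar continuous_inner h1
  have hpair := L2_pairing h1 F hF
  have hLI := (Lp.memLp (𝓕 F)).locallyIntegrable (by norm_num)
  generalize 𝓕 F = FF at *
  apply ae_eq_of_integral_contDiff_smul_eq hLI hcont.locallyIntegrable
  intro g hg hgs
  obtain ⟨G, hG⟩ := exists_schwartz hg hgs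
  have h := hpair G
  simp only [hG] at h
  simp only [Complex.real_smul]
  exact h

lemma memLp_fourier {n : ℕ} {f : Euc n → ℂ} (h1 : Integrable f) (h2 : MemLp f 2 volume) :
    MemLp (𝓕 f) 2 volume ∧ eLpNorm (𝓕 f) 2 volume = eLpNorm f 2 volume := by
  have hF := h2.coeFn_toLp
  generalize h2.toLp f = F at *
  have hae := L2_fourier_ae h1 F hF
  have hL := Lp.memLp (𝓕 F)
  refine ⟨hL.ae_eq hae, ?_⟩
  rw [← eLpNorm_congr_ae hae]
  have hn : ‖𝓕 F‖ = ‖F‖ := Lp.norm_fourier_eq F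
  rw [Lp.norm_def, Lp.norm_def, ENNReal.toReal_eq_toReal_iff' hL.2.ne (Lp.memLp F).2.ne] at hn
  rw [hn]
  exact eLpNorm_congr_ae hF

lemma memLp_fourierInv {n : ℕ} {f : Euc n → ℂ} (h1 : Integrable f) (h2 : MemLp f 2 volume) :
    eLpNorm (𝓕⁻ f) 2 volume = eLpNorm f 2 volume := by
  have h : 𝓕⁻ f = (𝓕 f) ∘ (fun x => -x) := by
    ext x; exact Real.fourierInv_eq_fourier_neg f x
  rw [h, eLpNorm_comp_measurePreserving (memLp_fourier h1 h2).1.1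
    (Measure.measurePreserving_neg volume)]
  exact (memLp_fourier h1 h2).2

lemma continuous_fourier' {n : ℕ} {f : Euc n → ℂ} (h1 : Integrable f) : Continuous (𝓕 f) :=
    VectorFourier.fourierIntegral_continuous Real.continuous_fourierChar continuous_inner h1

lemma continuous_fourierInv' {n : ℕ} {f : Euc n → ℂ} (h1 : Integrable f) : Continuous (𝓕⁻ f) := by
  have h : 𝓕⁻ f = (𝓕 f) ∘ (fun x => -x) := by
    ext x; exact Real.fourierInv_eq_fourier_neg f x
  rw [h]
  exact (continuous_fourier' h1).comp continuous_neg

lemma norm_fourier_le {n : ℕ} (f : Euc n → ℂ) (ξ : Euc n) : ‖𝓕 f ξ‖ ≤ ∫ x, ‖f x‖ :=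
  VectorFourier.norm_fourierIntegral_le_integral_norm _ _ _ _ _

/-- a Fourier multiplier is a convolution -/
lemma mult_eq_conv {n : ℕ} {m f : Euc n → ℂ} (hm : Integrable m) (hf : Integrable f) (x : Euc n) :
    𝓕⁻ (fun ξ => m ξ * 𝓕 f ξ) x = ∫ y, 𝓕⁻ m (x - y) * f y := by
  have key := fourier_flip (g := fun ξ => (Real.fourierChar (inner ℝ ξ x) : ℂ) * m ξ) hf (by
    refine hm.norm.mono' ?_ ?_
    · refine AEStronglyMeasurable.mul ?_ hm.1
      have : Continuous (fun ξ : Euc n => (Real.fourierChar (inner ℝ ξ x) : ℂ)) := by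
        have := Real.continuous_fourierChar
        fun_prop
      exact this.aestronglyMeasurable
    · filter_upwards with ξ
      rw [norm_mul, Circle.norm_coe, one_mul])
  rw [Real.fourierInv_eq]
  convert key using 1
  · congr 1; ext ξ; rw [Circle.smul_def, smul_eq_mul]; ring
  · congr 1; ext y
    rw [Real.fourierInv_eq, Real.fourier_eq, mul_comm]
    congr 2; ext ξ
    simp only [Circle.smul_def, smul_eq_mul]
    rw [← mul_assoc]
    congr 1
    rw [← Circle.coe_mul, ← AddChar.map_add_eq_mul, inner_sub_right]
    congr 2; ring


lemma lintegral_scale {n : ℕ} (f : Euc n → ℝ≥0∞) {r : ℝ} (hr : 0 < r) :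
    ∫⁻ x, f x = ENNReal.ofReal (r ^ n) * ∫⁻ x, f (r • x) := by
  have h := (Homeomorph.smulOfNeZero (α := Euc n) r hr.ne').measurableEmbedding.lintegral_map
    (μ := volume) f
  have h2 := Measure.map_addHaar_smul (volume : Measure (Euc n)) hr.ne'
  have h3 : ∫⁻ x, f x ∂(Measure.map (fun x : Euc n => r • x) volume) = ∫⁻ x, f (r • x) := h
  rw [← h3, h2, lintegral_smul_measure, smul_eq_mul, ← mul_assoc, ← ENNReal.ofReal_mul (by positivity),
    finrank_euclideanSpace_fin, abs_of_pos (by positivity), mul_inv_cancel₀ (by positivity)]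
  simp

lemma pint {n : ℕ} (hn : 1 ≤ n) {p : ℝ} (hp0 : 0 < p) (hp : p < n) :
    ∫⁻ z : Euc n, ENNReal.ofReal ((1 + ‖z‖) ^ (-(n:ℝ)) * ‖z‖ ^ (-p)) < ⊤ := by
  have : Nonempty (Fin n) := ⟨⟨0, hn⟩⟩
  have key : Integrable (fun z : Euc n => (fun y : ℝ => (1 + y) ^ (-(n:ℝ)) * y ^ (-p)) ‖z‖) volume := by
    refine (integrable_fun_norm_addHaar (volume : Measure (Euc n))
      (f := fun y : ℝ => (1 + y) ^ (-(n:ℝ)) * y ^ (-p))).2 ?_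
    rw [finrank_euclideanSpace_fin]
    have hmeas : Measurable (fun y : ℝ => y ^ (n - 1) • ((1 + y) ^ (-(n:ℝ)) * y ^ (-p))) := by
      fun_prop
    have hpow : ∀ y : ℝ, 0 < y → y ^ (n - 1) = y ^ ((n:ℝ) - 1) := by
      intro y hy
      rw [← Real.rpow_natCast, Nat.cast_sub hn, Nat.cast_one]
    rw [← Ioc_union_Ioi_eq_Ioi (zero_le_one (α := ℝ))]
    refine IntegrableOn.union ?_ ?_
    · have h1 : IntegrableOn (fun y : ℝ => y ^ ((n:ℝ) - 1 - p)) (Ioc 0 1) := by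
        rw [← intervalIntegrable_iff_integrableOn_Ioc_of_le zero_le_one]
        exact intervalIntegral.intervalIntegrable_rpow' (by linarith)
      refine Integrable.mono' h1 hmeas.aestronglyMeasurable ?_
      refine (ae_restrict_iff' measurableSet_Ioc).2 (Filter.Eventually.of_forall ?_)
      intro y hy
      have hy0 : 0 < y := hy.1
      rw [Real.norm_of_nonneg (by positivity), smul_eq_mul, hpow y hy0]
      have : (1 + y) ^ (-(n:ℝ)) ≤ 1 := Real.rpow_le_one_of_one_le_of_nonpos (by linarith) (by simp)
      calc y ^ ((n:ℝ) - 1) * ((1 + y) ^ (-(n:ℝ)) * y ^ (-p))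
          ≤ y ^ ((n:ℝ) - 1) * (1 * y ^ (-p)) := by gcongr
        _ = y ^ ((n:ℝ) - 1 - p) := by
          rw [one_mul, ← Real.rpow_add hy0]; congr 1
    · have h1 : IntegrableOn (fun y : ℝ => y ^ (-1 - p)) (Ioi 1) :=
        integrableOn_Ioi_rpow_of_lt (by linarith) one_pos
      refine Integrable.mono' h1 hmeas.aestronglyMeasurable ?_
      refine (ae_restrict_iff' measurableSet_Ioi).2 (Filter.Eventually.of_forall ?_)
      intro y hy
      have hy0 : 0 < y := lt_trans one_pos hy
      rw [Real.norm_of_nonneg (by positivity), smul_eq_mul, hpow y hy0]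
      have : (1 + y) ^ (-(n:ℝ)) ≤ y ^ (-(n:ℝ)) :=
        Real.rpow_le_rpow_of_nonpos hy0 (by linarith) (by simp)
      calc y ^ ((n:ℝ) - 1) * ((1 + y) ^ (-(n:ℝ)) * y ^ (-p))
          ≤ y ^ ((n:ℝ) - 1) * (y ^ (-(n:ℝ)) * y ^ (-p)) := by gcongr
        _ = y ^ (-1 - p) := by
          rw [← Real.rpow_add hy0, ← Real.rpow_add hy0]; congr 1; ring
  have h := key.2
  rw [hasFiniteIntegral_iff_ofReal] at h
  · exact h
  · filter_upwards with z
    simp only [Pi.zero_apply]; positivity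

lemma rpow_lip (β : ℝ) : ∃ C : ℝ, 0 ≤ C ∧ ∀ t ∈ Icc (1/2 : ℝ) (3/2), |t ^ (-β) - 1| ≤ C * |t - 1| := by
  have hd : ∀ t ∈ Icc (1/2 : ℝ) (3/2), HasDerivWithinAt (fun t : ℝ => t ^ (-β)) (-β * t ^ (-β - 1))
      (Icc (1/2 : ℝ) (3/2)) t := by
    intro t ht
    exact (Real.hasDerivAt_rpow_const (Or.inl (by linarith [ht.1]))).hasDerivWithinAt
  have hcont : ContinuousOn (fun t : ℝ => -β * t ^ (-β - 1)) (Icc (1/2 : ℝ) (3/2)) := by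
    refine continuousOn_const.mul (ContinuousOn.rpow_const continuousOn_id ?_)
    intro t ht; left; show t ≠ 0; linarith [ht.1]
  obtain ⟨C, hC⟩ := isCompact_Icc.exists_bound_of_continuousOn hcont
  refine ⟨max C 0, le_max_right _ _, fun t ht => ?_⟩
  have := (convex_Icc (1/2 : ℝ) (3/2)).norm_image_sub_le_of_norm_hasDerivWithin_le hd
    (fun x hx => (hC x hx).trans (le_max_left C 0)) (show (1:ℝ) ∈ Icc (1/2 : ℝ) (3/2) by constructor <;> norm_num) ht
  simpa using this

/-- The kernel bounding the commutator. -/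
def kap {n : ℕ} (β : ℝ) (x y : Euc n) : ℝ := |‖x‖ ^ β * ‖y‖ ^ (-β) - 1| * ‖x - y‖ ^ (-(n:ℝ))

def gg {n : ℕ} (p : ℝ) (z : Euc n) : ℝ := (1 + ‖z‖) ^ (-(n:ℝ)) * ‖z‖ ^ (-p)

lemma kap_unit {n : ℕ} (hn : 1 ≤ n) (β : ℝ) : ∃ C : ℝ, 0 ≤ C ∧ ∀ e z : Euc n, ‖e‖ = 1 → z ≠ 0 → e ≠ z →
    kap β e z * ‖z‖ ^ (-(n/2 : ℝ)) ≤
      C * (gg ((n:ℝ) - 1) (e - z) + gg (n/2 + β) z + gg (n/2) z) := by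
  obtain ⟨C, hC0, hC⟩ := rpow_lip β
  refine ⟨C * 2 ^ (n/2:ℝ) * 2 ^ (n:ℝ) + 5 ^ (n:ℝ), by positivity, ?_⟩
  intro e z he hz hez
  have hz0 : 0 < ‖z‖ := norm_pos_iff.2 hz
  have hez0 : 0 < ‖e - z‖ := norm_pos_iff.2 (sub_ne_zero.2 hez)
  have hg1 : 0 ≤ gg ((n:ℝ) - 1) (e - z) := by unfold gg; positivity
  have hg2 : 0 ≤ gg (n/2 + β) z := by unfold gg; positivity
  have hg3 : 0 ≤ gg (n/2) z := by unfold gg; positivity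
  have htri : |‖z‖ - 1| ≤ ‖e - z‖ := by
    rw [← he, norm_sub_rev]; exact abs_norm_sub_norm_le z e
  have htri' := abs_le.1 htri
  have hA : (0:ℝ) ≤ C * 2 ^ (n/2:ℝ) * 2 ^ (n:ℝ) := by positivity
  have hB : (0:ℝ) ≤ 5 ^ (n:ℝ) := by positivity
  rcases lt_or_ge ‖e - z‖ (1/2) with h | h
  · have h1 : kap β e z * ‖z‖ ^ (-(n/2 : ℝ)) ≤ C * 2 ^ (n/2:ℝ) * 2 ^ (n:ℝ) * gg ((n:ℝ) - 1) (e - z) := by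
      unfold kap gg
      rw [he, Real.one_rpow, one_mul]
      have a1 : |‖z‖ ^ (-β) - 1| ≤ C * ‖e - z‖ :=
        (hC ‖z‖ ⟨by linarith, by linarith⟩).trans (by gcongr)
      have a2 : ‖z‖ ^ (-(n/2 : ℝ)) ≤ 2 ^ (n/2:ℝ) := by
        calc ‖z‖ ^ (-(n/2 : ℝ)) ≤ (1/2:ℝ) ^ (-(n/2 : ℝ)) :=
              Real.rpow_le_rpow_of_nonpos (by norm_num) (by linarith) (by simp; positivity)
          _ = _ := by rw [Real.rpow_neg (by norm_num), one_div, Real.inv_rpow (by norm_num), inv_inv]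
      have a3 : (2:ℝ) ^ (-(n : ℝ)) ≤ (1 + ‖e - z‖) ^ (-(n : ℝ)) :=
        Real.rpow_le_rpow_of_nonpos (by positivity) (by linarith) (by simp)
      have a4 : ‖e - z‖ * ‖e - z‖ ^ (-(n:ℝ)) = ‖e - z‖ ^ (-((n:ℝ) - 1)) := by
        nth_rewrite 1 [← Real.rpow_one ‖e - z‖]
        rw [← Real.rpow_add hez0]; congr 1; ring
      calc |‖z‖ ^ (-β) - 1| * ‖e - z‖ ^ (-(n:ℝ)) * ‖z‖ ^ (-(n/2 : ℝ))
          ≤ C * ‖e - z‖ * ‖e - z‖ ^ (-(n:ℝ)) * 2 ^ (n/2:ℝ) := by gcongr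
        _ = C * 2 ^ (n/2:ℝ) * (2 ^ (n:ℝ) * (2 ^ (-(n : ℝ)) * ‖e - z‖ ^ (-((n:ℝ) - 1)))) := by
            rw [← mul_assoc (2 ^ (n:ℝ)), Real.rpow_neg (by norm_num : (0:ℝ) ≤ 2), mul_inv_cancel₀ (by positivity), ← a4]
            ring
        _ ≤ C * 2 ^ (n/2:ℝ) * (2 ^ (n:ℝ) * ((1 + ‖e - z‖) ^ (-(n : ℝ)) * ‖e - z‖ ^ (-((n:ℝ) - 1)))) := by gcongr
        _ = _ := by ring
    nlinarith [mul_nonneg hA hg2, mul_nonneg hA hg3, mul_nonneg hB hg1, mul_nonneg hB hg2, mul_nonneg hB hg3]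
  · have h1 : kap β e z * ‖z‖ ^ (-(n/2 : ℝ)) ≤ 5 ^ (n:ℝ) * (gg (n/2 + β) z + gg (n/2) z) := by
      unfold kap gg
      rw [he, Real.one_rpow, one_mul]
      have a1 : |‖z‖ ^ (-β) - 1| ≤ ‖z‖ ^ (-β) + 1 := by
        rw [abs_le]; constructor <;> nlinarith [Real.rpow_nonneg hz0.le (-β)]
      have a2 : ‖e - z‖ ^ (-(n:ℝ)) ≤ 5 ^ (n:ℝ) * (1 + ‖z‖) ^ (-(n:ℝ)) := by
        calc ‖e - z‖ ^ (-(n:ℝ)) ≤ ((1 + ‖z‖) / 5) ^ (-(n:ℝ)) :=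
              Real.rpow_le_rpow_of_nonpos (by positivity) (by linarith) (by simp)
          _ = _ := by
            rw [Real.div_rpow (by positivity) (by norm_num), Real.rpow_neg (by norm_num : (0:ℝ) ≤ 5),
              div_inv_eq_mul, mul_comm]
      have a3 : ‖z‖ ^ (-(n/2 + β : ℝ)) = ‖z‖ ^ (-β) * ‖z‖ ^ (-(n/2 : ℝ)) := by
        rw [← Real.rpow_add hz0]; congr 1; ring
      calc |‖z‖ ^ (-β) - 1| * ‖e - z‖ ^ (-(n:ℝ)) * ‖z‖ ^ (-(n/2 : ℝ))
          ≤ (‖z‖ ^ (-β) + 1) * (5 ^ (n:ℝ) * (1 + ‖z‖) ^ (-(n:ℝ))) * ‖z‖ ^ (-(n/2 : ℝ)) := by gcongr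
        _ = _ := by rw [a3]; ring
    nlinarith [mul_nonneg hA hg2, mul_nonneg hA hg3, mul_nonneg hA hg1, mul_nonneg hB hg1]

lemma kap_schur {n : ℕ} (hn : 2 ≤ n) (β : ℝ) (hβ : |β| < n/2) : ∃ C : ℝ≥0, ∀ x : Euc n, x ≠ 0 →
    ∫⁻ y, ENNReal.ofReal (kap β x y) * ENNReal.ofReal (‖y‖ ^ (-(n/2:ℝ))) ≤
      C * ENNReal.ofReal (‖x‖ ^ (-(n/2:ℝ))) := by
  have hn1 : 1 ≤ n := by omega
  have hnR : (2:ℝ) ≤ n := by exact_mod_cast hn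
  have : Nonempty (Fin n) := ⟨⟨0, hn1⟩⟩
  obtain ⟨C, hC0, hC⟩ := kap_unit hn1 β (n := n)
  have hb := abs_lt.1 hβ
  have i1 := pint hn1 (p := (n:ℝ) - 1) (by linarith) (by linarith)
  have i2 := pint hn1 (p := n/2 + β) (by linarith) (by linarith)
  have i3 := pint hn1 (p := (n/2 : ℝ)) (by linarith) (by linarith)
  have mg : ∀ p : ℝ, Measurable (gg p : Euc n → ℝ) := by intro p; unfold gg; fun_prop
  obtain ⟨M, hM⟩ : ∃ M, M = ENNReal.ofReal C * ((∫⁻ z : Euc n, ENNReal.ofReal (gg ((n:ℝ)-1) z)) +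
    (∫⁻ z : Euc n, ENNReal.ofReal (gg (n/2 + β) z)) + (∫⁻ z : Euc n, ENNReal.ofReal (gg (n/2 : ℝ) z))) := ⟨_, rfl⟩
  have hfin : M < ⊤ := hM ▸ ENNReal.mul_lt_top ENNReal.ofReal_lt_top (ENNReal.add_lt_top.2 ⟨ENNReal.add_lt_top.2 ⟨i1, i2⟩, i3⟩)
  refine ⟨ENNReal.toNNReal M, fun x hx => ?_⟩
  · rw [ENNReal.coe_toNNReal hfin.ne, hM]
    have hx0 : 0 < ‖x‖ := norm_pos_iff.2 hx
    set e : Euc n := ‖x‖⁻¹ • x with he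
    have hen : ‖e‖ = 1 := by
      rw [he, norm_smul, norm_inv, norm_norm, inv_mul_cancel₀ hx0.ne']
    have hxe : x = ‖x‖ • e := by rw [he, smul_smul, mul_inv_cancel₀ hx0.ne', one_smul]
    rw [lintegral_scale _ hx0]
    have hpt : ∀ z : Euc n, z ≠ 0 → e ≠ z → ENNReal.ofReal (kap β x (‖x‖ • z)) * ENNReal.ofReal (‖‖x‖ • z‖ ^ (-(n/2:ℝ)))
        ≤ ENNReal.ofReal (‖x‖ ^ (-(n:ℝ)) * ‖x‖ ^ (-(n/2:ℝ))) * (ENNReal.ofReal C *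
          (ENNReal.ofReal (gg ((n:ℝ)-1) (e - z)) + ENNReal.ofReal (gg (n/2 + β) z) + ENNReal.ofReal (gg (n/2 : ℝ) z))) := by
      intro z hz hez
      have hz0 : 0 < ‖z‖ := norm_pos_iff.2 hz
      have g0 : ∀ (p : ℝ) (z : Euc n), 0 ≤ gg p z := by intro p z; unfold gg; positivity
      rw [← ENNReal.ofReal_add (g0 _ _) (g0 _ _), ← ENNReal.ofReal_add (add_nonneg (g0 _ _) (g0 _ _)) (g0 _ _),
        ← ENNReal.ofReal_mul hC0, ← ENNReal.ofReal_mul (p := kap _ _ _) (by unfold kap; positivity),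
        ← ENNReal.ofReal_mul (by positivity)]
      apply ENNReal.ofReal_le_ofReal
      have hk : kap β x (‖x‖ • z) = ‖x‖ ^ (-(n:ℝ)) * kap β e z := by
        unfold kap
        have e1 : x - ‖x‖ • z = ‖x‖ • (e - z) := by rw [smul_sub, ← hxe]
        rw [e1, norm_smul, norm_smul, norm_norm, hen, Real.mul_rpow hx0.le (norm_nonneg _),
          Real.mul_rpow hx0.le (norm_nonneg _), ← mul_assoc (‖x‖ ^ β), ← Real.rpow_add hx0]
        simp only [add_neg_cancel, Real.rpow_zero, Real.one_rpow]
        ring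
      rw [hk, norm_smul, norm_norm, Real.mul_rpow hx0.le (norm_nonneg _)]
      calc _ = (‖x‖ ^ (-(n:ℝ)) * ‖x‖ ^ (-(n/2:ℝ))) * (kap β e z * ‖z‖ ^ (-(n/2 : ℝ))) := by ring
        _ ≤ _ := by
          exact mul_le_mul_of_nonneg_left (hC e z hen hz hez) (by positivity)
    have hae : ∀ᵐ z : Euc n, z ≠ 0 ∧ e ≠ z := by
      filter_upwards [Measure.ae_ne volume (0 : Euc n), Measure.ae_ne volume e] with z h1 h2
      exact ⟨h1, h2.symm⟩
    have hle := lintegral_mono_ae (hae.mono fun z hz => hpt z hz.1 hz.2)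
    have m1 : Measurable fun z => ENNReal.ofReal (gg ((n:ℝ)-1) (e - z)) :=
      ENNReal.measurable_ofReal.comp ((mg _).comp (measurable_const.sub measurable_id))
    have m2 : ∀ p, Measurable fun z : Euc n => ENNReal.ofReal (gg p z) := fun p =>
      ENNReal.measurable_ofReal.comp (mg _)
    rw [lintegral_const_mul' _ _ ENNReal.ofReal_ne_top, lintegral_const_mul' _ _ ENNReal.ofReal_ne_top,
      lintegral_add_right _ (m2 _), lintegral_add_right _ (m2 _),
      lintegral_sub_left_eq_self (fun z : Euc n => ENNReal.ofReal (gg ((n:ℝ)-1) z)) e] at hle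
    refine (mul_le_mul_right hle _).trans ?_
    rw [← mul_assoc, ← ENNReal.ofReal_mul (by positivity), ← mul_assoc (‖x‖ ^ n), ← Real.rpow_natCast,
      ← Real.rpow_add hx0, add_neg_cancel, Real.rpow_zero, one_mul, mul_comm]

/-- Schur test on `L²`. -/
lemma schur {X : Type*} [MeasurableSpace X] {μ : Measure X} [SFinite μ] {K : X → X → ℝ≥0∞}
    (hK : Measurable (Function.uncurry K)) {h : X → ℝ≥0∞} (hh : Measurable h)
    (hpos : ∀ᵐ x ∂μ, h x ≠ 0 ∧ h x ≠ ⊤) {C : ℝ≥0}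
    (h1 : ∀ᵐ x ∂μ, ∫⁻ y, K x y * h y ∂μ ≤ C * h x)
    (h2 : ∀ᵐ y ∂μ, ∫⁻ x, K x y * h x ∂μ ≤ C * h y) {g : X → ℝ≥0∞} (hg : Measurable g) :
    ∫⁻ x, (∫⁻ y, K x y * g y ∂μ) ^ (2:ℝ) ∂μ ≤ (C : ℝ≥0∞) ^ (2:ℝ) * ∫⁻ y, g y ^ (2:ℝ) ∂μ := by
  have hKx : ∀ x, Measurable (K x) := fun x => hK.of_uncurry_left
  have hKy : ∀ y, Measurable (fun x => K x y) := fun y => hK.of_uncurry_right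
  have step1 : ∀ᵐ x ∂μ, (∫⁻ y, K x y * g y ∂μ) ^ (2:ℝ) ≤
      C * (∫⁻ y, h x * (K x y * (g y ^ (2:ℝ) * (h y)⁻¹)) ∂μ) := by
    filter_upwards [h1] with x hx
    have hcs := ENNReal.lintegral_mul_le_Lp_mul_Lq μ (p := 2) (q := 2)
      (by constructor <;> norm_num)
      (f := fun y => (K x y * h y) ^ (1/2:ℝ)) (g := fun y => (K x y * (g y ^ (2:ℝ) * (h y)⁻¹)) ^ (1/2:ℝ))
      (by have := hKx x; fun_prop) (by have := hKx x; fun_prop)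
    have e1 : ∀ a : ℝ≥0∞, (a ^ (1/2:ℝ)) ^ (2:ℝ) = a := by
      intro a; rw [← ENNReal.rpow_mul]; norm_num
    simp only [e1, Pi.mul_apply] at hcs
    have e2 : ∀ᵐ y ∂μ, (K x y * h y) ^ (1/2:ℝ) * (K x y * (g y ^ (2:ℝ) * (h y)⁻¹)) ^ (1/2:ℝ) = K x y * g y := by
      filter_upwards [hpos] with y hy
      rw [← ENNReal.mul_rpow_of_nonneg _ _ (by norm_num)]
      have : K x y * h y * (K x y * (g y ^ (2:ℝ) * (h y)⁻¹)) = (K x y * g y) ^ (2:ℝ) := by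
        rw [ENNReal.mul_rpow_of_nonneg _ _ (by norm_num : (0:ℝ) ≤ 2)]
        rw [ENNReal.rpow_two (K x y), sq]
        calc _ = K x y * K x y * g y ^ (2:ℝ) * (h y * (h y)⁻¹) := by ring
          _ = _ := by rw [ENNReal.mul_inv_cancel hy.1 hy.2, mul_one]
      rw [this, ← ENNReal.rpow_mul]; norm_num
    rw [lintegral_congr_ae e2] at hcs
    calc (∫⁻ y, K x y * g y ∂μ) ^ (2:ℝ) ≤ _ := ENNReal.rpow_le_rpow hcs (by norm_num)
      _ = (∫⁻ y, K x y * h y ∂μ) * ∫⁻ y, K x y * (g y ^ (2:ℝ) * (h y)⁻¹) ∂μ := by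
        rw [ENNReal.mul_rpow_of_nonneg _ _ (by norm_num), e1, e1]
      _ ≤ (C * h x) * ∫⁻ y, K x y * (g y ^ (2:ℝ) * (h y)⁻¹) ∂μ := by gcongr
      _ = _ := by
        rw [lintegral_const_mul _ (by have := hKx x; fun_prop), mul_assoc]
  calc _ ≤ ∫⁻ x, C * (∫⁻ y, h x * (K x y * (g y ^ (2:ℝ) * (h y)⁻¹)) ∂μ) ∂μ := lintegral_mono_ae step1
    _ = C * ∫⁻ x, (∫⁻ y, h x * (K x y * (g y ^ (2:ℝ) * (h y)⁻¹)) ∂μ) ∂μ := lintegral_const_mul' _ _ (by simp)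
    _ = C * ∫⁻ y, (∫⁻ x, h x * (K x y * (g y ^ (2:ℝ) * (h y)⁻¹)) ∂μ) ∂μ := by
      rw [lintegral_lintegral_swap]
      have : Measurable (fun p : X × X => K p.1 p.2) := hK
      refine Measurable.aemeasurable ?_
      unfold Function.uncurry
      fun_prop
    _ ≤ C * ∫⁻ y, C * g y ^ (2:ℝ) ∂μ := by
      refine mul_le_mul_right ?_ _
      refine lintegral_mono_ae ?_
      filter_upwards [h2, hpos] with y hy hp
      calc _ = ∫⁻ x, (K x y * h x) * (g y ^ (2:ℝ) * (h y)⁻¹) ∂μ := by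
            congr 1; ext x; ring
        _ = (∫⁻ x, (K x y * h x) ∂μ) * (g y ^ (2:ℝ) * (h y)⁻¹) :=
            lintegral_mul_const _ ((hKy y).mul hh)
        _ ≤ (C * h y) * (g y ^ (2:ℝ) * (h y)⁻¹) := by gcongr
        _ = C * g y ^ (2:ℝ) * (h y * (h y)⁻¹) := by ring
        _ = _ := by rw [ENNReal.mul_inv_cancel hp.1 hp.2, mul_one]
    _ = _ := by
      rw [lintegral_const_mul' _ _ (by simp), ENNReal.rpow_two, sq, mul_assoc]


lemma integrableOn_ball_pow {n : ℕ} (hn : 1 ≤ n) {q : ℝ} (hq : -(n:ℝ) < q) {R : ℝ} (hR : 0 < R) :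
    IntegrableOn (fun x : Euc n => ‖x‖ ^ q) (ball 0 R) := by
  have : Nonempty (Fin n) := ⟨⟨0, hn⟩⟩
  refine (integrableOn_fun_norm_addHaar (volume : Measure (Euc n)) (f := fun y : ℝ => y ^ q)).2 ?_
  rw [finrank_euclideanSpace_fin]
  have h1 : IntegrableOn (fun y : ℝ => y ^ ((n:ℝ) - 1 + q)) (Ioo 0 R) := by
    have : IntegrableOn (fun y : ℝ => y ^ ((n:ℝ) - 1 + q)) (Ioc 0 R) := by
      rw [← intervalIntegrable_iff_integrableOn_Ioc_of_le hR.le]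
      exact intervalIntegral.intervalIntegrable_rpow' (by linarith)
    exact this.mono_set Ioo_subset_Ioc_self
  refine h1.congr_fun ?_ measurableSet_Ioo
  intro y hy
  simp only [smul_eq_mul]
  rw [Real.rpow_add hy.1, ← Real.rpow_natCast, Nat.cast_sub hn, Nat.cast_one]

lemma integrable_pow_mul {n : ℕ} (hn : 1 ≤ n) {q : ℝ} (hq : -(n:ℝ) < q) {h : Euc n → ℝ}
    (hc : Continuous h) (hs : HasCompactSupport h) : Integrable (fun x => ‖x‖ ^ q * h x) := by
  obtain ⟨M, hM⟩ := hc.bounded_above_of_compact_support hs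
  obtain ⟨R, hR⟩ := hs.isBounded.subset_ball 0
  have hR' : tsupport h ⊆ ball 0 (max R 1) := hR.trans (ball_subset_ball (le_max_left _ _))
  have hi := (integrableOn_ball_pow hn hq (R := max R 1) (by positivity)).integrable_indicator measurableSet_ball
  refine (hi.mul_const M).mono' (by
    have := hc.measurable
    exact Measurable.aestronglyMeasurable (by fun_prop)) ?_
  filter_upwards with x
  by_cases hx : x ∈ ball (0 : Euc n) (max R 1)
  · rw [indicator_of_mem hx, norm_mul, Real.norm_of_nonneg (by positivity)]
    exact mul_le_mul_of_nonneg_left (hM x) (by positivity)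
  · have : h x = 0 := image_eq_zero_of_notMem_tsupport fun hh => hx (hR' hh)
    rw [this, indicator_of_notMem hx]; simp

lemma wL2_eq {n : ℕ} (β : ℝ) (f : Euc n → ℂ) :
    wL2 β (fun x => (‖f x‖₊ : ℝ≥0∞)) = eLpNorm (fun x => ((‖x‖ ^ β : ℝ) : ℂ) * f x) 2 volume := by
  rw [eLpNorm_eq_lintegral_rpow_enorm_toReal (by norm_num) (by norm_num)]
  unfold wL2
  simp only [ENNReal.toReal_ofNat, enorm_mul]
  congr 2
  ext x
  congr 2
  rw [← ofReal_norm_eq_enorm, Complex.norm_real, Real.norm_of_nonneg (by positivity)]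

lemma weight_integrable {n : ℕ} (hn : 1 ≤ n) {β : ℝ} (hβ : -(n/2:ℝ) < β) {f : Euc n → ℂ}
    (hc : Continuous f) (hs : HasCompactSupport f) :
    Integrable (fun x => ((‖x‖ ^ β : ℝ) : ℂ) * f x) ∧
    MemLp (fun x => ((‖x‖ ^ β : ℝ) : ℂ) * f x) 2 volume := by
  have hn0 : (0:ℝ) < n := by exact_mod_cast hn
  have hmeas : AEStronglyMeasurable (fun x => ((‖x‖ ^ β : ℝ) : ℂ) * f x) volume := by
    have := hc.measurable
    exact Measurable.aestronglyMeasurable (by fun_prop)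
  constructor
  · refine (integrable_norm_iff hmeas).1 ?_
    have := integrable_pow_mul hn (q := β) (by linarith) hc.norm hs.norm
    refine this.congr (Filter.Eventually.of_forall fun x => ?_)
    simp only [norm_mul, Complex.norm_real]
    rw [Real.norm_of_nonneg (by positivity)]
  · rw [memLp_two_iff_integrable_sq_norm hmeas]
    have := integrable_pow_mul hn (q := β * 2) (h := fun x => ‖f x‖ ^ 2) (by linarith) (by fun_prop)
      (hs.comp_left (g := fun z : ℂ => ‖z‖ ^ 2) (by simp))
    refine this.congr (Filter.Eventually.of_forall fun x => ?_)
    simp only [norm_mul, Complex.norm_real]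
    rw [Real.norm_of_nonneg (by positivity), mul_pow, Real.rpow_mul (norm_nonneg _), Real.rpow_two]

lemma wL2_lt_top {n : ℕ} (hn : 1 ≤ n) {β : ℝ} (hβ : -(n/2:ℝ) < β) {f : Euc n → ℂ}
    (hc : Continuous f) (hs : HasCompactSupport f) : wL2 β (fun x => (‖f x‖₊ : ℝ≥0∞)) < ⊤ := by
  rw [wL2_eq]
  exact (weight_integrable hn hβ hc hs).2.2

lemma kap_measurable {n : ℕ} (β : ℝ) :
    Measurable (Function.uncurry (fun x y : Euc n => ENNReal.ofReal (kap β x y))) := by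
  unfold Function.uncurry kap
  fun_prop

lemma kap_op {n : ℕ} (hn : 2 ≤ n) (β : ℝ) (hβ : |β| < n/2) : ∃ C : ℝ≥0, ∀ g : Euc n → ℝ≥0∞, Measurable g →
    (∫⁻ x, (∫⁻ y, ENNReal.ofReal (kap β x y) * g y) ^ (2:ℝ)) ^ (1/2 : ℝ) ≤
      C * (∫⁻ y, g y ^ (2:ℝ)) ^ (1/2 : ℝ) := by
  have : Nonempty (Fin n) := ⟨⟨0, by omega⟩⟩
  obtain ⟨C1, h1⟩ := kap_schur hn β hβ
  obtain ⟨C2, h2⟩ := kap_schur hn (-β) (by rwa [abs_neg])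
  refine ⟨max C1 C2, fun g hg => ?_⟩
  have hne := Measure.ae_ne volume (0 : Euc n)
  have key := schur (μ := (volume : Measure (Euc n))) (kap_measurable β)
    (h := fun y => ENNReal.ofReal (‖y‖ ^ (-(n/2:ℝ)))) (by fun_prop) (C := max C1 C2) (by
      filter_upwards [hne] with x hx
      have : 0 < ‖x‖ := norm_pos_iff.2 hx
      refine ⟨?_, ENNReal.ofReal_ne_top⟩
      have : 0 < ‖x‖ ^ (-(n/2:ℝ)) := by positivity
      simpa using this) (by
      filter_upwards [hne] with x hx
      refine (h1 x hx).trans ?_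
      gcongr
      exact le_max_left _ _) (by
      filter_upwards [hne] with y hy
      refine le_trans (le_of_eq ?_) ((h2 y hy).trans ?_)
      · congr 1; ext x; congr 2
        unfold kap
        rw [norm_sub_rev, neg_neg, mul_comm (‖x‖ ^ β)]
      · gcongr
        exact le_max_right _ _) hg
  calc _ ≤ _ := ENNReal.rpow_le_rpow key (by norm_num)
    _ = _ := by
      rw [ENNReal.mul_rpow_of_nonneg _ _ (by norm_num), ← ENNReal.rpow_mul]
      norm_num

lemma commut_bound {n : ℕ} (hn : 1 ≤ n) {β : ℝ} (hβ : -(n/2:ℝ) < β) {A : ℝ≥0} {m : Euc n → ℂ} (hm : Integrable m)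
    (hk : ∀ x, x ≠ 0 → ‖𝓕⁻ m x‖ ≤ A * ‖x‖ ^ (-(n:ℝ))) {f : Euc n → ℂ}
    (hc : Continuous f) (hs : HasCompactSupport f) (x : Euc n) :
    ENNReal.ofReal (‖x‖ ^ β) * (‖𝓕⁻ (fun ξ => m ξ * 𝓕 f ξ) x‖₊ : ℝ≥0∞) ≤
      ‖𝓕⁻ (fun ξ => m ξ * 𝓕 (fun x => ((‖x‖ ^ β : ℝ) : ℂ) * f x) ξ) x‖ₑ +
      A * ∫⁻ y, ENNReal.ofReal (kap β x y) * ‖((‖y‖ ^ β : ℝ) : ℂ) * f y‖ₑ := by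
  have : Nonempty (Fin n) := ⟨⟨0, by omega⟩⟩
  obtain ⟨hg1, hg2⟩ := weight_integrable hn hβ hc hs
  have hf : Integrable f := hc.integrable_of_hasCompactSupport hs
  rw [mult_eq_conv hm hf, mult_eq_conv hm hg1]
  have hkc : Continuous (fun y => 𝓕⁻ m (x - y)) :=
    (continuous_fourierInv' hm).comp (continuous_const.sub continuous_id)
  have hkb : ∀ y, ‖𝓕⁻ m (x - y)‖ ≤ ∫ x, ‖m x‖ := by
    intro y; rw [Real.fourierInv_eq_fourier_neg]; exact norm_fourier_le _ _
  have i1 : Integrable (fun y => 𝓕⁻ m (x - y) * f y) :=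
    hf.bdd_mul hkc.aestronglyMeasurable (Filter.Eventually.of_forall hkb)
  have i2 : Integrable (fun y => 𝓕⁻ m (x - y) * (((‖y‖ ^ β : ℝ) : ℂ) * f y)) :=
    hg1.bdd_mul hkc.aestronglyMeasurable (Filter.Eventually.of_forall hkb)
  have e0 : ENNReal.ofReal (‖x‖ ^ β) = ‖((‖x‖ ^ β : ℝ) : ℂ)‖ₑ := by
    rw [← ofReal_norm_eq_enorm, Complex.norm_real, Real.norm_of_nonneg (by positivity)]
  rw [← enorm_eq_nnnorm, e0, ← enorm_mul]
  have e1 : ((‖x‖ ^ β : ℝ) : ℂ) * ∫ y, 𝓕⁻ m (x - y) * f y =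
      (∫ y, 𝓕⁻ m (x - y) * (((‖y‖ ^ β : ℝ) : ℂ) * f y)) +
      ∫ y, (((‖x‖ ^ β : ℝ) : ℂ) * (𝓕⁻ m (x - y) * f y) - 𝓕⁻ m (x - y) * (((‖y‖ ^ β : ℝ) : ℂ) * f y)) := by
    rw [integral_sub (i1.const_mul _) i2, integral_const_mul]; ring
  rw [e1]
  refine (enorm_add_le _ _).trans ?_
  gcongr
  refine (enorm_integral_le_lintegral_enorm _).trans ?_
  rw [← lintegral_const_mul' _ _ (by simp)]
  apply lintegral_mono_ae
  filter_upwards [Measure.ae_ne volume (0 : Euc n), Measure.ae_ne volume x] with y hy hyx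
  have hy0 : 0 < ‖y‖ := norm_pos_iff.2 hy
  have hxy : x - y ≠ 0 := sub_ne_zero.2 hyx.symm
  rw [← ofReal_norm_eq_enorm, ← ofReal_norm_eq_enorm, ← ENNReal.ofReal_coe_nnreal,
    ← ENNReal.ofReal_mul (by unfold kap; positivity), ← ENNReal.ofReal_mul (by positivity)]
  apply ENNReal.ofReal_le_ofReal
  have e2 : ((‖x‖ ^ β : ℝ) : ℂ) * (𝓕⁻ m (x - y) * f y) - 𝓕⁻ m (x - y) * (((‖y‖ ^ β : ℝ) : ℂ) * f y)
     = 𝓕⁻ m (x - y) * ((((‖x‖ ^ β * ‖y‖ ^ (-β) - 1) * ‖y‖ ^ β : ℝ) : ℂ) * f y) := by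
    have : (‖x‖ ^ β * ‖y‖ ^ (-β) - 1) * ‖y‖ ^ β = ‖x‖ ^ β - ‖y‖ ^ β := by
      rw [sub_mul, mul_assoc, ← Real.rpow_add hy0]; simp
    rw [this]; push_cast; ring
  rw [e2]
  unfold kap
  simp only [norm_mul, Complex.norm_real, Real.norm_eq_abs]
  calc _ ≤ (A * ‖x - y‖ ^ (-(n:ℝ))) * (|‖x‖ ^ β * ‖y‖ ^ (-β) - 1| * |‖y‖ ^ β| * ‖f y‖) := by
        gcongr
        · exact hk _ hxy
    _ = _ := by ring

lemma weighted_mult {n : ℕ} (hn : 2 ≤ n) (β : ℝ) (hβ : |β| < n/2) : ∃ C : ℝ≥0, ∀ (A : ℝ≥0) (m : Euc n → ℂ),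
    Integrable m → (∀ ξ, ‖m ξ‖ ≤ A) → (∀ x, x ≠ 0 → ‖𝓕⁻ m x‖ ≤ A * ‖x‖ ^ (-(n:ℝ))) →
    ∀ f : Euc n → ℂ, Continuous f → HasCompactSupport f →
      wL2 β (fun x => (‖𝓕⁻ (fun ξ => m ξ * 𝓕 f ξ) x‖₊ : ℝ≥0∞)) ≤
        C * A * wL2 β (fun x => (‖f x‖₊ : ℝ≥0∞)) := by
  obtain ⟨C, hC⟩ := kap_op hn β hβ
  refine ⟨1 + C, fun A m hm hb hk f hc hs => ?_⟩
  have hβ1 := (abs_lt.1 hβ).1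
  have hn1 : 1 ≤ n := by omega
  obtain ⟨hg1, hg2⟩ := weight_integrable hn1 hβ1 hc hs
  have hgm : Measurable (fun x => ((‖x‖ ^ β : ℝ) : ℂ) * f x) := by
    have := hc.measurable
    fun_prop
  have hcb := commut_bound hn1 hβ1 hm hk hc hs
  rw [wL2_eq β f]
  set g : Euc n → ℂ := fun x => ((‖x‖ ^ β : ℝ) : ℂ) * f x with hg
  obtain ⟨hFg, hFg'⟩ := memLp_fourier hg1 hg2
  have hi1 : Integrable (fun ξ => m ξ * 𝓕 g ξ) :=
    hm.mul_bdd (c := ∫ x, ‖g x‖) (continuous_fourier' hg1).aestronglyMeasurable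
      (Filter.Eventually.of_forall (norm_fourier_le g))
  have hpt : ∀ ξ, ‖m ξ * 𝓕 g ξ‖ ≤ A * ‖𝓕 g ξ‖ := fun ξ => by
    rw [norm_mul]; exact mul_le_mul_of_nonneg_right (hb ξ) (norm_nonneg _)
  have hi2 : MemLp (fun ξ => m ξ * 𝓕 g ξ) 2 volume :=
    hFg.of_le_mul hi1.1 (Filter.Eventually.of_forall hpt)
  have hT : eLpNorm (𝓕⁻ (fun ξ => m ξ * 𝓕 g ξ)) 2 volume ≤ A * eLpNorm g 2 volume := by
    rw [memLp_fourierInv hi1 hi2, ← hFg']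
    have := eLpNorm_le_nnreal_smul_eLpNorm_of_ae_le_mul (f := fun ξ => m ξ * 𝓕 g ξ) (g := 𝓕 g) (c := A)
      (μ := volume) (Filter.Eventually.of_forall fun ξ => by exact_mod_cast hpt ξ) 2
    rw [ENNReal.smul_def, smul_eq_mul] at this
    exact this
  have hgn : (∫⁻ y, ‖g y‖ₑ ^ (2:ℝ)) ^ (1/2 : ℝ) = eLpNorm g 2 volume := by
    rw [eLpNorm_eq_lintegral_rpow_enorm_toReal (by norm_num) (by norm_num)]
    simp
  have hE := hC (fun y => ‖g y‖ₑ) hgm.enorm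
  rw [hgn] at hE
  unfold wL2
  have mT : Measurable fun x => ‖𝓕⁻ (fun ξ => m ξ * 𝓕 g ξ) x‖ₑ :=
    (continuous_fourierInv' hi1).measurable.enorm
  have mE : Measurable fun x => ∫⁻ y, ENNReal.ofReal (kap β x y) * ‖g y‖ₑ := by
    refine Measurable.lintegral_prod_right' (f := fun p : Euc n × Euc n => ENNReal.ofReal (kap β p.1 p.2) * ‖g p.2‖ₑ) ?_
    exact (kap_measurable β).mul (hgm.enorm.comp measurable_snd)
  have hmink := ENNReal.lintegral_Lp_add_le (μ := (volume : Measure (Euc n))) (p := 2)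
    (f := fun x => ‖𝓕⁻ (fun ξ => m ξ * 𝓕 g ξ) x‖ₑ)
    (g := fun x => A * ∫⁻ y, ENNReal.ofReal (kap β x y) * ‖g y‖ₑ) mT.aemeasurable
    (mE.const_mul _).aemeasurable (by norm_num)
  have hTe : (∫⁻ x, ‖𝓕⁻ (fun ξ => m ξ * 𝓕 g ξ) x‖ₑ ^ (2:ℝ)) ^ (1/2 : ℝ) = eLpNorm (𝓕⁻ (fun ξ => m ξ * 𝓕 g ξ)) 2 volume := by
    rw [eLpNorm_eq_lintegral_rpow_enorm_toReal (by norm_num) (by norm_num)]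
    simp
  calc _ ≤ (∫⁻ x, (‖𝓕⁻ (fun ξ => m ξ * 𝓕 g ξ) x‖ₑ + A * ∫⁻ y, ENNReal.ofReal (kap β x y) * ‖g y‖ₑ) ^ (2:ℝ)) ^ (1/2:ℝ) := by
        refine ENNReal.rpow_le_rpow (lintegral_mono fun x => ENNReal.rpow_le_rpow (hcb x) (by norm_num)) (by norm_num)
    _ ≤ _ := hmink
    _ ≤ A * eLpNorm g 2 volume + A * (C * eLpNorm g 2 volume) := by
        refine add_le_add (hTe.trans_le hT) ?_
        simp only [ENNReal.mul_rpow_of_nonneg _ _ (by norm_num : (0:ℝ) ≤ 2)]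
        rw [lintegral_const_mul' _ _ (by simp), ENNReal.mul_rpow_of_nonneg _ _ (by norm_num), ← ENNReal.rpow_mul]
        norm_num only [ENNReal.rpow_one]
        gcongr
    _ = _ := by push_cast; ring



lemma schwartz_decay_max {n : ℕ} (Ψ : SchwartzMap (Euc n) ℂ) (k : ℕ) : ∃ C : ℝ, 0 ≤ C ∧
    ∀ x, ‖x‖ ^ k * ‖Ψ x‖ ≤ C := by
  obtain ⟨C, hC, h⟩ := Ψ.decay k 0
  exact ⟨C, hC.le, fun x => by simpa using h x⟩

lemma schwartz_min {n : ℕ} (hn : 2 ≤ n) (Ψ : SchwartzMap (Euc n) ℂ) (h0 : Ψ 0 = 0) : ∃ C : ℝ≥0,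
    (∀ η, ‖Ψ η‖ ≤ C * min ‖η‖ ‖η‖⁻¹) ∧
    (∀ z, z ≠ 0 → ‖𝓕⁻ (Ψ : Euc n → ℂ) z‖ ≤ C * ‖z‖ ^ (-(n:ℝ)) * min ‖z‖ ‖z‖⁻¹) := by
  obtain ⟨C1, hC1, h1⟩ := Ψ.decay 0 1
  obtain ⟨C2, hC2, h2⟩ := schwartz_decay_max Ψ 1
  obtain ⟨C3, hC3, h3⟩ := schwartz_decay_max (𝓕⁻ Ψ) (n-1)
  obtain ⟨C4, hC4, h4⟩ := schwartz_decay_max (𝓕⁻ Ψ) (n+1)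
  have hl : ∀ η, ‖Ψ η‖ ≤ C1 * ‖η‖ := by
    intro η
    have := Convex.norm_image_sub_le_of_norm_fderiv_le (f := Ψ) (s := univ) (x := 0) (y := η) (C := C1) (𝕜 := ℝ)
      (fun x _ => Ψ.differentiableAt) (fun x _ => by simpa using h1 x) convex_univ (mem_univ _) (mem_univ _)
    simpa [h0] using this
  refine ⟨(C1 + C2 + C3 + C4).toNNReal, fun η => ?_, fun z hz => ?_⟩
  · rw [Real.coe_toNNReal _ (by positivity)]
    rcases eq_or_ne η 0 with rfl | hη
    · simp [h0]
    have hp : 0 < ‖η‖ := norm_pos_iff.2 hη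
    rw [mul_min_of_nonneg _ _ (by positivity)]
    refine le_min ((hl η).trans (by gcongr; linarith)) ?_
    rw [← div_eq_mul_inv, le_div_iff₀ hp]
    have := h2 η
    rw [pow_one] at this
    linarith
  · rw [Real.coe_toNNReal _ (by positivity)]
    have hp : 0 < ‖z‖ := norm_pos_iff.2 hz
    rw [mul_min_of_nonneg _ _ (by positivity)]
    have h3' := h3 z
    have h4' := h4 z
    rw [← SchwartzMap.fourierInv_coe]
    rw [Real.rpow_neg hp.le, Real.rpow_natCast]
    obtain ⟨k, rfl⟩ : ∃ k, n = k + 1 := ⟨n-1, by omega⟩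
    simp only [Nat.add_sub_cancel] at h3'
    refine le_min ?_ ?_
    · have e : (C1 + C2 + C3 + C4) * (‖z‖^(k+1))⁻¹ * ‖z‖ = (C1 + C2 + C3 + C4) / ‖z‖^k := by
        field_simp
        ring
      rw [e, le_div_iff₀ (by positivity)]
      linarith
    · have e : (C1 + C2 + C3 + C4) * (‖z‖^(k+1))⁻¹ * ‖z‖⁻¹ = (C1 + C2 + C3 + C4) / ‖z‖^(k+1+1) := by
        field_simp
        ring
      rw [e, le_div_iff₀ (by positivity)]
      linarith

lemma time_integrable {n : ℕ} (Ψ : SchwartzMap (Euc n) ℂ) {a b : ℝ} (ha : 0 < a) (p : ℝ) :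
    Integrable (fun q : ℝ × Euc n => ((q.1 ^ (-p) : ℝ) : ℂ) * Ψ (q.1 • q.2))
      ((volume.restrict (Ioc a b)).prod volume) := by
  obtain ⟨K, hK⟩ : ∃ K : ℝ, ∀ x, ‖Ψ x‖ ≤ K * (1 + ‖x‖) ^ (-((n:ℝ)+1)) := by
    have := fun x => SchwartzMap.one_add_le_sup_seminorm_apply (𝕜 := ℝ) (m := (n+1, 0)) (k := n+1) (n := 0) le_rfl le_rfl Ψ x
    refine ⟨2 ^ (n + 1) * ((Finset.Iic (n + 1, 0)).sup fun m => SchwartzMap.seminorm ℝ m.1 m.2) Ψ, fun x => ?_⟩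
    · have h := this x
      rw [norm_iteratedFDeriv_zero] at h
      rw [Real.rpow_neg (by positivity), ← div_eq_mul_inv, le_div_iff₀ (by positivity)]
      rw [mul_comm]
      have e : (1 + ‖x‖) ^ ((n:ℝ)+1) = (1 + ‖x‖) ^ (n + 1) := by
        exact_mod_cast Real.rpow_natCast (1 + ‖x‖) (n+1)
      rw [e]
      exact h
  have hK0 : 0 ≤ K := by
    have := hK 0
    simp at this
    exact (norm_nonneg _).trans this
  have hG : Integrable (fun x : Euc n => (1 + ‖a • x‖) ^ (-((n:ℝ)+1))) := by
    refine (integrable_comp_smul_iff volume (fun x : Euc n => (1 + ‖x‖) ^ (-((n:ℝ)+1))) ha.ne').2 ?_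
    exact integrable_one_add_norm (by simp)
  have hr : Integrable (fun t : ℝ => t ^ (-p)) (volume.restrict (Ioc a b)) := by
    refine IntegrableOn.mono_set ?_ Ioc_subset_Icc_self
    refine ContinuousOn.integrableOn_compact isCompact_Icc ?_
    intro t ht
    exact (Real.continuousAt_rpow_const _ _ (Or.inl (ha.trans_le ht.1).ne')).continuousWithinAt
  refine Integrable.mono' ((hr.mul_prod hG).const_mul K) ?_ ?_
  · refine AEStronglyMeasurable.mul ?_ ?_
    · have : Measurable (fun q : ℝ × Euc n => ((q.1 ^ (-p) : ℝ) : ℂ)) := by fun_prop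
      exact this.aestronglyMeasurable
    · have : Continuous (fun q : ℝ × Euc n => Ψ (q.1 • q.2)) := by
        have := Ψ.continuous
        fun_prop
      exact this.aestronglyMeasurable
  · have : ∀ᵐ q ∂((volume.restrict (Ioc a b)).prod (volume : Measure (Euc n))), q.1 ∈ Ioc a b :=
      Measure.quasiMeasurePreserving_fst.ae (ae_restrict_mem measurableSet_Ioc)
    filter_upwards [this] with q hq
    have hq0 : 0 < q.1 := ha.trans hq.1
    rw [norm_mul, Complex.norm_real, Real.norm_of_nonneg (by positivity)]
    rw [mul_left_comm]
    gcongr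
    refine (hK _).trans ?_
    gcongr K * ?_
    refine Real.rpow_le_rpow_of_nonpos (by positivity) ?_ (by linarith [(Nat.cast_nonneg n : (0:ℝ) ≤ n)])
    rw [norm_smul, norm_smul, Real.norm_of_nonneg ha.le, Real.norm_of_nonneg hq0.le]
    gcongr
    exact hq.1.le

lemma fourierInv_scale {n : ℕ} (Ψ : Euc n → ℂ) {t : ℝ} (ht : 0 < t) (x : Euc n) :
    𝓕⁻ (fun ξ => Ψ (t • ξ)) x = ((t ^ (-(n:ℝ)) : ℝ) : ℂ) * 𝓕⁻ Ψ (t⁻¹ • x) := by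
  rw [Real.fourierInv_eq, Real.fourierInv_eq]
  have := Measure.integral_comp_smul (volume : Measure (Euc n))
    (fun v => Real.fourierChar (inner ℝ v (t⁻¹ • x)) • Ψ v) t
  have e : ∀ v : Euc n, inner ℝ (t • v) (t⁻¹ • x) = inner ℝ v x := by
    intro v
    rw [inner_smul_left, inner_smul_right]
    simp; field_simp
  simp only [e] at this
  rw [this]
  rw [finrank_euclideanSpace_fin, abs_of_pos (by positivity), Real.rpow_neg ht.le, Real.rpow_natCast]
  rfl

lemma mult_time {n : ℕ} (hn : 2 ≤ n) (β : ℝ) (hβ : |β| < n/2) (Ψ : SchwartzMap (Euc n) ℂ) (h0 : Ψ 0 = 0) :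
    ∃ C : ℝ≥0, ∀ (a b p : ℝ), 0 < a → ∀ A : ℝ≥0,
      (∀ l : ℝ, 0 < l → ∫ t in Ioc a b, t ^ (-p) * min (t * l) (t * l)⁻¹ ≤ A) →
      ∀ f : Euc n → ℂ, Continuous f → HasCompactSupport f →
      wL2 β (fun x => (‖𝓕⁻ (fun ξ => (∫ t in Ioc a b, ((t ^ (-p) : ℝ) : ℂ) * Ψ (t • ξ)) * 𝓕 f ξ) x‖₊ : ℝ≥0∞)) ≤
        C * A * wL2 β (fun x => (‖f x‖₊ : ℝ≥0∞)) := by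
  obtain ⟨C0, hC0⟩ := weighted_mult hn β hβ
  obtain ⟨K, hK1, hK2⟩ := schwartz_min hn Ψ h0
  refine ⟨C0 * K, fun a b p ha A hA f hf hfs => ?_⟩
  have hint := time_integrable (b := b) Ψ ha p
  have hmi : ∀ l : ℝ, 0 < l → IntegrableOn (fun t : ℝ => t ^ (-p) * min (t * l) (t * l)⁻¹) (Ioc a b) := by
    intro l hl
    refine IntegrableOn.mono_set ?_ Ioc_subset_Icc_self
    refine ContinuousOn.integrableOn_compact isCompact_Icc ?_
    intro t ht
    have ht0 := ha.trans_le ht.1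
    refine ContinuousAt.continuousWithinAt ?_
    refine (Real.continuousAt_rpow_const _ _ (Or.inl ht0.ne')).mul ?_
    refine Filter.Tendsto.min (by exact (show Continuous (fun t : ℝ => t * l) by fun_prop).continuousAt) ?_
    refine ContinuousAt.inv₀ (by fun_prop) (by positivity)
  have key := hC0 (K * A) (fun ξ => ∫ t in Ioc a b, ((t ^ (-p) : ℝ) : ℂ) * Ψ (t • ξ))
    hint.integral_prod_right ?_ ?_ f hf hfs
  · refine key.trans (le_of_eq ?_)
    push_cast; ring
  · intro ξ
    rcases eq_or_ne ξ 0 with rfl | hξ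
    · simp [h0]; positivity
    have hp : 0 < ‖ξ‖ := norm_pos_iff.2 hξ
    refine (norm_integral_le_of_norm_le ((hmi ‖ξ‖ hp).const_mul K) ?_).trans ?_
    · filter_upwards [ae_restrict_mem measurableSet_Ioc] with t ht
      have ht0 : 0 < t := ha.trans ht.1
      rw [norm_mul, Complex.norm_real, Real.norm_of_nonneg (by positivity), mul_left_comm]
      gcongr
      have := hK1 (t • ξ)
      rwa [norm_smul, Real.norm_of_nonneg ht0.le] at this
    · rw [integral_const_mul]
      push_cast
      gcongr
      exact hA _ hp
  · intro x hx
    have hp : 0 < ‖x‖ := norm_pos_iff.2 hx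
    have e : 𝓕⁻ (fun ξ => ∫ t in Ioc a b, ((t ^ (-p) : ℝ) : ℂ) * Ψ (t • ξ)) x
        = ∫ t in Ioc a b, ((t ^ (-p) : ℝ) : ℂ) * 𝓕⁻ (fun ξ => Ψ (t • ξ)) x := by
      rw [Real.fourierInv_eq]
      simp only [Real.fourierInv_eq, ← integral_const_mul, Circle.smul_def, smul_eq_mul]
      rw [integral_integral_swap]
      · refine integral_congr_ae (.of_forall fun t => ?_)
        refine integral_congr_ae (.of_forall fun ξ => ?_)
        simp only []; ring
      · refine Integrable.mono hint.swap ?_ ?_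
        · refine AEStronglyMeasurable.mul ?_ hint.swap.1
          have : Continuous (fun q : Euc n × ℝ => (Real.fourierChar (inner ℝ q.1 x) : ℂ)) := by
            have := Real.continuous_fourierChar
            fun_prop
          exact this.aestronglyMeasurable
        · refine .of_forall fun q => ?_
          rcases q with ⟨q1, q2⟩
          simp [Function.uncurry, norm_mul, Circle.norm_coe]
    rw [e]
    refine (norm_integral_le_of_norm_le ((hmi ‖x‖⁻¹ (by positivity)).const_mul (K * ‖x‖ ^ (-(n:ℝ)))) ?_).trans ?_
    · filter_upwards [ae_restrict_mem measurableSet_Ioc] with t ht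
      have ht0 : 0 < t := ha.trans ht.1
      rw [norm_mul, Complex.norm_real, Real.norm_of_nonneg (by positivity), mul_left_comm]
      gcongr
      rw [fourierInv_scale _ ht0, norm_mul, Complex.norm_real, Real.norm_of_nonneg (by positivity)]
      have := hK2 (t⁻¹ • x) (by simp [ht0.ne', hx])
      rw [norm_smul, Real.norm_of_nonneg (by positivity)] at this
      refine (mul_le_mul_of_nonneg_left this (by positivity)).trans (le_of_eq ?_)
      · rw [Real.mul_rpow (by positivity) (by positivity), Real.inv_rpow ht0.le, min_comm]
        have e1 : (t⁻¹ * ‖x‖)⁻¹ = t * ‖x‖⁻¹ := by field_simp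
        have e2 : t⁻¹ * ‖x‖ = (t * ‖x‖⁻¹)⁻¹ := by field_simp
        rw [e1, e2]
        have : t ^ (-(n:ℝ)) ≠ 0 := by positivity
        field_simp
    · rw [integral_const_mul]
      push_cast
      calc _ ≤ K * ‖x‖ ^ (-(n:ℝ)) * A := by
            gcongr
            exact hA _ (by positivity)
        _ = _ := by ring



lemma wL2_mono {n : ℕ} (β : ℝ) {f g : Euc n → ℝ≥0∞} (h : ∀ x, f x ≤ g x) : wL2 β f ≤ wL2 β g := by
  unfold wL2
  gcongr
  exact h _

lemma weight_meas {n : ℕ} (β : ℝ) {f : Euc n → ℂ} (hf : Continuous f) :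
    AEStronglyMeasurable (fun x => ((‖x‖ ^ β : ℝ) : ℂ) * f x) volume := by
  have := hf.measurable
  exact Measurable.aestronglyMeasurable (by fun_prop)

lemma wL2_add {n : ℕ} (β : ℝ) {f g : Euc n → ℂ} (hf : Continuous f) (hg : Continuous g) :
    wL2 β (fun x => (‖f x + g x‖₊ : ℝ≥0∞)) ≤
      wL2 β (fun x => (‖f x‖₊ : ℝ≥0∞)) + wL2 β (fun x => (‖g x‖₊ : ℝ≥0∞)) := by
  rw [wL2_eq, wL2_eq, wL2_eq]
  simp only [mul_add]
  exact eLpNorm_add_le (weight_meas β hf) (weight_meas β hg) (by norm_num)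

lemma wL2_sum {n : ℕ} (β : ℝ) {ι : Type} (s : Finset ι) {f : ι → Euc n → ℂ} (hf : ∀ i, Continuous (f i)) :
    wL2 β (fun x => (‖∑ i ∈ s, f i x‖₊ : ℝ≥0∞)) ≤ ∑ i ∈ s, wL2 β (fun x => (‖f i x‖₊ : ℝ≥0∞)) := by
  simp only [wL2_eq]
  have := eLpNorm_sum_le (s := s) (f := fun i x => ((‖x‖ ^ β : ℝ) : ℂ) * f i x) (μ := volume) (p := 2)
    (fun i _ => weight_meas β (hf i)) (by norm_num)
  refine le_trans (le_of_eq ?_) this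
  congr 1
  ext x
  simp [Finset.mul_sum]

lemma wL2_const_mul {n : ℕ} (β : ℝ) (c : ℂ) (f : Euc n → ℂ) :
    wL2 β (fun x => (‖c * f x‖₊ : ℝ≥0∞)) = ‖c‖₊ * wL2 β (fun x => (‖f x‖₊ : ℝ≥0∞)) := by
  rw [wL2_eq, wL2_eq]
  have := eLpNorm_const_smul c (fun x => ((‖x‖ ^ β : ℝ) : ℂ) * f x) 2 volume
  rw [enorm_eq_nnnorm] at this
  rw [← this]
  congr 1
  ext x
  simp; ring

lemma wL2_fatou {n : ℕ} (β : ℝ) {F : ℕ → Euc n → ℂ} {G : Euc n → ℂ} (hF : ∀ k, Continuous (F k))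
    (hl : ∀ x, Filter.Tendsto (fun k => F k x) Filter.atTop (nhds (G x))) {B : ℝ≥0∞}
    (hB : ∀ᶠ k in Filter.atTop, wL2 β (fun x => (‖F k x‖₊ : ℝ≥0∞)) ≤ B) :
    wL2 β (fun x => (‖G x‖₊ : ℝ≥0∞)) ≤ B := by
  simp only [wL2_eq] at hB ⊢
  refine (Lp.eLpNorm_lim_le_liminf_eLpNorm (fun k => weight_meas β (hF k)) _
    (.of_forall fun x => (hl x).const_mul _)).trans ?_
  refine Filter.liminf_le_of_le (by isBoundedDefault) (fun b hb => ?_)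
  obtain ⟨k, hk⟩ := (hb.and hB).exists
  exact hk.1.trans hk.2

/-- the radial bump -/
def bump {n : ℕ} (ξ : Euc n) : ℝ := Real.smoothTransition (2 - ‖ξ‖ ^ 2)

lemma bump_contDiff {n : ℕ} : ContDiff ℝ (⊤ : ℕ∞) (bump (n := n)) := by
  unfold bump
  exact Real.smoothTransition.contDiff.comp (contDiff_const.sub (contDiff_norm_sq ℝ))

lemma bump_zero {n : ℕ} {ξ : Euc n} (h : 2 ≤ ‖ξ‖) : bump ξ = 0 :=
  Real.smoothTransition.zero_of_nonpos (by nlinarith)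

lemma bump_supp {n : ℕ} : HasCompactSupport (bump (n := n)) := by
  refine HasCompactSupport.intro (isCompact_closedBall 0 2) fun x hx => bump_zero ?_
  simp at hx
  exact hx.le

lemma exists_psi (n : ℕ) : ∃ Ψ : SchwartzMap (Euc n) ℂ, ∀ x, Ψ x = ((‖x‖ ^ 2 * bump x : ℝ) : ℂ) :=
  exists_schwartz ((contDiff_norm_sq ℝ).mul bump_contDiff) bump_supp.mul_left

lemma exists_psij (n : ℕ) (j : Fin n) : ∃ Ψ : SchwartzMap (Euc n) ℂ, ∀ x, Ψ x = ((x j * bump x : ℝ) : ℂ) :=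
  exists_schwartz (ContDiff.mul (by fun_prop) bump_contDiff) bump_supp.mul_left

lemma min_inv_le_one {x : ℝ} (hx : 0 < x) : min x x⁻¹ ≤ 1 := by
  rcases le_total x 1 with h | h
  · exact (min_le_left _ _).trans h
  · exact (min_le_right _ _).trans (inv_le_one_of_one_le₀ h)

lemma rpow_intOn {a b : ℝ} (ha : 0 < a) (p : ℝ) : IntegrableOn (fun t : ℝ => t ^ p) (Ioc a b) := by
  refine IntegrableOn.mono_set ?_ Ioc_subset_Icc_self
  refine ContinuousOn.integrableOn_compact isCompact_Icc ?_
  intro t ht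
  exact (Real.continuousAt_rpow_const _ _ (Or.inl (ha.trans_le ht.1).ne')).continuousWithinAt

lemma min_intOn {a b : ℝ} (ha : 0 < a) (p : ℝ) {l : ℝ} (hl : 0 < l) :
    IntegrableOn (fun t : ℝ => t ^ p * min (t * l) (t * l)⁻¹) (Ioc a b) := by
  refine Integrable.mono' (rpow_intOn ha p) ?_ ?_
  · exact Measurable.aestronglyMeasurable (by fun_prop)
  · filter_upwards [ae_restrict_mem measurableSet_Ioc] with t ht
    have ht0 : 0 < t := ha.trans ht.1
    rw [Real.norm_of_nonneg (by positivity)]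
    exact mul_le_of_le_one_right (by positivity) (min_inv_le_one (by positivity))

lemma A_low {α : ℝ} (h0 : α < 1) {a T : ℝ} (ha : 0 < a) {l : ℝ} (hl : 0 < l) (hT : 0 < T) :
    ∫ t in Ioc a T, t ^ (-α) * min (t * l) (t * l)⁻¹ ≤ T ^ (1 - α) / (1 - α) := by
  have hi : IntegrableOn (fun t : ℝ => t ^ (-α)) (Ioc 0 T) :=
    (intervalIntegrable_iff_integrableOn_Ioc_of_le hT.le).1 (intervalIntegral.intervalIntegrable_rpow' (by linarith))
  calc _ ≤ ∫ t in Ioc a T, t ^ (-α) := by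
        refine setIntegral_mono_on (min_intOn ha _ hl) (rpow_intOn ha _) measurableSet_Ioc fun t ht => ?_
        have ht0 : 0 < t := ha.trans ht.1
        exact mul_le_of_le_one_right (by positivity) (min_inv_le_one (by positivity))
    _ ≤ ∫ t in Ioc 0 T, t ^ (-α) := by
        refine setIntegral_mono_set hi ?_ (Ioc_subset_Ioc_left ha.le).eventuallyLE
        filter_upwards [ae_restrict_mem measurableSet_Ioc] with t ht
        have := ht.1
        simp only [Pi.zero_apply]; positivity
    _ = _ := by
        rw [← intervalIntegral.integral_of_le hT.le, integral_rpow (Or.inl (by linarith))]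
        rw [Real.zero_rpow (by linarith)]
        ring_nf

lemma A_high {α : ℝ} (h0 : 0 < α) {T b : ℝ} (hT : 0 < T) {l : ℝ} (hl : 0 < l) :
    ∫ t in Ioc T b, t ^ (-(α+1)) * min (t * l) (t * l)⁻¹ ≤ T ^ (-α) / α := by
  have hi : IntegrableOn (fun t : ℝ => t ^ (-(α+1))) (Ioi T) := integrableOn_Ioi_rpow_of_lt (by linarith) hT
  calc _ ≤ ∫ t in Ioc T b, t ^ (-(α+1)) := by
        refine setIntegral_mono_on (min_intOn hT _ hl) (rpow_intOn hT _) measurableSet_Ioc fun t ht => ?_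
        have ht0 : 0 < t := hT.trans ht.1
        exact mul_le_of_le_one_right (by positivity) (min_inv_le_one (by positivity))
    _ ≤ ∫ t in Ioi T, t ^ (-(α+1)) := by
        refine setIntegral_mono_set hi ?_ Ioc_subset_Ioi_self.eventuallyLE
        filter_upwards [ae_restrict_mem measurableSet_Ioi] with t ht
        have : 0 < t := hT.trans ht
        simp only [Pi.zero_apply]; positivity
    _ = _ := by
        rw [integral_Ioi_rpow_of_lt (by linarith) hT]
        have : -(α + 1) + 1 = -α := by ring
        rw [this]; field_simp

lemma A_one {a b : ℝ} (ha : 0 < a) {l : ℝ} (hl : 0 < l) :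
    ∫ t in Ioc a b, t ^ (-(1:ℝ)) * min (t * l) (t * l)⁻¹ ≤ 2 := by
  have hi := min_intOn (b := b) ha (-1) hl
  rw [← integral_inter_add_diff (measurableSet_Iic (a := l⁻¹)) hi]
  have h1 : ∫ t in Ioc a b ∩ Iic l⁻¹, t ^ (-(1:ℝ)) * min (t * l) (t * l)⁻¹ ≤ 1 := by
    have hs : Ioc a b ∩ Iic l⁻¹ ⊆ Ioc 0 l⁻¹ := fun t ht => ⟨ha.trans ht.1.1, ht.2⟩
    have hm : MeasurableSet (Ioc a b ∩ Iic l⁻¹) := measurableSet_Ioc.inter measurableSet_Iic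
    calc _ ≤ ∫ t in Ioc a b ∩ Iic l⁻¹, l := by
          refine setIntegral_mono_on (hi.mono_set inter_subset_left) ?_ hm fun t ht => ?_
          · exact IntegrableOn.mono_set (t := Ioc 0 l⁻¹) (by simp) hs
          · have ht0 : 0 < t := (hs ht).1
            calc _ ≤ t ^ (-(1:ℝ)) * (t * l) := by gcongr; exact min_le_left _ _
              _ = l := by rw [Real.rpow_neg_one]; field_simp
      _ ≤ ∫ t in Ioc 0 l⁻¹, l := by
          refine setIntegral_mono_set (by simp) (.of_forall fun _ => hl.le) hs.eventuallyLE
      _ = 1 := by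
          simp [hl.le]; field_simp
  have h2 : ∫ t in Ioc a b \ Iic l⁻¹, t ^ (-(1:ℝ)) * min (t * l) (t * l)⁻¹ ≤ 1 := by
    have hl' : 0 < l⁻¹ := by positivity
    have hs : Ioc a b \ Iic l⁻¹ ⊆ Ioi l⁻¹ := fun t ht => by simpa using ht.2
    have hm : MeasurableSet (Ioc a b \ Iic l⁻¹) := measurableSet_Ioc.diff measurableSet_Iic
    have hr : IntegrableOn (fun t : ℝ => l⁻¹ * t ^ (-2:ℝ)) (Ioi l⁻¹) :=
      (integrableOn_Ioi_rpow_of_lt (by norm_num) hl').const_mul _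
    calc _ ≤ ∫ t in Ioc a b \ Iic l⁻¹, l⁻¹ * t ^ (-2:ℝ) := by
          refine setIntegral_mono_on (hi.mono_set diff_subset) (hr.mono_set hs) hm fun t ht => ?_
          have ht0 : 0 < t := hl'.trans (hs ht)
          calc _ ≤ t ^ (-(1:ℝ)) * (t * l)⁻¹ := by gcongr; exact min_le_right _ _
            _ = _ := by
              rw [Real.rpow_neg_one, Real.rpow_neg ht0.le, Real.rpow_two]; field_simp
      _ ≤ ∫ t in Ioi l⁻¹, l⁻¹ * t ^ (-2:ℝ) := by
          refine setIntegral_mono_set hr ?_ hs.eventuallyLE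
          filter_upwards [ae_restrict_mem measurableSet_Ioi] with t ht
          have : 0 < t := hl'.trans ht
          simp only [Pi.zero_apply]; positivity
      _ = 1 := by
          rw [integral_const_mul, integral_Ioi_rpow_of_lt (by norm_num) hl']
          norm_num
          rw [Real.rpow_neg_one]; field_simp
  linarith



def hfun (α τ : ℝ) : ℝ := τ ^ (1 - α) * Real.smoothTransition (2 - τ ^ 2)

lemma hfun_cont {α : ℝ} (h1 : α ≤ 1) : Continuous (hfun α) := by
  unfold hfun
  exact (Real.continuous_rpow_const (by linarith)).mul
    (Real.smoothTransition.continuous.comp (by fun_prop))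

lemma hfun_nonneg {α τ : ℝ} (h : 0 < τ) : 0 ≤ hfun α τ :=
  mul_nonneg (by positivity) (Real.smoothTransition.nonneg _)

lemma hfun_int {α : ℝ} (h1 : α ≤ 1) : IntegrableOn (hfun α) (Ioi 0) := by
  refine ((hfun_cont h1).integrable_of_hasCompactSupport ?_).integrableOn
  refine HasCompactSupport.intro (isCompact_closedBall 0 2) fun x hx => ?_
  simp at hx
  unfold hfun
  rw [Real.smoothTransition.zero_of_nonpos, mul_zero]
  nlinarith [sq_abs x]

def cst (α : ℝ) : ℝ := ∫ τ in Ioi 0, hfun α τ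

lemma cst_pos {α : ℝ} (h1 : α ≤ 1) : 0 < cst α := by
  unfold cst
  have hp : ∀ t ∈ Ioc (0:ℝ) 1, 0 < hfun α t := fun t ht =>
    mul_pos (Real.rpow_pos_of_pos ht.1 _) (Real.smoothTransition.pos_of_pos (by nlinarith [ht.1, ht.2]))
  calc 0 < ∫ τ in Ioc (0:ℝ) 1, hfun α τ := by
        rw [← intervalIntegral.integral_of_le zero_le_one]
        refine intervalIntegral.intervalIntegral_pos_of_pos_on ?_ (fun t ht => hp t ⟨ht.1, ht.2.le⟩) one_pos
        exact (hfun_cont h1).intervalIntegrable _ _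
    _ ≤ _ := by
        refine setIntegral_mono_set (hfun_int h1) ?_ Ioc_subset_Ioi_self.eventuallyLE
        filter_upwards [ae_restrict_mem measurableSet_Ioi] with t ht
        exact hfun_nonneg ht

lemma symb_eq {n : ℕ} {α : ℝ} {ξ : Euc n} (hξ : ξ ≠ 0) {t : ℝ} (ht : 0 < t) :
    t ^ (-(α+1)) * (‖t • ξ‖ ^ 2 * bump (t • ξ)) = ‖ξ‖ ^ (1 + α) * hfun α (t * ‖ξ‖) := by
  have hp : 0 < ‖ξ‖ := norm_pos_iff.2 hξ
  unfold hfun bump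
  rw [norm_smul, Real.norm_of_nonneg ht.le]
  rw [Real.mul_rpow ht.le hp.le, ← mul_assoc, ← mul_assoc]
  congr 1
  rw [mul_pow, ← Real.rpow_two, ← Real.rpow_two]
  calc _ = (t ^ (-(α+1)) * t ^ (2:ℝ)) * ‖ξ‖ ^ (2:ℝ) := by ring
    _ = t ^ (1 - α) * (‖ξ‖ ^ (1 + α) * ‖ξ‖ ^ (1 - α)) := by
      rw [← Real.rpow_add ht, ← Real.rpow_add hp]; ring_nf
    _ = _ := by ring

lemma symb_nonneg {n : ℕ} {α : ℝ} (ξ : Euc n) {t : ℝ} (ht : 0 < t) :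
    0 ≤ t ^ (-(α+1)) * (‖t • ξ‖ ^ 2 * bump (t • ξ)) :=
  mul_nonneg (by positivity) (mul_nonneg (by positivity) (Real.smoothTransition.nonneg _))

lemma symb_int {n : ℕ} {α : ℝ} (h0 : 0 < α) (h1 : α ≤ 1) (ξ : Euc n) :
    IntegrableOn (fun t : ℝ => t ^ (-(α+1)) * (‖t • ξ‖ ^ 2 * bump (t • ξ))) (Ioi 0) ∧
    ∫ t in Ioi (0:ℝ), t ^ (-(α+1)) * (‖t • ξ‖ ^ 2 * bump (t • ξ)) = cst α * ‖ξ‖ ^ α := by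
  rcases eq_or_ne ξ 0 with rfl | hξ
  · simp [Real.zero_rpow h0.ne']
  have hp : 0 < ‖ξ‖ := norm_pos_iff.2 hξ
  constructor
  · have : IntegrableOn (fun t => ‖ξ‖ ^ (1 + α) * hfun α (t * ‖ξ‖)) (Ioi 0) := by
      refine Integrable.const_mul ?_ _
      refine (integrableOn_Ioi_comp_mul_right_iff (hfun α) 0 hp).2 ?_
      rw [zero_mul]
      exact hfun_int h1
    exact this.congr_fun (fun t ht => (symb_eq hξ ht).symm) measurableSet_Ioi
  · rw [setIntegral_congr_fun measurableSet_Ioi (fun t ht => symb_eq hξ ht), integral_const_mul,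
      integral_comp_mul_right_Ioi _ _ hp, zero_mul]
    unfold cst
    rw [Real.rpow_add hp, Real.rpow_one, smul_eq_mul]
    field_simp

lemma symb_lim {n : ℕ} {α : ℝ} (h0 : 0 < α) (h1 : α ≤ 1) {Ψ : SchwartzMap (Euc n) ℂ}
    (hΨ : ∀ x, Ψ x = ((‖x‖ ^ 2 * bump x : ℝ) : ℂ)) (ξ : Euc n) :
    (∀ a b : ℝ, 0 < a → ‖∫ t in Ioc a b, ((t ^ (-(α+1)) : ℝ) : ℂ) * Ψ (t • ξ)‖ ≤ cst α * ‖ξ‖ ^ α) ∧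
    Filter.Tendsto (fun k : ℕ => ∫ t in Ioc (1/((k:ℝ)+1)) ((k:ℝ)+1), ((t ^ (-(α+1)) : ℝ) : ℂ) * Ψ (t • ξ))
      Filter.atTop (nhds ((cst α * ‖ξ‖ ^ α : ℝ) : ℂ)) := by
  obtain ⟨hi, he⟩ := symb_int h0 h1 ξ
  have e : ∀ a b : ℝ, ∫ t in Ioc a b, ((t ^ (-(α+1)) : ℝ) : ℂ) * Ψ (t • ξ) =
      ((∫ t in Ioc a b, t ^ (-(α+1)) * (‖t • ξ‖ ^ 2 * bump (t • ξ)) : ℝ) : ℂ) := by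
    intro a b
    refine Eq.trans ?_ (integral_ofReal (𝕜 := ℂ))
    refine integral_congr_ae (.of_forall fun t => ?_)
    simp [hΨ]
  have hpos : 0 ≤ᵐ[volume.restrict (Ioi (0:ℝ))] fun t => t ^ (-(α+1)) * (‖t • ξ‖ ^ 2 * bump (t • ξ)) := by
    filter_upwards [ae_restrict_mem measurableSet_Ioi] with t ht
    exact symb_nonneg ξ ht
  constructor
  · intro a b ha
    rw [e, Complex.norm_real, Real.norm_of_nonneg, ← he]
    · exact setIntegral_mono_set hi hpos (HasSubset.Subset.eventuallyLE fun t ht => ha.trans ht.1)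
    · exact setIntegral_nonneg measurableSet_Ioc fun t ht => symb_nonneg ξ (ha.trans ht.1)
  · simp only [e]
    refine (Complex.continuous_ofReal.tendsto _).comp ?_
    rw [← he]
    have hcov : AECover (volume.restrict (Ioi (0:ℝ))) Filter.atTop
        (fun k : ℕ => Ioc (1/((k:ℝ)+1)) ((k:ℝ)+1)) := by
      refine AECover.inter (aecover_Ioi_of_Ioi tendsto_one_div_add_atTop_nhds_zero_nat) (aecover_Iic ?_)
      exact Filter.tendsto_atTop_add_const_right _ _ tendsto_natCast_atTop_atTop
    have := hcov.integral_tendsto_of_countably_generated hi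
    refine this.congr fun k => ?_
    rw [Measure.restrict_restrict measurableSet_Ioc]
    congr 2
    refine inter_eq_left.2 fun t ht => ?_
    have : (0:ℝ) < 1/((k:ℝ)+1) := by positivity
    exact this.trans ht.1

/-- the integrated operator in gradient form -/
lemma symb_grad {n : ℕ} {α : ℝ} {Ψ : SchwartzMap (Euc n) ℂ} {Ψj : Fin n → SchwartzMap (Euc n) ℂ}
    (hΨ : ∀ x, Ψ x = ((‖x‖ ^ 2 * bump x : ℝ) : ℂ)) (hΨj : ∀ j x, Ψj j x = ((x j * bump x : ℝ) : ℂ))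
    {a b : ℝ} (ha : 0 < a) (ξ : Euc n) :
    ∫ t in Ioc a b, ((t ^ (-(α+1)) : ℝ) : ℂ) * Ψ (t • ξ) =
      ∑ j, (∫ t in Ioc a b, ((t ^ (-α) : ℝ) : ℂ) * Ψj j (t • ξ)) * (ξ j : ℂ) := by
  simp only [← integral_mul_const]
  rw [← integral_finset_sum]
  · refine setIntegral_congr_fun measurableSet_Ioc fun t ht => ?_
    have ht0 : 0 < t := ha.trans ht.1
    simp only [hΨ, hΨj]
    norm_cast
    rw [EuclideanSpace.norm_sq_eq]
    rw [Finset.sum_mul, Finset.mul_sum]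
    refine Finset.sum_congr rfl fun j _ => ?_
    have : t ^ (-α) = t ^ (-(α+1)) * t := by
      rw [← Real.rpow_add_one ht0.ne']; ring_nf
    rw [this]
    simp [mul_pow]; ring
  · intro j _
    refine Integrable.mul_const ?_ _
    refine IntegrableOn.mono_set ?_ Ioc_subset_Icc_self
    refine ContinuousOn.integrableOn_compact isCompact_Icc ?_
    refine ContinuousOn.mul ?_ ?_
    · refine Complex.continuous_ofReal.comp_continuousOn fun t ht => ?_
      exact (Real.continuousAt_rpow_const _ _ (Or.inl (ha.trans_le ht.1).ne')).continuousWithinAt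
    · have := (Ψj j).continuous
      fun_prop

lemma fourier_partial {n : ℕ} {u : Euc n → ℂ} (hu : ContDiff ℝ (⊤ : ℕ∞) u) (hs : HasCompactSupport u) (j : Fin n)
    (ξ : Euc n) :
    𝓕 (fun x => (2 * Real.pi * Complex.I)⁻¹ * fderiv ℝ u x (EuclideanSpace.single j 1)) ξ = (ξ j : ℂ) * 𝓕 u ξ := by
  have hd : Integrable (fderiv ℝ u) :=
    (hu.continuous_fderiv (by simp)).integrable_of_hasCompactSupport (hs.fderiv ℝ)
  have h := Real.fourier_fderiv (hu.continuous.integrable_of_hasCompactSupport hs) (hu.differentiable (by simp)) hd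
  have h2 := congrArg (fun L => L ξ (EuclideanSpace.single j 1)) h
  simp only [VectorFourier.fourierSMulRight_apply] at h2
  have h3 : 𝓕 (fderiv ℝ u) ξ (EuclideanSpace.single j 1) = 𝓕 (fun x => fderiv ℝ u x (EuclideanSpace.single j 1)) ξ := by
    rw [Real.fourier_eq, Real.fourier_eq, ContinuousLinearMap.integral_apply]
    · rfl
    · exact (Real.fourierIntegral_convergent_iff ξ).2 hd
  have h4 : 𝓕 (fun x => (2 * Real.pi * Complex.I)⁻¹ * fderiv ℝ u x (EuclideanSpace.single j 1)) ξ =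
      (2 * Real.pi * Complex.I)⁻¹ * 𝓕 (fun x => fderiv ℝ u x (EuclideanSpace.single j 1)) ξ := by
    rw [Real.fourier_eq, Real.fourier_eq, ← integral_const_mul]
    refine integral_congr_ae (.of_forall fun x => ?_)
    simp only [Circle.smul_def, smul_eq_mul]; ring
  rw [h4, ← h3, h2]
  have : (2 * Real.pi * Complex.I : ℂ) ≠ 0 := by
    simp [Real.pi_ne_zero]
  have e : innerSL ℝ ξ (EuclideanSpace.single j 1) = ξ j := by
    rw [innerSL_apply_apply, EuclideanSpace.inner_single_right]; simp
  simp only [ContinuousLinearMap.neg_apply, e, smul_eq_mul, Complex.real_smul, Complex.ofReal_neg]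
  rw [neg_mul (ξ j : ℂ), neg_mul_neg, inv_mul_cancel_left₀ this]



def mab {n : ℕ} (Ψ : SchwartzMap (Euc n) ℂ) (p a b : ℝ) (ξ : Euc n) : ℂ :=
  ∫ t in Ioc a b, ((t ^ (-p) : ℝ) : ℂ) * Ψ (t • ξ)

lemma mab_integrable {n : ℕ} (Ψ : SchwartzMap (Euc n) ℂ) (p : ℝ) {a : ℝ} (ha : 0 < a) (b : ℝ) :
    Integrable (mab Ψ p a b) := (time_integrable (b := b) Ψ ha p).integral_prod_right

lemma mab_mul_integrable {n : ℕ} (Ψ : SchwartzMap (Euc n) ℂ) (p : ℝ) {a : ℝ} (ha : 0 < a) (b : ℝ)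
    {f : Euc n → ℂ} (hf : Integrable f) : Integrable (fun ξ => mab Ψ p a b ξ * 𝓕 f ξ) := by
  refine (mab_integrable Ψ p ha b).mul_bdd (c := ∫ x, ‖f x‖) (continuous_fourier' hf).aestronglyMeasurable ?_
  exact .of_forall fun ξ => norm_fourier_le f ξ

lemma mab_split {n : ℕ} (Ψ : SchwartzMap (Euc n) ℂ) (p : ℝ) {a T b : ℝ} (ha : 0 < a) (h1 : a ≤ T) (h2 : T ≤ b) (ξ : Euc n) :
    mab Ψ p a b ξ = mab Ψ p a T ξ + mab Ψ p T b ξ := by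
  unfold mab
  have hi : ∀ c d : ℝ, 0 < c → IntegrableOn (fun t : ℝ => ((t ^ (-p) : ℝ) : ℂ) * Ψ (t • ξ)) (Ioc c d) := by
    intro c d hc
    refine IntegrableOn.mono_set ?_ Ioc_subset_Icc_self
    refine ContinuousOn.integrableOn_compact isCompact_Icc ?_
    refine ContinuousOn.mul ?_ ?_
    · refine Complex.continuous_ofReal.comp_continuousOn fun t ht => ?_
      exact (Real.continuousAt_rpow_const _ _ (Or.inl (hc.trans_le ht.1).ne')).continuousWithinAt
    · have := Ψ.continuous
      fun_prop
  rw [← setIntegral_union (Ioc_disjoint_Ioc_of_le le_rfl) measurableSet_Ioc (hi _ _ ha) (hi _ _ (ha.trans_le h1)),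
    Ioc_union_Ioc_eq_Ioc h1 h2]

lemma fourierInv_add' {n : ℕ} {f g : Euc n → ℂ} (hf : Integrable f) (hg : Integrable g) (x : Euc n) :
    𝓕⁻ (fun ξ => f ξ + g ξ) x = 𝓕⁻ f x + 𝓕⁻ g x := by
  simp only [Real.fourierInv_eq]
  rw [← integral_add]
  · simp only [smul_add]
  · simpa using! (Real.fourierIntegral_convergent_iff (-x)).2 hf
  · simpa using! (Real.fourierIntegral_convergent_iff (-x)).2 hg

lemma fourierInv_sum' {n : ℕ} {ι : Type} (s : Finset ι) {f : ι → Euc n → ℂ} (hf : ∀ i, Integrable (f i)) (x : Euc n) :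
    𝓕⁻ (fun ξ => ∑ i ∈ s, f i ξ) x = ∑ i ∈ s, 𝓕⁻ (f i) x := by
  simp only [Real.fourierInv_eq]
  rw [← integral_finset_sum]
  · simp only [Finset.smul_sum]
  · intro i _
    simpa using! (Real.fourierIntegral_convergent_iff (-x)).2 (hf i)

lemma grad_bound {n : ℕ} (hn : 2 ≤ n) (β : ℝ) (hβ : |β| < n/2) (α : ℝ) {Ψ : SchwartzMap (Euc n) ℂ}
    (hΨ : ∀ x, Ψ x = ((‖x‖ ^ 2 * bump x : ℝ) : ℂ)) :
    ∃ C : ℝ≥0, ∀ (a b : ℝ), 0 < a → ∀ A : ℝ≥0,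
      (∀ l : ℝ, 0 < l → ∫ t in Ioc a b, t ^ (-α) * min (t * l) (t * l)⁻¹ ≤ A) →
      ∀ u : Euc n → ℂ, ContDiff ℝ (⊤ : ℕ∞) u → HasCompactSupport u →
      wL2 β (fun x => (‖𝓕⁻ (fun ξ => mab Ψ (α+1) a b ξ * 𝓕 u ξ) x‖₊ : ℝ≥0∞)) ≤
        C * A * wL2 β (fun x => (‖fderiv ℝ u x‖₊ : ℝ≥0∞)) := by
  choose Ψj hΨj using exists_psij n
  choose C hC using fun j => mult_time hn β hβ (Ψj j) (by rw [hΨj]; simp)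
  refine ⟨∑ j, C j, fun a b ha A hA u hu hs => ?_⟩
  set f : Fin n → Euc n → ℂ := fun j x => (2 * Real.pi * Complex.I)⁻¹ * fderiv ℝ u x (EuclideanSpace.single j 1) with hf
  have hfd := hu.continuous_fderiv (by simp)
  have hfc : ∀ j, Continuous (f j) := fun j => by
    simp only [hf]
    fun_prop
  have hfs : ∀ j, HasCompactSupport (f j) := fun j =>
    (hs.fderiv ℝ).comp_left (g := fun L : Euc n →L[ℝ] ℂ => (2 * Real.pi * Complex.I)⁻¹ * L (EuclideanSpace.single j 1)) (by simp)
  have hfi : ∀ j, Integrable (f j) := fun j => (hfc j).integrable_of_hasCompactSupport (hfs j)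
  have hint : ∀ j, Integrable (fun ξ => mab (Ψj j) α a b ξ * 𝓕 (f j) ξ) :=
    fun j => mab_mul_integrable _ _ ha b (hfi j)
  have e : ∀ x, 𝓕⁻ (fun ξ => mab Ψ (α+1) a b ξ * 𝓕 u ξ) x =
      ∑ j, 𝓕⁻ (fun ξ => mab (Ψj j) α a b ξ * 𝓕 (f j) ξ) x := by
    intro x
    rw [← fourierInv_sum' _ hint]
    refine congrArg (fun F : Euc n → ℂ => 𝓕⁻ F x) (funext fun ξ => ?_)
    unfold mab
    rw [symb_grad hΨ hΨj ha, Finset.sum_mul]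
    refine Finset.sum_congr rfl fun j _ => ?_
    rw [fourier_partial hu hs j, mul_assoc]
  simp only [e]
  refine (wL2_sum β _ fun j => continuous_fourierInv' (hint j)).trans ?_
  rw [ENNReal.ofNNReal_finsetSum, Finset.sum_mul, Finset.sum_mul]
  refine Finset.sum_le_sum fun j _ => ?_
  refine (hC j a b α ha A hA (f j) (hfc j) (hfs j)).trans ?_
  gcongr
  refine wL2_mono β fun x => ?_
  norm_cast
  rw [← NNReal.coe_le_coe, coe_nnnorm, coe_nnnorm]
  simp only [hf, norm_mul, norm_inv, Complex.norm_I, Complex.norm_ofNat, Complex.norm_real, mul_one]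
  have h1 : ‖fderiv ℝ u x (EuclideanSpace.single j 1)‖ ≤ ‖fderiv ℝ u x‖ := by
    have := (fderiv ℝ u x).le_opNorm (EuclideanSpace.single j 1)
    simpa using this
  have h2 : (2 * ‖Real.pi‖)⁻¹ ≤ 1 := by
    rw [Real.norm_of_nonneg Real.pi_pos.le]
    exact inv_le_one_of_one_le₀ (by linarith [Real.pi_gt_three])
  calc _ ≤ 1 * ‖fderiv ℝ u x‖ := by gcongr
    _ = _ := one_mul _

lemma conv_lim {n : ℕ} {α : ℝ} (h0 : 0 < α) (h1 : α ≤ 1) {Ψ : SchwartzMap (Euc n) ℂ}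
    (hΨ : ∀ x, Ψ x = ((‖x‖ ^ 2 * bump x : ℝ) : ℂ)) {u : Euc n → ℂ} (hu : ContDiff ℝ (⊤ : ℕ∞) u) (hs : HasCompactSupport u)
    (x : Euc n) :
    Filter.Tendsto (fun k : ℕ => 𝓕⁻ (fun ξ => mab Ψ (α+1) (1/((k:ℝ)+1)) ((k:ℝ)+1) ξ * 𝓕 u ξ) x) Filter.atTop
      (nhds ((cst α : ℂ) * fracD α u x)) := by
  obtain ⟨U, hU⟩ : ∃ U : SchwartzMap (Euc n) ℂ, ∀ x, U x = u x := ⟨hs.toSchwartzMap hu, fun x => rfl⟩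
  have hUu : (U : Euc n → ℂ) = u := funext hU
  have hF : Integrable (fun ξ => ‖ξ‖ ^ α * ‖𝓕 u ξ‖) := by
    have hi0 : Integrable (fun ξ => (1 + ‖ξ‖) * ‖𝓕 u ξ‖) := by
      have i0 := (𝓕 U).integrable_pow_mul volume 0
      have i1 := (𝓕 U).integrable_pow_mul volume 1
      rw [← hUu, ← SchwartzMap.fourier_coe]
      refine (i0.add i1).congr (.of_forall fun ξ => ?_)
      simp; ring
    have hcF : Continuous (𝓕 u) := continuous_fourier' (hu.continuous.integrable_of_hasCompactSupport hs)
    refine hi0.mono' ?_ (.of_forall fun ξ => ?_)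
    · have := hcF.measurable
      exact Measurable.aestronglyMeasurable (by fun_prop)
    · rw [Real.norm_of_nonneg (by positivity)]
      gcongr
      rcases le_total ‖ξ‖ 1 with h | h
      · exact (Real.rpow_le_one (norm_nonneg _) h h0.le).trans (by linarith [norm_nonneg ξ])
      · refine (Real.rpow_le_rpow_of_exponent_le h h1).trans ?_
        rw [Real.rpow_one]; linarith
  have e : (cst α : ℂ) * fracD α u x =
      ∫ ξ, Real.fourierChar (inner ℝ ξ x) • (((cst α * ‖ξ‖ ^ α : ℝ) : ℂ) * 𝓕 u ξ) := by
    unfold fracD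
    rw [Real.fourierInv_eq, ← integral_const_mul]
    refine integral_congr_ae (.of_forall fun ξ => ?_)
    simp only [Circle.smul_def, smul_eq_mul]
    push_cast
    ring
  rw [e]
  simp only [Real.fourierInv_eq]
  have hpos : ∀ k : ℕ, (0:ℝ) < 1/((k:ℝ)+1) := fun k => by positivity
  refine tendsto_integral_of_dominated_convergence (fun ξ => cst α * (‖ξ‖ ^ α * ‖𝓕 u ξ‖)) ?_ (hF.const_mul _) ?_ ?_
  · intro k
    have := (mab_mul_integrable Ψ (α+1) (hpos k) ((k:ℝ)+1) (hu.continuous.integrable_of_hasCompactSupport hs))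
    have h2 : Integrable (fun ξ => Real.fourierChar (inner ℝ ξ x) •
        (mab Ψ (α+1) (1/((k:ℝ)+1)) ((k:ℝ)+1) ξ * 𝓕 u ξ)) := by
      simpa using! (Real.fourierIntegral_convergent_iff (-x)).2 this
    exact h2.1
  · intro k
    refine .of_forall fun ξ => ?_
    rw [Circle.norm_smul, norm_mul, ← mul_assoc]
    gcongr
    exact (symb_lim h0 h1 hΨ ξ).1 _ _ (hpos k)
  · refine .of_forall fun ξ => ?_
    refine Filter.Tendsto.const_smul ?_ _
    exact ((symb_lim h0 h1 hΨ ξ).2).mul_const _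

lemma first_ineq {n : ℕ} (hn : 2 ≤ n) {α β : ℝ} (h0 : 0 < α) (h1 : α ≤ 1) (hβ : |β| < n/2) :
    ∃ C : ℝ≥0, ∀ u : Euc n → ℂ, ContDiff ℝ (⊤ : ℕ∞) u → HasCompactSupport u → ∀ T : ℝ, 0 < T →
      wL2 β (fun x => (‖fracD α u x‖₊ : ℝ≥0∞)) ≤
        (C : ℝ≥0∞) * (ENNReal.ofReal (T ^ (1 - α)) * wL2 β (fun x => (‖fderiv ℝ u x‖₊ : ℝ≥0∞)) +
          ENNReal.ofReal (T ^ (-α)) * wL2 β (fun x => (‖u x‖₊ : ℝ≥0∞))) := by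
  obtain ⟨Ψ, hΨ⟩ := exists_psi n
  obtain ⟨C1, hC1⟩ := grad_bound hn β hβ α hΨ
  obtain ⟨C0, hC0⟩ := mult_time hn β hβ Ψ (by rw [hΨ]; simp)
  have hc := cst_pos h1
  -- reduce to bounds on truncations
  suffices H : ∃ C : ℝ≥0, ∀ u : Euc n → ℂ, ContDiff ℝ (⊤ : ℕ∞) u → HasCompactSupport u → ∀ T : ℝ, 0 < T →
      ∀ᶠ k : ℕ in Filter.atTop, wL2 β (fun x => (‖𝓕⁻ (fun ξ => mab Ψ (α+1) (1/((k:ℝ)+1)) ((k:ℝ)+1) ξ * 𝓕 u ξ) x‖₊ : ℝ≥0∞)) ≤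
        (C : ℝ≥0∞) * (ENNReal.ofReal (T ^ (1 - α)) * wL2 β (fun x => (‖fderiv ℝ u x‖₊ : ℝ≥0∞)) +
          ENNReal.ofReal (T ^ (-α)) * wL2 β (fun x => (‖u x‖₊ : ℝ≥0∞))) by
    obtain ⟨C, hC⟩ := H
    refine ⟨(cst α).toNNReal⁻¹ * C, fun u hu hs T hT => ?_⟩
    have hui : Integrable u := hu.continuous.integrable_of_hasCompactSupport hs
    have := wL2_fatou β (fun k => continuous_fourierInv'
      (mab_mul_integrable Ψ (α+1) (by positivity : (0:ℝ) < 1/((k:ℝ)+1)) ((k:ℝ)+1) hui))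
      (conv_lim h0 h1 hΨ hu hs) (hC u hu hs T hT)
    rw [wL2_const_mul] at this
    have hcn : ‖(cst α : ℂ)‖₊ = (cst α).toNNReal := by
      ext; rw [coe_nnnorm, Complex.norm_real, Real.norm_of_nonneg hc.le, Real.coe_toNNReal _ hc.le]
    rw [hcn] at this
    have hc' : (cst α).toNNReal ≠ 0 := by simpa using hc
    rw [ENNReal.coe_mul, mul_assoc, ENNReal.coe_inv hc', mul_comm (_⁻¹), ← div_eq_mul_inv, ENNReal.le_div_iff_mul_le
      (by left; simpa using hc) (by left; simp), mul_comm]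
    exact this
  rcases h1.lt_or_eq with hlt | rfl
  · refine ⟨C1 * (1 - α)⁻¹.toNNReal + C0 * α⁻¹.toNNReal, fun u hu hs T hT => ?_⟩
    have hui : Integrable u := hu.continuous.integrable_of_hasCompactSupport hs
    have ev1 : ∀ᶠ k : ℕ in Filter.atTop, 1/((k:ℝ)+1) ≤ T :=
      (tendsto_one_div_add_atTop_nhds_zero_nat).eventually_le_const hT
    have ev2 : ∀ᶠ k : ℕ in Filter.atTop, T ≤ (k:ℝ)+1 :=
      (Filter.tendsto_atTop_add_const_right _ _ tendsto_natCast_atTop_atTop).eventually_ge_atTop T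
    filter_upwards [ev1, ev2] with k hk1 hk2
    have hk0 : (0:ℝ) < 1/((k:ℝ)+1) := by positivity
    have e : ∀ x, 𝓕⁻ (fun ξ => mab Ψ (α+1) (1/((k:ℝ)+1)) ((k:ℝ)+1) ξ * 𝓕 u ξ) x =
        𝓕⁻ (fun ξ => mab Ψ (α+1) (1/((k:ℝ)+1)) T ξ * 𝓕 u ξ) x + 𝓕⁻ (fun ξ => mab Ψ (α+1) T ((k:ℝ)+1) ξ * 𝓕 u ξ) x := by
      intro x
      rw [← fourierInv_add' (mab_mul_integrable _ _ hk0 _ hui) (mab_mul_integrable _ _ hT _ hui)]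
      refine congrArg (fun F : Euc n → ℂ => 𝓕⁻ F x) (funext fun ξ => ?_)
      rw [mab_split _ _ hk0 hk1 hk2, add_mul]
    simp only [e]
    refine (wL2_add β (continuous_fourierInv' (mab_mul_integrable _ _ hk0 _ hui))
      (continuous_fourierInv' (mab_mul_integrable _ _ hT _ hui))).trans ?_
    have b1 := hC1 (1/((k:ℝ)+1)) T hk0 (T ^ (1 - α) / (1 - α)).toNNReal (fun l hl => by
      rw [Real.coe_toNNReal _ (div_nonneg (by positivity) (by linarith))]
      exact A_low hlt hk0 hl hT) u hu hs
    have b0 := hC0 T ((k:ℝ)+1) (α+1) hT (T ^ (-α) / α).toNNReal (fun l hl => by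
      rw [Real.coe_toNNReal _ (by positivity)]
      exact A_high h0 hT hl) u hu.continuous hs
    refine (add_le_add b1 b0).trans ?_
    rw [div_eq_mul_inv, div_eq_mul_inv, Real.toNNReal_mul (by positivity), Real.toNNReal_mul (by positivity)]
    push_cast
    rw [mul_add]
    refine add_le_add ?_ ?_
    · calc _ = (C1 * ((1 - α)⁻¹.toNNReal:ℝ≥0∞)) * (ENNReal.ofReal (T ^ (1 - α)) * wL2 β (fun x => (‖fderiv ℝ u x‖₊ : ℝ≥0∞))) := by
            unfold ENNReal.ofReal; ring
        _ ≤ _ := by gcongr; exact le_self_add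
    · calc _ = (C0 * (α⁻¹.toNNReal:ℝ≥0∞)) * (ENNReal.ofReal (T ^ (-α)) * wL2 β (fun x => (‖u x‖₊ : ℝ≥0∞))) := by
            unfold ENNReal.ofReal; ring
        _ ≤ _ := by gcongr; exact le_add_self
  · refine ⟨C1 * 2, fun u hu hs T hT => .of_forall fun k => ?_⟩
    have hk0 : (0:ℝ) < 1/((k:ℝ)+1) := by positivity
    refine (hC1 (1/((k:ℝ)+1)) ((k:ℝ)+1) hk0 2 (fun l hl => by simpa using A_one hk0 hl) u hu hs).trans ?_
    push_cast
    gcongr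
    simp



lemma optim {α : ℝ} (h0 : 0 < α) (h1 : α ≤ 1) {X N1 N0 : ℝ≥0∞} (C : ℝ≥0) (hN1 : N1 ≠ ⊤) (hN0 : N0 ≠ ⊤)
    (h : ∀ R : ℝ, 0 < R → X ≤ C * (ENNReal.ofReal (R ^ (1 - α)) * N1 + ENNReal.ofReal (R ^ (-α)) * N0)) :
    X ≤ ((2 * C : ℝ≥0) : ℝ≥0∞) * N1 ^ α * N0 ^ (1 - α) := by
  rcases eq_or_ne N1 0 with rfl | hN1z
  · have hlim : Filter.Tendsto (fun R : ℝ => (C : ℝ≥0∞) * (ENNReal.ofReal (R ^ (-α)) * N0)) Filter.atTop (nhds (C * (ENNReal.ofReal 0 * N0))) := by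
      refine ENNReal.Tendsto.const_mul (ENNReal.Tendsto.mul_const ?_ (Or.inr hN0)) (Or.inr (by simp))
      exact ENNReal.tendsto_ofReal (tendsto_rpow_neg_atTop h0)
    have : X ≤ C * (ENNReal.ofReal 0 * N0) := by
      refine ge_of_tendsto hlim ?_
      filter_upwards [Filter.eventually_gt_atTop 0] with R hR
      simpa using h R hR
    simp at this
    simp [this]
  rcases eq_or_ne N0 0 with rfl | hN0z
  · rcases h1.lt_or_eq with hlt | rfl
    · have hlim : Filter.Tendsto (fun R : ℝ => (C : ℝ≥0∞) * (ENNReal.ofReal (R ^ (-(1 - α))) * N1)) Filter.atTop (nhds (C * (ENNReal.ofReal 0 * N1))) := by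
        refine ENNReal.Tendsto.const_mul (ENNReal.Tendsto.mul_const ?_ (Or.inr hN1)) (Or.inr (by simp))
        exact ENNReal.tendsto_ofReal (tendsto_rpow_neg_atTop (by linarith))
      have : X ≤ C * (ENNReal.ofReal 0 * N1) := by
        refine ge_of_tendsto hlim ?_
        filter_upwards [Filter.eventually_gt_atTop 0] with R hR
        have := h R⁻¹ (by positivity)
        rw [Real.inv_rpow hR.le, ← Real.rpow_neg hR.le] at this
        simpa using this
      simp at this
      simp [this]
    · have := h 1 one_pos
      simp at this
      refine this.trans ?_
      simp
      gcongr
      rw [two_mul]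
      exact le_self_add
  have ha : 0 < N1.toReal := ENNReal.toReal_pos hN1z hN1
  have hb : 0 < N0.toReal := ENNReal.toReal_pos hN0z hN0
  have e1 : N1 = ENNReal.ofReal N1.toReal := (ENNReal.ofReal_toReal hN1).symm
  have e0 : N0 = ENNReal.ofReal N0.toReal := (ENNReal.ofReal_toReal hN0).symm
  refine (h (N0.toReal / N1.toReal) (by positivity)).trans (le_of_eq ?_)
  generalize N1.toReal = a at *
  generalize N0.toReal = b at *
  subst e1 e0
  rw [ENNReal.ofReal_rpow_of_pos ha, ENNReal.ofReal_rpow_of_pos hb, ← ENNReal.ofReal_mul (by positivity),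
    ← ENNReal.ofReal_mul (by positivity), mul_assoc, ← ENNReal.ofReal_mul (by positivity)]
  have k1 : (b / a) ^ (1 - α) * a = a ^ α * b ^ (1 - α) := by
    rw [Real.div_rpow hb.le ha.le, Real.rpow_sub ha, Real.rpow_one]
    have : a ^ α ≠ 0 := by positivity
    field_simp
  have k2 : (b / a) ^ (-α) * b = a ^ α * b ^ (1 - α) := by
    rw [Real.div_rpow hb.le ha.le, Real.rpow_sub hb, Real.rpow_one, Real.rpow_neg hb.le, Real.rpow_neg ha.le]
    have : a ^ α ≠ 0 := by positivity
    field_simp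
  rw [k1, k2]
  push_cast
  ring

lemma wL2_mono_ae {n : ℕ} {β γ : ℝ} {f g : Euc n → ℝ≥0∞}
    (h : ∀ x, x ≠ 0 → ENNReal.ofReal (‖x‖ ^ β) * f x ≤ ENNReal.ofReal (‖x‖ ^ γ) * g x) (hn : 1 ≤ n) :
    wL2 β f ≤ wL2 γ g := by
  have : Nonempty (Fin n) := ⟨⟨0, by omega⟩⟩
  unfold wL2
  gcongr 1
  refine lintegral_mono_ae ?_
  filter_upwards [Measure.ae_ne volume (0 : Euc n)] with x hx
  gcongr 1
  exact h x hx

lemma wL2_add' {n : ℕ} (β : ℝ) {f g : Euc n → ℝ≥0∞} (hf : Measurable f) (hg : Measurable g) :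
    wL2 β (fun x => f x + g x) ≤ wL2 β f + wL2 β g := by
  unfold wL2
  simp only [mul_add]
  exact ENNReal.lintegral_Lp_add_le (p := 2) (f := fun x : Euc n => ENNReal.ofReal (‖x‖ ^ β) * f x)
    (g := fun x : Euc n => ENNReal.ofReal (‖x‖ ^ β) * g x)
    (Measurable.aemeasurable (by fun_prop)) (Measurable.aemeasurable (by fun_prop)) (by norm_num)

lemma wL2_const' {n : ℕ} (β : ℝ) {c : ℝ≥0∞} (hc : c ≠ ⊤) (f : Euc n → ℝ≥0∞) :
    wL2 β (fun x => c * f x) = c * wL2 β f := by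
  unfold wL2
  have : ∀ x : Euc n, (ENNReal.ofReal (‖x‖ ^ β) * (c * f x)) ^ (2:ℝ) = c ^ (2:ℝ) * (ENNReal.ofReal (‖x‖ ^ β) * f x) ^ (2:ℝ) := by
    intro x
    rw [← ENNReal.mul_rpow_of_nonneg _ _ (by norm_num)]
    congr 1; ring
  simp only [this]
  rw [lintegral_const_mul' _ _ (by simp [hc]), ENNReal.mul_rpow_of_nonneg _ _ (by norm_num), ← ENNReal.rpow_mul]
  norm_num

lemma lint_rpow {q : ℝ} (hq : 0 < q) : ∫⁻ s in Ioi (1:ℝ), ENNReal.ofReal (s ^ (-1 - q)) = ENNReal.ofReal q⁻¹ := by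
  rw [← ofReal_integral_eq_lintegral_ofReal]
  · rw [integral_Ioi_rpow_of_lt (by linarith) one_pos]
    congr 1
    have : -1 - q + 1 = -q := by ring
    rw [this]
    simp
  · exact integrableOn_Ioi_rpow_of_lt (by linarith) one_pos
  · filter_upwards [ae_restrict_mem measurableSet_Ioi] with s hs
    have : (0:ℝ) < s := one_pos.trans hs
    simp only [Pi.zero_apply]; positivity

lemma hardy_pt {n : ℕ} {v : Euc n → ℂ} (hv : ContDiff ℝ (⊤ : ℕ∞) v) (hs : HasCompactSupport v) {x : Euc n} (hx : x ≠ 0) :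
    (‖v x‖₊ : ℝ≥0∞) ≤ ∫⁻ s in Ioi (1:ℝ), (‖fderiv ℝ v (s • x)‖₊ : ℝ≥0∞) * ‖x‖₊ := by
  have hp : 0 < ‖x‖ := norm_pos_iff.2 hx
  obtain ⟨R, hR⟩ := hs.isCompact.isBounded.subset_closedBall (0 : Euc n)
  set S := max 1 ((R + 1) / ‖x‖) with hS
  have hS1 : 1 ≤ S := le_max_left _ _
  have hvS : v (S • x) = 0 := by
    refine image_eq_zero_of_notMem_tsupport fun hh => ?_
    have := hR hh
    rw [mem_closedBall_zero_iff, norm_smul, Real.norm_of_nonneg (by linarith)] at this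
    have h2 : (R + 1) / ‖x‖ ≤ S := le_max_right _ _
    rw [div_le_iff₀ hp] at h2
    linarith
  have hd : ∀ s : ℝ, HasDerivAt (fun s : ℝ => v (s • x)) (fderiv ℝ v (s • x) x) s := by
    intro s
    have h1 := ((hv.differentiable (by simp)) (s • x)).hasFDerivAt
    have h2 : HasDerivAt (fun s : ℝ => s • x) ((1:ℝ) • x) s := (hasDerivAt_id s).smul_const x
    rw [one_smul] at h2
    exact h1.comp_hasDerivAt s h2
  have hcont : Continuous (fun s : ℝ => fderiv ℝ v (s • x) x) := by
    have := hv.continuous_fderiv (by simp)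
    fun_prop
  have key := intervalIntegral.integral_eq_sub_of_hasDerivAt (a := 1) (b := S) (fun s _ => hd s) (hcont.intervalIntegrable _ _)
  rw [hvS, one_smul, zero_sub, intervalIntegral.integral_of_le hS1] at key
  have : v x = -∫ s in Ioc 1 S, fderiv ℝ v (s • x) x := by rw [key, neg_neg]
  rw [this, nnnorm_neg, ← enorm_eq_nnnorm]
  refine (enorm_integral_le_lintegral_enorm _).trans ?_
  refine (lintegral_mono_set Ioc_subset_Ioi_self).trans ?_
  refine lintegral_mono fun s => ?_
  rw [enorm_eq_nnnorm]
  rw [← ENNReal.coe_mul]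
  exact ENNReal.coe_le_coe.2 ((fderiv ℝ v (s • x)).le_opNNNorm x)

lemma hardy_cs {n : ℕ} {v : Euc n → ℂ} (hv : ContDiff ℝ (⊤ : ℕ∞) v) (hs : HasCompactSupport v) {x : Euc n} (hx : x ≠ 0)
    {δ : ℝ} (hδ : 0 < δ) :
    (‖v x‖₊ : ℝ≥0∞) ^ (2:ℝ) ≤ ENNReal.ofReal δ⁻¹ *
      ∫⁻ s in Ioi (1:ℝ), ENNReal.ofReal (s ^ (1 + δ)) * ((‖fderiv ℝ v (s • x)‖₊ : ℝ≥0∞) * ‖x‖₊) ^ (2:ℝ) := by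
  have hfd := (hv.continuous_fderiv (by simp)).measurable
  have hm : Measurable (fun s : ℝ => (‖fderiv ℝ v (s • x)‖₊ : ℝ≥0∞)) := by fun_prop
  have h := ENNReal.lintegral_mul_le_Lp_mul_Lq (volume.restrict (Ioi (1:ℝ))) (p := 2) (q := 2)
    (Real.HolderConjugate.two_two)
    (f := fun s : ℝ => ENNReal.ofReal (s ^ (-(1 + δ)/2)))
    (g := fun s : ℝ => ENNReal.ofReal (s ^ ((1 + δ)/2)) * ((‖fderiv ℝ v (s • x)‖₊ : ℝ≥0∞) * ‖x‖₊))
    (Measurable.aemeasurable (by fun_prop)) (Measurable.aemeasurable (by fun_prop))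
  have e0 : ∫⁻ s in Ioi (1:ℝ), (‖fderiv ℝ v (s • x)‖₊ : ℝ≥0∞) * ‖x‖₊ ≤
      ∫⁻ s in Ioi (1:ℝ), ((fun s : ℝ => ENNReal.ofReal (s ^ (-(1 + δ)/2))) *
        (fun s : ℝ => ENNReal.ofReal (s ^ ((1 + δ)/2)) * ((‖fderiv ℝ v (s • x)‖₊ : ℝ≥0∞) * ‖x‖₊))) s := by
    refine setLIntegral_mono' measurableSet_Ioi fun s hs' => ?_
    have hs0 : (0:ℝ) < s := one_pos.trans hs'
    simp only [Pi.mul_apply]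
    rw [← mul_assoc, ← ENNReal.ofReal_mul (by positivity), ← Real.rpow_add hs0]
    have : -(1 + δ)/2 + (1 + δ)/2 = 0 := by ring
    rw [this]; simp
  have h2 := ((hardy_pt hv hs hx).trans e0).trans h
  have h3 := ENNReal.rpow_le_rpow h2 (by norm_num : (0:ℝ) ≤ 2)
  refine h3.trans (le_of_eq ?_)
  rw [ENNReal.mul_rpow_of_nonneg _ _ (by norm_num), ← ENNReal.rpow_mul, ← ENNReal.rpow_mul]
  norm_num only [ENNReal.rpow_one]
  congr 1
  · rw [← lint_rpow hδ]
    refine setLIntegral_congr_fun measurableSet_Ioi fun s hs' => ?_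
    have hs0 : (0:ℝ) < s := one_pos.trans hs'
    beta_reduce
    rw [ENNReal.ofReal_rpow_of_nonneg (by positivity) (by norm_num), ← Real.rpow_mul hs0.le]
    ring_nf
  · refine setLIntegral_congr_fun measurableSet_Ioi fun s hs' => ?_
    have hs0 : (0:ℝ) < s := one_pos.trans hs'
    beta_reduce
    rw [ENNReal.mul_rpow_of_nonneg _ _ (by norm_num), ENNReal.ofReal_rpow_of_nonneg (by positivity) (by norm_num), ← Real.rpow_mul hs0.le]
    ring_nf

lemma hardy {n : ℕ} (hn : 1 ≤ n) {γ : ℝ} (hγ : -(n/2:ℝ) < γ) : ∃ C : ℝ≥0, ∀ v : Euc n → ℂ, ContDiff ℝ (⊤ : ℕ∞) v →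
    HasCompactSupport v →
    wL2 γ (fun x => (‖v x‖₊ : ℝ≥0∞)) ≤ C * wL2 (γ + 1) (fun x => (‖fderiv ℝ v x‖₊ : ℝ≥0∞)) := by
  have : Nonempty (Fin n) := ⟨⟨0, by omega⟩⟩
  set δ : ℝ := (n + 2 * γ)/2 with hδd
  have hδ : 0 < δ := by rw [hδd]; linarith
  refine ⟨δ⁻¹.toNNReal, fun v hv hs => ?_⟩
  have hfd := (hv.continuous_fderiv (by simp)).measurable
  set G : Euc n → ℝ≥0∞ := fun y => (ENNReal.ofReal (‖y‖ ^ (γ + 1)) * (‖fderiv ℝ v y‖₊ : ℝ≥0∞)) ^ (2:ℝ) with hG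
  have hGm : Measurable G := by simp only [hG]; fun_prop
  set d := ENNReal.ofReal δ⁻¹ with hd
  have main : ∫⁻ x : Euc n, (ENNReal.ofReal (‖x‖ ^ γ) * (‖v x‖₊ : ℝ≥0∞)) ^ (2:ℝ) ≤ d * (d * ∫⁻ y, G y) := by
    calc _ ≤ ∫⁻ x : Euc n, d * ∫⁻ s in Ioi (1:ℝ), ENNReal.ofReal (s ^ (1 + δ - 2 * (γ + 1))) * G (s • x) := by
          refine lintegral_mono_ae ?_
          filter_upwards [Measure.ae_ne volume (0 : Euc n)] with x hx
          have hp : 0 < ‖x‖ := norm_pos_iff.2 hx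
          rw [ENNReal.mul_rpow_of_nonneg _ _ (by norm_num)]
          refine (mul_le_mul_right (hardy_cs hv hs hx hδ) _).trans (le_of_eq ?_)
          rw [mul_left_comm]
          congr 1
          rw [← lintegral_const_mul' _ _ (by simp)]
          refine setLIntegral_congr_fun measurableSet_Ioi fun s hs' => ?_
          have hs0 : (0:ℝ) < s := one_pos.trans hs'
          simp only [hG]
          rw [ENNReal.mul_rpow_of_nonneg _ _ (by norm_num), ENNReal.mul_rpow_of_nonneg _ _ (by norm_num)]
          have e : (‖x‖₊ : ℝ≥0∞) = ENNReal.ofReal ‖x‖ := by rw [← enorm_eq_nnnorm, ofReal_norm]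
          rw [e, norm_smul, Real.norm_of_nonneg hs0.le]
          generalize (‖fderiv ℝ v (s • x)‖₊ : ℝ≥0∞) ^ (2:ℝ) = F
          rw [ENNReal.ofReal_rpow_of_nonneg (by positivity) (by norm_num),
            ENNReal.ofReal_rpow_of_nonneg (by positivity) (by norm_num),
            ENNReal.ofReal_rpow_of_nonneg (by positivity) (by norm_num)]
          calc _ = (ENNReal.ofReal ((‖x‖ ^ γ) ^ (2:ℝ)) * ENNReal.ofReal (s ^ (1 + δ)) * ENNReal.ofReal (‖x‖ ^ (2:ℝ))) * F := by ring
            _ = (ENNReal.ofReal (s ^ (1 + δ - 2 * (γ + 1))) * ENNReal.ofReal (((s * ‖x‖) ^ (γ + 1)) ^ (2:ℝ))) * F := by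
              rw [← ENNReal.ofReal_mul (by positivity), ← ENNReal.ofReal_mul (by positivity), ← ENNReal.ofReal_mul (by positivity)]
              congr 2
              rw [← Real.rpow_mul hp.le, ← Real.rpow_mul (by positivity), Real.mul_rpow hs0.le hp.le]
              rw [mul_right_comm, ← Real.rpow_add hp, ← mul_assoc, ← Real.rpow_add hs0]
              rw [mul_comm]
              ring_nf
            _ = _ := by ring
      _ = d * ∫⁻ s in Ioi (1:ℝ), ∫⁻ x : Euc n, ENNReal.ofReal (s ^ (1 + δ - 2 * (γ + 1))) * G (s • x) := by
          rw [lintegral_const_mul' _ _ (by simp [hd])]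
          congr 1
          refine lintegral_lintegral_swap ?_
          refine Measurable.aemeasurable ?_
          unfold Function.uncurry
          fun_prop
      _ = d * ∫⁻ s in Ioi (1:ℝ), ENNReal.ofReal (s ^ (-1 - δ)) * ∫⁻ y, G y := by
          congr 1
          refine setLIntegral_congr_fun measurableSet_Ioi fun s hs' => ?_
          have hs0 : (0:ℝ) < s := one_pos.trans hs'
          beta_reduce
          rw [lintegral_const_mul' _ _ (by simp)]
          rw [lintegral_scale G hs0, ← mul_assoc, ← ENNReal.ofReal_mul (by positivity)]
          congr 2
          rw [← Real.rpow_natCast, ← Real.rpow_add hs0]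
          congr 1
          rw [hδd]; ring
      _ = _ := by
          rw [lintegral_mul_const _ (by fun_prop), lint_rpow hδ]
  unfold wL2
  refine (ENNReal.rpow_le_rpow main (by norm_num)).trans (le_of_eq ?_)
  rw [← mul_assoc, ENNReal.mul_rpow_of_nonneg _ _ (by norm_num)]
  congr 1
  have : d * d = d ^ (2:ℝ) := by rw [ENNReal.rpow_two, sq]
  rw [this, ← ENNReal.rpow_mul]
  norm_num
  rfl



lemma bump_one {n : ℕ} {ξ : Euc n} (h : ‖ξ‖ ≤ 1) : bump ξ = 1 :=
  Real.smoothTransition.one_of_one_le (by nlinarith [norm_nonneg ξ])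

lemma cut_deriv {n : ℕ} : ∃ K : ℝ, 0 ≤ K ∧ ∀ (u : Euc n → ℂ), ContDiff ℝ (⊤ : ℕ∞) u → ∀ (R : ℝ), 0 < R → ∀ x,
    ‖fderiv ℝ (fun x => ((bump (R⁻¹ • x) : ℝ) : ℂ) * u x) x‖ ≤ ‖fderiv ℝ u x‖ + K * R⁻¹ * ‖u x‖ := by
  have hc : Continuous (fderiv ℝ (bump (n := n))) := bump_contDiff.continuous_fderiv (by simp)
  obtain ⟨K, hK⟩ := (bump_supp.fderiv ℝ).exists_bound_of_continuous hc
  have hK0 : 0 ≤ K := (norm_nonneg _).trans (hK 0)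
  refine ⟨K, hK0, fun u hu R hR x => ?_⟩
  have hb : HasFDerivAt (fun x : Euc n => bump (R⁻¹ • x)) ((fderiv ℝ bump (R⁻¹ • x)).comp (R⁻¹ • ContinuousLinearMap.id ℝ (Euc n))) x := by
    have h1 : HasFDerivAt (bump (n := n)) _ (R⁻¹ • x) := ((bump_contDiff.differentiable (by simp)) (R⁻¹ • x)).hasFDerivAt
    exact h1.comp x ((hasFDerivAt_id x).const_smul R⁻¹)
  have hu' := ((hu.differentiable (by simp)) x).hasFDerivAt
  have e : (fun x : Euc n => ((bump (R⁻¹ • x) : ℝ) : ℂ) * u x) = fun x => bump (R⁻¹ • x) • u x := by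
    ext x; rw [Complex.real_smul]
  rw [e, (hb.fun_smul hu').fderiv]
  refine (norm_add_le _ _).trans (add_le_add ?_ ?_)
  · rw [norm_smul, Real.norm_of_nonneg (show 0 ≤ bump (R⁻¹ • x) from Real.smoothTransition.nonneg _)]
    exact mul_le_of_le_one_left (norm_nonneg _) (Real.smoothTransition.le_one _)
  · rw [ContinuousLinearMap.norm_smulRight_apply]
    gcongr
    refine (ContinuousLinearMap.opNorm_comp_le _ _).trans ?_
    rw [norm_smul, Real.norm_of_nonneg (by positivity)]
    calc _ ≤ K * (R⁻¹ * 1) := by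
          gcongr
          · exact hK _
          · exact ContinuousLinearMap.norm_id_le
      _ = _ := by ring

lemma second_ineq {n : ℕ} (hn : 1 ≤ n) {α β : ℝ} (h0 : 0 < α) (h1 : α ≤ 1) (hβ : α - n/2 < β) :
    ∃ C : ℝ≥0, ∀ u : Euc n → ℂ, ContDiff ℝ (⊤ : ℕ∞) u → HasCompactSupport u → ∀ R : ℝ, 0 < R →
      wL2 (β - α) (fun x => (‖u x‖₊ : ℝ≥0∞)) ≤
        (C : ℝ≥0∞) * (ENNReal.ofReal (R ^ (1 - α)) * wL2 β (fun x => (‖fderiv ℝ u x‖₊ : ℝ≥0∞)) +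
          ENNReal.ofReal (R ^ (-α)) * wL2 β (fun x => (‖u x‖₊ : ℝ≥0∞))) := by
  obtain ⟨C, hC⟩ := hardy hn (γ := β - α) (by linarith)
  obtain ⟨K, hK0, hK⟩ := cut_deriv (n := n)
  refine ⟨2 * C + 2 * C * K.toNNReal + 1, fun u hu hs R hR => ?_⟩
  set v : Euc n → ℂ := fun x => ((bump (R⁻¹ • x) : ℝ) : ℂ) * u x with hv
  have hvc : ContDiff ℝ (⊤ : ℕ∞) v := by
    refine ContDiff.mul ?_ hu
    exact ofReal_contDiff (g := fun x => bump (R⁻¹ • x)) (bump_contDiff.comp (contDiff_const_smul R⁻¹))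
  have hvs : HasCompactSupport v := hs.mul_left
  have hfm : Measurable (fderiv ℝ u) := (hu.continuous_fderiv (by simp)).measurable
  have hum : Measurable u := hu.continuous.measurable
  have hvm : Measurable v := hvc.continuous.measurable
  set N1 := wL2 β (fun x => (‖fderiv ℝ u x‖₊ : ℝ≥0∞)) with hN1
  set N0 := wL2 β (fun x => (‖u x‖₊ : ℝ≥0∞)) with hN0
  -- step 1
  have s1 : wL2 (β - α) (fun x => (‖u x‖₊ : ℝ≥0∞)) ≤
      wL2 (β - α) (fun x => (‖v x‖₊ : ℝ≥0∞)) + ENNReal.ofReal (R ^ (-α)) * N0 := by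
    have hshift : wL2 (β - α) (fun x => ENNReal.ofReal (R ^ (-α) * ‖x‖ ^ α) * (‖u x‖₊ : ℝ≥0∞)) ≤ ENNReal.ofReal (R ^ (-α)) * N0 := by
      rw [hN0, ← wL2_const' β ENNReal.ofReal_ne_top]
      refine wL2_mono_ae (fun x hx => le_of_eq ?_) hn
      have hp : 0 < ‖x‖ := norm_pos_iff.2 hx
      rw [← mul_assoc, ← mul_assoc, ← ENNReal.ofReal_mul (by positivity), ← ENNReal.ofReal_mul (by positivity)]
      congr 2
      rw [Real.rpow_sub hp]
      field_simp
    refine le_trans ?_ (add_le_add le_rfl hshift)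
    refine le_trans ?_ (wL2_add' _ (by fun_prop) (by fun_prop))
    refine wL2_mono _ fun x => ?_
    rcases le_total ‖x‖ R with h | h
    · have : v x = u x := by
        simp only [hv]
        rw [bump_one]
        · simp
        · rw [norm_smul, Real.norm_of_nonneg (by positivity), inv_mul_le_one₀ hR]; exact h
      rw [this]
      exact le_self_add
    · refine le_trans ?_ le_add_self
      have hge : (1:ℝ) ≤ R ^ (-α) * ‖x‖ ^ α := by
        rw [Real.rpow_neg hR.le, le_inv_mul_iff₀ (by positivity), mul_one]
        exact Real.rpow_le_rpow hR.le h h0.le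
      have : (1:ℝ≥0∞) ≤ ENNReal.ofReal (R ^ (-α) * ‖x‖ ^ α) := by
        rw [← ENNReal.ofReal_one]; exact ENNReal.ofReal_le_ofReal hge
      exact le_mul_of_one_le_left (zero_le) this
  -- step 2
  have s2 : wL2 (β - α + 1) (fun x => (‖fderiv ℝ v x‖₊ : ℝ≥0∞)) ≤
      ENNReal.ofReal (2 * R ^ (1 - α)) * (N1 + ENNReal.ofReal (K * R⁻¹) * N0) := by
    have hb : wL2 β (fun x => ENNReal.ofReal (2 * R ^ (1 - α)) * ((‖fderiv ℝ u x‖₊ : ℝ≥0∞) + ENNReal.ofReal (K * R⁻¹) * (‖u x‖₊ : ℝ≥0∞)))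
        ≤ ENNReal.ofReal (2 * R ^ (1 - α)) * (N1 + ENNReal.ofReal (K * R⁻¹) * N0) := by
      rw [wL2_const' β ENNReal.ofReal_ne_top]
      refine mul_le_mul_right ?_ _
      rw [hN0, ← wL2_const' β ENNReal.ofReal_ne_top]
      exact wL2_add' _ (by fun_prop) (by fun_prop)
    refine le_trans (wL2_mono_ae (fun x hx => ?_) hn) hb
    have hp : 0 < ‖x‖ := norm_pos_iff.2 hx
    rcases le_or_gt ‖x‖ (2 * R) with h | h
    · rw [← mul_assoc, ← ENNReal.ofReal_mul (by positivity)]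
      refine mul_le_mul' (ENNReal.ofReal_le_ofReal ?_) ?_
      · have : β - α + 1 = β + (1 - α) := by ring
        rw [this, Real.rpow_add hp]
        gcongr
        calc _ ≤ (2 * R) ^ (1 - α) := Real.rpow_le_rpow hp.le h (by linarith)
          _ = 2 ^ (1 - α) * R ^ (1 - α) := Real.mul_rpow (by norm_num) hR.le
          _ ≤ _ := by
            gcongr
            calc (2:ℝ) ^ (1 - α) ≤ 2 ^ (1:ℝ) := Real.rpow_le_rpow_of_exponent_le (by norm_num) (by linarith)
              _ = 2 := by norm_num
      · have := hK u hu R hR x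
        have h2 := ENNReal.ofReal_le_ofReal this
        rw [ENNReal.ofReal_add (by positivity) (by positivity), ENNReal.ofReal_mul (by positivity)] at h2
        simp only [ofReal_norm, enorm_eq_nnnorm] at h2
        exact h2
    · have : v =ᶠ[nhds x] fun _ => 0 := by
        have ho : IsOpen {y : Euc n | 2 * R < ‖y‖} := isOpen_lt continuous_const continuous_norm
        filter_upwards [ho.mem_nhds h] with y hy
        simp only [hv]
        rw [bump_zero]
        · simp
        · rw [norm_smul, Real.norm_of_nonneg (by positivity), ← div_eq_inv_mul, le_div_iff₀ hR]; 
          have hy2 : 2 * R < ‖y‖ := hy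
          exact hy2.le
      rw [this.fderiv_eq]
      simp
  refine s1.trans ?_
  have s3 := (hC v hvc hvs).trans (mul_le_mul_right s2 _)
  refine (add_le_add s3 le_rfl).trans ?_
  have e1 : ENNReal.ofReal (2 * R ^ (1 - α)) = 2 * ENNReal.ofReal (R ^ (1 - α)) := by
    rw [ENNReal.ofReal_mul (by norm_num)]; simp
  have e2 : ENNReal.ofReal (R ^ (1 - α)) * ENNReal.ofReal (K * R⁻¹) = K.toNNReal * ENNReal.ofReal (R ^ (-α)) := by
    change _ = ENNReal.ofReal K * _
    rw [← ENNReal.ofReal_mul (by positivity), ← ENNReal.ofReal_mul hK0]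
    congr 1
    rw [Real.rpow_sub hR, Real.rpow_one, Real.rpow_neg hR.le]
    field_simp
  rw [e1]
  generalize ENNReal.ofReal (R ^ (1 - α)) = r1 at *
  generalize ENNReal.ofReal (R ^ (-α)) = r0 at *
  calc _ = 2 * C * (r1 * N1) + 2 * C * (r1 * ENNReal.ofReal (K * R⁻¹)) * N0 + r0 * N0 := by ring
    _ = 2 * C * (r1 * N1) + (2 * C * K.toNNReal + 1) * (r0 * N0) := by rw [e2]; ring
    _ ≤ (2 * C + 2 * C * K.toNNReal + 1) * (r1 * N1) + (2 * C + 2 * C * K.toNNReal + 1) * (r0 * N0) := by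
      gcongr
      · rw [add_assoc]; exact le_self_add
      · exact le_add_self
    _ = _ := by push_cast; ring

lemma grad_finite {n : ℕ} (hn : 1 ≤ n) {β : ℝ} (hβ : -(n/2:ℝ) < β) {u : Euc n → ℂ} (hu : ContDiff ℝ (⊤ : ℕ∞) u)
    (hs : HasCompactSupport u) : wL2 β (fun x => (‖fderiv ℝ u x‖₊ : ℝ≥0∞)) ≠ ⊤ := by
  have hc := hu.continuous_fderiv (by simp)
  have := wL2_lt_top hn hβ (f := fun x => ((‖fderiv ℝ u x‖ : ℝ) : ℂ)) (by fun_prop)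
    ((hs.fderiv ℝ).comp_left (g := fun L : Euc n →L[ℝ] ℂ => ((‖L‖ : ℝ) : ℂ)) (by simp))
  refine (lt_of_le_of_lt (wL2_mono β fun x => ?_) this).ne
  simp

/-- For `n ≥ 3`, `α ∈ (0,1]`, `β ∈ (α - n/2, n/2)`:
`‖|x|^β D^α u‖_{L²} ≲ ‖|x|^β ∇u‖_{L²}^α ‖|x|^β u‖_{L²}^{1-α}` and consequently
`‖|x|^{β-α} u‖_{L²} ≲ ‖|x|^β ∇u‖_{L²}^α ‖|x|^β u‖_{L²}^{1-α}`, for `u ∈ C_0^∞(ℝⁿ)`. -/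
theorem weighted_interpolation (n : ℕ) (hn : 3 ≤ n) (α β : ℝ) (hα0 : 0 < α) (hα1 : α ≤ 1)
    (hβ1 : α - n/2 < β) (hβ2 : β < n/2) :
    ∃ C : ℝ≥0, ∀ u : Euc n → ℂ, ContDiff ℝ (⊤ : ℕ∞) u → HasCompactSupport u →
      wL2 β (fun x => (‖fracD α u x‖₊ : ℝ≥0∞)) ≤
        (C : ℝ≥0∞) * (wL2 β (fun x => (‖fderiv ℝ u x‖₊ : ℝ≥0∞))) ^ α *
          (wL2 β (fun x => (‖u x‖₊ : ℝ≥0∞))) ^ (1 - α) ∧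
      wL2 (β - α) (fun x => (‖u x‖₊ : ℝ≥0∞)) ≤
        (C : ℝ≥0∞) * (wL2 β (fun x => (‖fderiv ℝ u x‖₊ : ℝ≥0∞))) ^ α *
          (wL2 β (fun x => (‖u x‖₊ : ℝ≥0∞))) ^ (1 - α) := by
  have hβ : -(n/2:ℝ) < β := by linarith
  obtain ⟨C1, h1⟩ := first_ineq (n := n) (by omega) hα0 hα1 (abs_lt.2 ⟨hβ, hβ2⟩)
  obtain ⟨C2, h2⟩ := second_ineq (n := n) (by omega) hα0 hα1 hβ1
  refine ⟨max (2 * C1) (2 * C2), fun u hu hs => ?_⟩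
  have f1 := grad_finite (by omega) hβ hu hs
  have f0 := (wL2_lt_top (by omega) hβ hu.continuous hs).ne
  refine ⟨(optim hα0 hα1 C1 f1 f0 (h1 u hu hs)).trans ?_, (optim hα0 hα1 C2 f1 f0 (h2 u hu hs)).trans ?_⟩
  · gcongr
    exact le_max_left _ _
  · gcongr
    exact le_max_right _ _
end
end

section
/- (Weighted trace estimate at α = 1) Let n ≥ 3 and β ∈ (1 − n/2, n/2). Then for all u ∈ C_0^∞(ℝ^n), ‖ r^{n/2−1+β} u ‖_{L^∞_r H^{1/2}_ω} ≲ ‖ |x|^β ∇ u ‖_{L^2(ℝ^n)}, i.e. sup_{r>0} r^{n/2 − 1 + β} ‖ u(rω) ‖_{H^{1/2}_ω} ≲ ‖ |x|^β ∇u ‖_{L^2(ℝ^n)}. -/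
open MeasureTheory Metric Set ENNReal NNReal FourierTransform

noncomputable section

lemma cs_weight {α : Type*} [MeasurableSpace α] (μ : Measure α) (f w : α → ℝ≥0∞)
    (hf : AEMeasurable f μ) (hw : AEMeasurable w μ)
    (h : ∀ᵐ x ∂μ, w x ≠ 0 ∧ w x ≠ ∞) :
    (∫⁻ x, f x ∂μ) ^ 2 ≤ (∫⁻ x, (w x)⁻¹ ∂μ) * ∫⁻ x, w x * f x ^ 2 ∂μ := by
  have key := ENNReal.lintegral_mul_le_Lp_mul_Lq μ (Real.HolderConjugate.two_two)
    (f := fun x => (w x)⁻¹ ^ (1/2 : ℝ)) (g := fun x => (w x) ^ (1/2 : ℝ) * f x)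
    (hw.inv.pow_const _) ((hw.pow_const _).mul hf)
  have e1 : ∫⁻ x, f x ∂μ = ∫⁻ x, ((fun x => (w x)⁻¹ ^ (1/2 : ℝ)) * (fun x => (w x) ^ (1/2 : ℝ) * f x)) x ∂μ := by
    apply lintegral_congr_ae
    filter_upwards [h] with x hx
    simp only [Pi.mul_apply]
    rw [← mul_assoc, ← ENNReal.mul_rpow_of_nonneg _ _ (by norm_num),
      ENNReal.inv_mul_cancel hx.1 hx.2, ENNReal.one_rpow, one_mul]
  have e2 : ∀ x, ((w x)⁻¹ ^ (1/2 : ℝ)) ^ (2 : ℝ) = (w x)⁻¹ := by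
    intro x; rw [← ENNReal.rpow_mul]; norm_num
  have e3 : ∀ x, ((w x) ^ (1/2 : ℝ) * f x) ^ (2 : ℝ) = w x * f x ^ 2 := by
    intro x; rw [ENNReal.mul_rpow_of_nonneg _ _ (by norm_num), ← ENNReal.rpow_mul]; norm_num
  rw [← e1] at key
  simp only [e2, e3] at key
  calc _ ≤ ((∫⁻ x, (w x)⁻¹ ∂μ) ^ (1/2 : ℝ) * (∫⁻ x, w x * f x ^ 2 ∂μ) ^ (1/2 : ℝ)) ^ 2 := by
        gcongr
    _ = _ := by
        rw [← ENNReal.rpow_two, ENNReal.mul_rpow_of_nonneg _ _ (by norm_num), ← ENNReal.rpow_mul,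
          ← ENNReal.rpow_mul]; norm_num

open scoped Pointwise in
lemma cap_measure (n : ℕ) (hn : 3 ≤ n) : ∃ C : ℝ≥0, ∀ y : Euc n, ∀ t : ℝ, 0 < t →
    sphMeas n {ω | dist ω.val y ≤ t} ≤ (C : ℝ≥0∞) * ENNReal.ofReal (t ^ (n - 1)) := by
  obtain ⟨M, hM⟩ : ∃ M : ℝ≥0, (M : ℝ≥0∞) = sphMeas n univ := by
    have : IsFiniteMeasure (sphMeas n) := by unfold sphMeas; infer_instance
    exact ⟨(sphMeas n univ).toNNReal, ENNReal.coe_toNNReal (measure_ne_top _ _)⟩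
  obtain ⟨V, hV⟩ : ∃ V : ℝ≥0, (V : ℝ≥0∞) = volume (ball (0 : Euc n) 1) :=
    ⟨_, ENNReal.coe_toNNReal measure_ball_lt_top.ne⟩
  refine ⟨M + n * (2 * 3 ^ n * V), fun y t ht => ?_⟩
  rcases le_or_gt 1 t with h1 | h1
  · calc _ ≤ sphMeas n univ := measure_mono (subset_univ _)
      _ = M * 1 := by rw [hM, mul_one]
      _ ≤ _ := by
        gcongr
        · simp
        · rw [ENNReal.one_le_ofReal]; exact one_le_pow₀ h1
  rcases eq_empty_or_nonempty {ω : sphere (0 : Euc n) 1 | dist ω.val y ≤ t} with he | ⟨ω₀, h₀⟩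
  · rw [he]; simp
  have hmeas : MeasurableSet {ω : sphere (0 : Euc n) 1 | dist ω.val y ≤ t} := by
    apply IsClosed.measurableSet
    exact isClosed_le (by fun_prop) continuous_const
  unfold sphMeas
  rw [Measure.toSphere_apply' _ hmeas]
  set N := ⌊1 / t⌋₊ with hN
  have hsub : (Ioo (0:ℝ) 1 • (Set.image (fun ω : sphere (0 : Euc n) 1 => (ω : Euc n)) {ω : sphere (0 : Euc n) 1 | dist ω.val y ≤ t} : Set (Euc n)))
      ⊆ ⋃ k ∈ Finset.range (N + 1), closedBall (((k : ℝ) * t) • ω₀.val) (3 * t) := by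
    rintro x ⟨r, hr, _, ⟨ω, hω, rfl⟩, rfl⟩
    simp only [mem_iUnion, Finset.mem_range, mem_closedBall, exists_prop]
    refine ⟨⌊r / t⌋₊, ?_, ?_⟩
    · rw [hN, Nat.lt_succ_iff]; apply Nat.floor_mono; gcongr; exact hr.2.le
    · have h2 : dist ω.val ω₀.val ≤ 2 * t := by
        have := dist_triangle_right ω.val ω₀.val y
        simp only [mem_ofPred_eq] at hω h₀; linarith
      have h3 : (⌊r / t⌋₊ : ℝ) * t ≤ r := by
        rw [← le_div_iff₀ ht]; exact Nat.floor_le (div_nonneg hr.1.le ht.le)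
      have h4 : r ≤ (⌊r / t⌋₊ : ℝ) * t + t := by
        have := (Nat.lt_floor_add_one (r / t)).le
        rw [div_le_iff₀ ht] at this; linarith
      have : r • ω.val - ((⌊r / t⌋₊ : ℝ) * t) • ω₀.val
        = r • (ω.val - ω₀.val) + (r - (⌊r / t⌋₊ : ℝ) * t) • ω₀.val := by
        rw [smul_sub, sub_smul]; abel
      rw [dist_eq_norm, this]
      refine (norm_add_le _ _).trans ?_
      rw [norm_smul, norm_smul, ← dist_eq_norm, norm_eq_of_mem_sphere ω₀, Real.norm_eq_abs,
        Real.norm_eq_abs, abs_of_pos hr.1, abs_of_nonneg (by linarith)]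
      nlinarith [hr.2, hr.1, dist_nonneg (x := ω.val) (y := ω₀.val)]
  have hdim : Module.finrank ℝ (Euc n) = n := by simp
  have hb : ∀ x : Euc n, volume (closedBall x (3 * t)) = ENNReal.ofReal ((3 * t) ^ n) * V := by
    intro x; rw [Measure.addHaar_closedBall _ _ (by positivity), hdim, hV]
  calc _ ≤ (n : ℝ≥0∞) * (∑ k ∈ Finset.range (N + 1), ENNReal.ofReal ((3 * t) ^ n) * V) := by
        rw [hdim]
        gcongr
        refine (measure_mono hsub).trans ((measure_biUnion_finset_le _ _).trans ?_)
        gcongr with k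
        exact (hb _).le
    _ = n * (ENNReal.ofReal ((N + 1) * (3 * t) ^ n) * V) := by
        rw [Finset.sum_const, Finset.card_range, nsmul_eq_mul, ← mul_assoc (((N + 1 : ℕ)) : ℝ≥0∞),
          ENNReal.ofReal_mul (by positivity)]
        congr 3
        rw [← Nat.cast_succ, ENNReal.ofReal_natCast]
    _ ≤ n * (ENNReal.ofReal (2 * 3 ^ n * t ^ (n - 1)) * V) := by
        gcongr n * (ENNReal.ofReal ?_ * V)
        have : (N : ℝ) ≤ 1 / t := Nat.floor_le (by positivity)
        have e : t ^ n = t * t ^ (n - 1) := by rw [← pow_succ']; congr 1; omega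
        have h5 : ((N : ℝ) + 1) * t ≤ 2 := by
          rw [le_div_iff₀ ht] at this; linarith
        calc ((N : ℝ) + 1) * (3 * t) ^ n = (((N : ℝ) + 1) * t) * 3 ^ n * t ^ (n - 1) := by
              rw [mul_pow, e]; ring
          _ ≤ _ := by gcongr
    _ = (n * (2 * 3 ^ n * V)) * ENNReal.ofReal (t ^ (n - 1)) := by
        rw [ENNReal.ofReal_mul (by positivity), ENNReal.ofReal_mul (by positivity),
          ENNReal.ofReal_pow (by positivity)]
        norm_num; ring
    _ ≤ _ := by
        gcongr
        push_cast
        exact le_add_self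

/-- Truncated cone indicator. -/
def chi {n : ℕ} (ω w : Euc n) : ℝ≥0∞ :=
  indicator {p : Euc n × Euc n | ‖p.2‖ ≤ 7 * inner ℝ p.1 p.2 ∧ ‖p.2‖ ≤ 7} 1 (ω, w)

lemma chi_of {n : ℕ} {ω w : Euc n} (h : ‖w‖ ≤ 7 * inner ℝ ω w) (h' : ‖w‖ ≤ 7) : chi ω w = 1 := by
  unfold chi; rw [indicator_of_mem]; · rfl
  exact ⟨h, h'⟩

lemma chi_of_not {n : ℕ} {ω w : Euc n} (h : ¬ (‖w‖ ≤ 7 * inner ℝ ω w ∧ ‖w‖ ≤ 7)) : chi ω w = 0 := by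
  unfold chi; rw [indicator_of_notMem]; exact h

lemma measurable_chi {n : ℕ} : Measurable (fun p : Euc n × Euc n => chi p.1 p.2) := by
  unfold chi
  refine Measurable.indicator measurable_one ?_
  apply IsClosed.measurableSet
  refine IsClosed.and ?_ ?_
  · exact isClosed_le (by fun_prop) (by fun_prop)
  · exact isClosed_le (by fun_prop) (by fun_prop)

lemma chi_smul {n : ℕ} (ω w : Euc n) {s : ℝ} (h0 : 0 < s) (h1 : s ≤ 1) : chi ω w ≤ chi ω (s • w) := by
  by_cases h : (‖w‖ ≤ 7 * inner ℝ ω w ∧ ‖w‖ ≤ 7)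
  · rw [chi_of h.1 h.2, chi_of]
    · rw [norm_smul, inner_smul_right, Real.norm_eq_abs, abs_of_pos h0]; nlinarith [h.1]
    · rw [norm_smul, Real.norm_eq_abs, abs_of_pos h0]; nlinarith [norm_nonneg w, h.2]
  · rw [chi_of_not h]; exact zero_le

lemma chi_shell {n : ℕ} (ω : sphere (0 : Euc n) 1) (y : Euc n)
    (h : ‖y - ω.val‖ ≤ 7 * inner ℝ ω.val (y - ω.val)) :
    ‖y - ω.val‖ ≤ 7 * (‖y‖ - 1) ∧ ‖y‖ - 1 ≤ ‖y - ω.val‖ := by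
  have h1 : ‖ω.val‖ = 1 := norm_eq_of_mem_sphere ω
  constructor
  · have := real_inner_le_norm ω.val y
    rw [inner_sub_right, real_inner_self_eq_norm_sq, h1] at h
    rw [h1] at this
    linarith
  · have := norm_sub_norm_le y ω.val; linarith

lemma cone_int (n : ℕ) (hn : 3 ≤ n) : ∃ C : ℝ≥0, ∀ y : Euc n,
    ∫⁻ ω, chi ω.val (y - ω.val) * ENNReal.ofReal ((‖y - ω.val‖ ^ (n - 1))⁻¹) ∂(sphMeas n) ≤
      (C : ℝ≥0∞) * indicator {x : Euc n | 1 ≤ ‖x‖ ∧ ‖x‖ ≤ 8} 1 y := by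
  obtain ⟨C, hC⟩ := cap_measure n hn
  refine ⟨C * 7 ^ (n - 1), fun y => ?_⟩
  have hn1 : n - 1 ≠ 0 := by omega
  by_cases hy : 1 < ‖y‖ ∧ ‖y‖ ≤ 8
  · have hd : 0 < ‖y‖ - 1 := by linarith [hy.1]
    rw [indicator_of_mem (by exact ⟨hy.1.le, hy.2⟩), Pi.one_apply, mul_one]
    have hm : MeasurableSet {ω : sphere (0 : Euc n) 1 | dist ω.val y ≤ 7 * (‖y‖ - 1)} :=
      (isClosed_le (by fun_prop) continuous_const).measurableSet
    calc _ ≤ ∫⁻ ω, indicator {ω : sphere (0 : Euc n) 1 | dist ω.val y ≤ 7 * (‖y‖ - 1)}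
          (fun _ => ENNReal.ofReal (((‖y‖ - 1) ^ (n - 1))⁻¹)) ω ∂(sphMeas n) := by
          apply lintegral_mono
          intro ω
          by_cases h : (‖y - ω.val‖ ≤ 7 * inner ℝ ω.val (y - ω.val) ∧ ‖y - ω.val‖ ≤ 7)
          · obtain ⟨h1, h2⟩ := chi_shell ω y h.1
            simp only
            rw [chi_of h.1 h.2, one_mul, indicator_of_mem (by
              rw [mem_ofPred_eq, dist_eq_norm, norm_sub_rev]; exact h1)]
            gcongr
          · simp only
            rw [chi_of_not h, zero_mul]; exact zero_le
      _ = ENNReal.ofReal (((‖y‖ - 1) ^ (n - 1))⁻¹) *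
          sphMeas n {ω : sphere (0 : Euc n) 1 | dist ω.val y ≤ 7 * (‖y‖ - 1)} := by
          rw [lintegral_indicator_const hm]
      _ ≤ ENNReal.ofReal (((‖y‖ - 1) ^ (n - 1))⁻¹) *
          (C * ENNReal.ofReal ((7 * (‖y‖ - 1)) ^ (n - 1))) := by
          gcongr; exact hC _ _ (by positivity)
      _ = _ := by
          rw [mul_left_comm, ← ENNReal.ofReal_mul (by positivity), mul_pow, mul_left_comm,
            inv_mul_cancel₀ (by positivity), mul_one, ENNReal.ofReal_pow (by norm_num)]
          norm_num
  · have : ∀ ω : sphere (0 : Euc n) 1,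
        chi ω.val (y - ω.val) * ENNReal.ofReal ((‖y - ω.val‖ ^ (n - 1))⁻¹) = 0 := by
      intro ω
      by_cases h : (‖y - ω.val‖ ≤ 7 * inner ℝ ω.val (y - ω.val) ∧ ‖y - ω.val‖ ≤ 7)
      · obtain ⟨h1, h2⟩ := chi_shell ω y h.1
        have h8 : ‖y‖ ≤ 8 := by linarith [h.2]
        have : ‖y - ω.val‖ = 0 := by
          apply le_antisymm _ (norm_nonneg _)
          have : ‖y‖ ≤ 1 := by by_contra hc; exact hy ⟨not_le.1 hc, h8⟩
          linarith
        rw [this, zero_pow hn1]; simp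
      · rw [chi_of_not h, zero_mul]
    simp only [this, lintegral_zero]
    exact zero_le

/-- The constant `∫₀¹ s^{-1/2} ds`. -/
def Aconst : ℝ≥0∞ := ∫⁻ s in Ioc (0:ℝ) 1, (ENNReal.ofReal (s ^ (1/2 : ℝ)))⁻¹

lemma Aconst_eq : Aconst = ∫⁻ s in Ioc (0:ℝ) 1, ENNReal.ofReal (s ^ (-1/2 : ℝ)) := by
  unfold Aconst
  apply setLIntegral_congr_fun measurableSet_Ioc
  intro s hs
  simp only
  rw [← ENNReal.ofReal_inv_of_pos (Real.rpow_pos_of_pos hs.1 _), ← Real.rpow_neg hs.1.le]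
  norm_num

lemma Aconst_ne_top : Aconst ≠ ∞ := by
  rw [Aconst_eq]
  have h := (intervalIntegral.intervalIntegrable_rpow' (a := 0) (b := 1) (r := (-1/2 : ℝ))
    (by norm_num)).1
  exact (Integrable.lintegral_lt_top h).ne

lemma seg_bound {n : ℕ} (u : Euc n → ℂ) (hu : ContDiff ℝ (⊤ : ℕ∞) u) (x v : Euc n) :
    ‖u x - u (x + v)‖ₑ ^ 2 ≤ Aconst * ‖v‖ₑ ^ 2 *
      ∫⁻ s in Ioc (0:ℝ) 1, ENNReal.ofReal (s ^ (1/2 : ℝ)) * ‖fderiv ℝ u (x + s • v)‖ₑ ^ 2 := by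
  have hd : Differentiable ℝ u := hu.differentiable (by simp)
  have hc : Continuous (fderiv ℝ u) := hu.continuous_fderiv (by simp)
  have hder : ∀ s ∈ uIcc (0:ℝ) 1, HasDerivAt (fun s : ℝ => u (x + s • v))
      (fderiv ℝ u (x + s • v) v) s := by
    intro s _
    have h1 : HasDerivAt (fun s : ℝ => x + s • v) v s := by
      simpa using ((hasDerivAt_id s).smul_const v).const_add x
    exact (hd (x + s • v)).hasFDerivAt.comp_hasDerivAt s h1
  have hcont : Continuous (fun s : ℝ => fderiv ℝ u (x + s • v)) := by fun_prop
  have hftc := intervalIntegral.integral_eq_sub_of_hasDerivAt hder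
    ((hcont.clm_apply continuous_const).intervalIntegrable _ _)
  simp only [one_smul, zero_smul, add_zero] at hftc
  have h1 : ‖u x - u (x + v)‖ₑ ≤ ‖v‖ₑ * ∫⁻ s in Ioc (0:ℝ) 1, ‖fderiv ℝ u (x + s • v)‖ₑ := by
    rw [← enorm_neg, neg_sub, ← hftc, intervalIntegral.integral_of_le zero_le_one,
      ← lintegral_const_mul _ (by fun_prop)]
    refine (enorm_integral_le_lintegral_enorm _).trans (lintegral_mono fun s => ?_)
    rw [mul_comm]
    exact ContinuousLinearMap.le_opENorm _ _
  have h2 := cs_weight (volume.restrict (Ioc (0:ℝ) 1)) (fun s => ‖fderiv ℝ u (x + s • v)‖ₑ)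
    (fun s => ENNReal.ofReal (s ^ (1/2 : ℝ))) (by fun_prop) (by fun_prop) (by
      filter_upwards [ae_restrict_mem measurableSet_Ioc] with s hs
      refine ⟨?_, ENNReal.ofReal_ne_top⟩
      simpa using Real.rpow_pos_of_pos hs.1 _)
  calc _ ≤ (‖v‖ₑ * ∫⁻ s in Ioc (0:ℝ) 1, ‖fderiv ℝ u (x + s • v)‖ₑ) ^ 2 := by gcongr
    _ = ‖v‖ₑ ^ 2 * (∫⁻ s in Ioc (0:ℝ) 1, ‖fderiv ℝ u (x + s • v)‖ₑ) ^ 2 := mul_pow _ _ _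
    _ ≤ ‖v‖ₑ ^ 2 * (Aconst * ∫⁻ s in Ioc (0:ℝ) 1,
          ENNReal.ofReal (s ^ (1/2 : ℝ)) * ‖fderiv ℝ u (x + s • v)‖ₑ ^ 2) := by
        gcongr; exact h2
    _ = _ := by ring

lemma lintegral_smul_euc {n : ℕ} (f : Euc n → ℝ≥0∞) (hf : Measurable f) {s : ℝ} (hs : 0 < s) :
    ∫⁻ v, f (s • v) = ENNReal.ofReal ((s ^ n)⁻¹) * ∫⁻ v, f v := by
  have h1 : ∫⁻ v, f (s • v) = ∫⁻ v, f v ∂(Measure.map (fun x : Euc n => s • x) volume) := by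
    rw [lintegral_map hf (by fun_prop)]
  rw [h1, Measure.map_addHaar_smul volume hs.ne', lintegral_smul_measure]
  simp [abs_of_pos hs]

lemma cone_point {n : ℕ} (hn : 3 ≤ n) (u : Euc n → ℂ) (hu : ContDiff ℝ (⊤ : ℕ∞) u) (ω : Euc n) :
    ∫⁻ z, chi ω (z - ω) * ENNReal.ofReal ((‖z - ω‖ ^ (n + 1))⁻¹) * ‖u ω - u z‖ₑ ^ 2 ≤
    Aconst ^ 2 * ∫⁻ y, chi ω (y - ω) * ENNReal.ofReal ((‖y - ω‖ ^ (n - 1))⁻¹) *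
      ‖fderiv ℝ u y‖ₑ ^ 2 := by
  have hc : Continuous (fderiv ℝ u) := hu.continuous_fderiv (by simp)
  have hcu : Continuous u := hu.continuous
  have hchi : ∀ ω : Euc n, Measurable (fun w => chi ω w) := fun ω =>
    measurable_chi.comp (f := fun w : Euc n => (ω, w)) measurable_prodMk_left
  set H : Euc n → ℝ≥0∞ := fun w => chi ω w * ENNReal.ofReal ((‖w‖ ^ (n - 1))⁻¹) *
      ‖fderiv ℝ u (ω + w)‖ₑ ^ 2 with hH
  have hHm : Measurable H := by
    have h1 := hchi ω
    have h2 : Measurable (fun w => ‖fderiv ℝ u (ω + w)‖ₑ ^ 2) :=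
      ((hc.comp (continuous_const.add continuous_id)).enorm.measurable).pow_const 2
    have h3 : Measurable (fun w : Euc n => ENNReal.ofReal ((‖w‖ ^ (n - 1))⁻¹)) := by fun_prop
    exact (h1.mul h3).mul h2
  have e1 : ∫⁻ z, chi ω (z - ω) * ENNReal.ofReal ((‖z - ω‖ ^ (n + 1))⁻¹) * ‖u ω - u z‖ₑ ^ 2
      = ∫⁻ v, chi ω v * ENNReal.ofReal ((‖v‖ ^ (n + 1))⁻¹) * ‖u ω - u (ω + v)‖ₑ ^ 2 := by
    rw [← lintegral_add_left_eq_self _ ω]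
    simp
  have e2 : ∫⁻ y, chi ω (y - ω) * ENNReal.ofReal ((‖y - ω‖ ^ (n - 1))⁻¹) *
      ‖fderiv ℝ u y‖ₑ ^ 2 = ∫⁻ w, H w := by
    rw [← lintegral_add_left_eq_self _ ω]
    simp [hH]
  rw [e1, e2]
  have hpt : ∀ v, chi ω v * ENNReal.ofReal ((‖v‖ ^ (n + 1))⁻¹) * ‖u ω - u (ω + v)‖ₑ ^ 2 ≤
      Aconst * ∫⁻ s in Ioc (0:ℝ) 1, ENNReal.ofReal (s ^ (1/2 : ℝ)) *
        (chi ω v * ENNReal.ofReal ((‖v‖ ^ (n - 1))⁻¹) * ‖fderiv ℝ u (ω + s • v)‖ₑ ^ 2) := by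
    intro v
    by_cases hv : v = 0
    · simp [hv]
    have hv' : 0 < ‖v‖ := norm_pos_iff.2 hv
    have e3 : ENNReal.ofReal ((‖v‖ ^ (n + 1))⁻¹) * ‖v‖ₑ ^ 2 = ENNReal.ofReal ((‖v‖ ^ (n - 1))⁻¹) := by
      rw [← ofReal_norm, ← ENNReal.ofReal_pow (norm_nonneg _),
        ← ENNReal.ofReal_mul (by positivity)]
      congr 1
      have : n + 1 = (n - 1) + 2 := by omega
      rw [this, pow_add]; field_simp
    calc _ ≤ chi ω v * ENNReal.ofReal ((‖v‖ ^ (n + 1))⁻¹) * (Aconst * ‖v‖ₑ ^ 2 *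
        ∫⁻ s in Ioc (0:ℝ) 1, ENNReal.ofReal (s ^ (1/2 : ℝ)) * ‖fderiv ℝ u (ω + s • v)‖ₑ ^ 2) := by
          gcongr; exact seg_bound u hu ω v
      _ = Aconst * ((chi ω v * (ENNReal.ofReal ((‖v‖ ^ (n + 1))⁻¹) * ‖v‖ₑ ^ 2)) *
        ∫⁻ s in Ioc (0:ℝ) 1, ENNReal.ofReal (s ^ (1/2 : ℝ)) * ‖fderiv ℝ u (ω + s • v)‖ₑ ^ 2) := by
          ring
      _ = _ := by
          rw [e3, ← lintegral_const_mul _ (by fun_prop)]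
          congr 1; apply lintegral_congr; intro s; ring
  refine (lintegral_mono hpt).trans ?_
  rw [lintegral_const_mul', pow_two, mul_assoc]
  swap; · exact Aconst_ne_top
  gcongr
  rw [lintegral_lintegral_swap]
  swap
  · apply Measurable.aemeasurable
    have h1 : Measurable (fun p : Euc n × ℝ => chi ω p.1) := (hchi ω).comp measurable_fst
    have h2 : Measurable (fun p : Euc n × ℝ => ‖fderiv ℝ u (ω + p.2 • p.1)‖ₑ ^ 2) :=
      ((hc.comp (by fun_prop : Continuous fun p : Euc n × ℝ => ω + p.2 • p.1)).enorm.measurable).pow_const 2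
    have h3 : Measurable (fun p : Euc n × ℝ => ENNReal.ofReal ((‖p.1‖ ^ (n - 1))⁻¹)) := by fun_prop
    have h4 : Measurable (fun p : Euc n × ℝ => ENNReal.ofReal (p.2 ^ (1/2 : ℝ))) := by fun_prop
    exact h4.mul ((h1.mul h3).mul h2)
  rw [Aconst_eq, ← lintegral_mul_const _ (by fun_prop)]
  apply setLIntegral_mono (by fun_prop)
  intro s hs
  rw [lintegral_const_mul' _ _ ENNReal.ofReal_ne_top]
  have hs0 := hs.1
  calc _ ≤ ENNReal.ofReal (s ^ (1/2 : ℝ)) * ∫⁻ v, ENNReal.ofReal (s ^ (n - 1)) * H (s • v) := by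
        gcongr ENNReal.ofReal _ * ?_
        refine lintegral_mono fun v => ?_
        have : ENNReal.ofReal ((‖v‖ ^ (n - 1))⁻¹) =
          ENNReal.ofReal (s ^ (n - 1)) * ENNReal.ofReal ((‖s • v‖ ^ (n - 1))⁻¹) := by
          rw [← ENNReal.ofReal_mul (by positivity), norm_smul, Real.norm_eq_abs, abs_of_pos hs0,
            mul_pow, mul_inv, mul_inv_cancel_left₀ (by positivity)]
        simp only [hH]
        rw [this]
        calc _ ≤ chi ω (s • v) * (ENNReal.ofReal (s ^ (n - 1)) *
            ENNReal.ofReal ((‖s • v‖ ^ (n - 1))⁻¹)) * ‖fderiv ℝ u (ω + s • v)‖ₑ ^ 2 := by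
              gcongr; exact chi_smul ω v hs0 hs.2
          _ = _ := by ring
    _ = ENNReal.ofReal (s ^ (1/2 : ℝ)) * (ENNReal.ofReal (s ^ (n - 1)) *
          (ENNReal.ofReal ((s ^ n)⁻¹) * ∫⁻ v, H v)) := by
        rw [lintegral_const_mul' _ _ ENNReal.ofReal_ne_top, lintegral_smul_euc H hHm hs0]
    _ = ENNReal.ofReal (s ^ (1/2 : ℝ) * (s ^ (n - 1) * (s ^ n)⁻¹)) * ∫⁻ v, H v := by
        rw [ENNReal.ofReal_mul (by positivity), ENNReal.ofReal_mul (by positivity)]; ring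
    _ ≤ _ := by
        gcongr
        have e : s ^ n = s ^ (n - 1) * s := by rw [← pow_succ]; congr 1; omega
        have e' : s ^ (n - 1) * (s ^ n)⁻¹ = s⁻¹ := by rw [e]; field_simp
        rw [e', ← Real.rpow_neg_one s, ← Real.rpow_add hs0]
        norm_num

lemma measurable_chi_sph {n : ℕ} :
    Measurable (fun p : sphere (0 : Euc n) 1 × Euc n => chi p.1.val (p.2 - p.1.val)) :=
  measurable_chi.comp (f := fun p : sphere (0 : Euc n) 1 × Euc n => (p.1.val, p.2 - p.1.val))
    ((measurable_subtype_coe.comp measurable_fst).prodMk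
      (measurable_snd.sub (measurable_subtype_coe.comp measurable_fst)))

instance instSFiniteSphMeas (n : ℕ) : IsFiniteMeasure (sphMeas n) := by
  unfold sphMeas; infer_instance

lemma cone_total (n : ℕ) (hn : 3 ≤ n) : ∃ C : ℝ≥0, ∀ u : Euc n → ℂ, ContDiff ℝ (⊤ : ℕ∞) u →
    ∫⁻ ω, ∫⁻ z, chi ω.val (z - ω.val) * ENNReal.ofReal ((‖z - ω.val‖ ^ (n + 1))⁻¹) *
      ‖u ω.val - u z‖ₑ ^ 2 ∂volume ∂(sphMeas n) ≤
    C * ∫⁻ y in {x : Euc n | 1 ≤ ‖x‖ ∧ ‖x‖ ≤ 8}, ‖fderiv ℝ u y‖ₑ ^ 2 := by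
  obtain ⟨C, hC⟩ := cone_int n hn
  obtain ⟨A, hA⟩ : ∃ A : ℝ≥0, (A : ℝ≥0∞) = Aconst := ⟨_, ENNReal.coe_toNNReal Aconst_ne_top⟩
  refine ⟨A ^ 2 * C, fun u hu => ?_⟩
  have hc : Continuous (fderiv ℝ u) := hu.continuous_fderiv (by simp)
  have hm : MeasurableSet {x : Euc n | 1 ≤ ‖x‖ ∧ ‖x‖ ≤ 8} :=
    ((isClosed_le (by fun_prop) (by fun_prop)).and
      (isClosed_le (by fun_prop) (by fun_prop))).measurableSet
  have hchi := measurable_chi_sph (n := n)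
  have hg : Measurable (fun y => ‖fderiv ℝ u y‖ₑ ^ 2) := (hc.enorm.measurable).pow_const 2
  have hmono := lintegral_mono (μ := sphMeas n) (fun ω : sphere (0 : Euc n) 1 => cone_point hn u hu ω.val)
  refine le_trans hmono ?_
  clear hmono
  rw [lintegral_const_mul' _ _ (ENNReal.pow_ne_top Aconst_ne_top), ← hA]
  push_cast
  rw [mul_assoc]
  gcongr
  rw [lintegral_lintegral_swap]
  swap
  · apply Measurable.aemeasurable
    have h2 : Measurable (fun p : sphere (0 : Euc n) 1 × Euc n => ‖fderiv ℝ u p.2‖ₑ ^ 2) :=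
      hg.comp measurable_snd
    have h3 : Measurable (fun p : sphere (0 : Euc n) 1 × Euc n =>
        ENNReal.ofReal ((‖p.2 - p.1.val‖ ^ (n - 1))⁻¹)) := by fun_prop
    exact (hchi.mul h3).mul h2
  rw [← lintegral_indicator hm, ← lintegral_const_mul _ (hg.indicator hm)]
  apply lintegral_mono
  intro y
  have : ‖fderiv ℝ u y‖ₑ ^ 2 ≠ ∞ := by finiteness
  simp only
  rw [lintegral_mul_const' _ _ this]
  refine (mul_le_mul_left (hC y) _).trans ?_
  rw [mul_assoc]
  gcongr
  by_cases h : y ∈ {x : Euc n | 1 ≤ ‖x‖ ∧ ‖x‖ ≤ 8}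
  · rw [indicator_of_mem h, indicator_of_mem h]; simp
  · rw [indicator_of_notMem h, indicator_of_notMem h]; simp

/-- Region of averaging points seen from `ω` at the scale of a second point. -/
def regSet (n : ℕ) : Set (Euc n × Euc n × Euc n) :=
  {p | 0 < ‖p.1 - p.2.1‖ ∧ ‖p.2.2 - p.1‖ ≤ 7 * ‖p.1 - p.2.1‖ ∧
    ‖p.1 - p.2.1‖ ≤ inner ℝ p.1 (p.2.2 - p.1) ∧ ‖p.1 - p.2.1‖ ≤ 1}

/-- Indicator of `regSet`. -/
def reg {n : ℕ} (ω ω' z : Euc n) : ℝ≥0∞ := indicator (regSet n) 1 (ω, ω', z)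

lemma measurableSet_regSet (n : ℕ) : MeasurableSet (regSet n) := by
  unfold regSet
  refine MeasurableSet.inter (s₁ := {p : Euc n × Euc n × Euc n | 0 < ‖p.1 - p.2.1‖}) ?_ ?_
  · exact (isOpen_lt (by fun_prop) (by fun_prop)).measurableSet
  · exact ((isClosed_le (by fun_prop) (by fun_prop)).and
      ((isClosed_le (by fun_prop) (by fun_prop)).and
      (isClosed_le (by fun_prop) (by fun_prop)))).measurableSet

lemma measurable_reg {n : ℕ} : Measurable (fun p : Euc n × Euc n × Euc n => reg p.1 p.2.1 p.2.2) := by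
  unfold reg
  exact Measurable.indicator measurable_one (measurableSet_regSet n)

lemma bracket (n : ℕ) (hn : 3 ≤ n) : ∃ C : ℝ≥0, ∀ ω z : Euc n, ‖ω‖ = 1 →
    ∫⁻ ω', ENNReal.ofReal ((‖ω - ω'.val‖ ^ (2 * n))⁻¹) * reg ω ω'.val z ∂(sphMeas n) ≤
      (C : ℝ≥0∞) * (chi ω (z - ω) * ENNReal.ofReal ((‖z - ω‖ ^ (n + 1))⁻¹)) := by
  obtain ⟨C, hC⟩ := cap_measure n hn
  refine ⟨C * 7 ^ (2 * n), fun ω z hω => ?_⟩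
  have hz : ∀ ω' : Euc n, reg ω ω' z ≠ 0 → 0 < ‖ω - ω'‖ ∧ ‖z - ω‖ ≤ 7 * ‖ω - ω'‖ ∧
    ‖ω - ω'‖ ≤ inner ℝ ω (z - ω) ∧ ‖ω - ω'‖ ≤ 1 := by
    intro ω' h
    have h' : (ω, ω', z) ∈ regSet n := by
      by_contra hc
      exact h (by unfold reg; rw [indicator_of_notMem hc])
    exact h'
  have hin : inner ℝ ω (z - ω) ≤ ‖z - ω‖ := by
    have := real_inner_le_norm ω (z - ω)
    rwa [hω, one_mul] at this
  by_cases hg : chi ω (z - ω) ≠ 0 ∧ 0 < ‖z - ω‖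
  · have hchi1 : chi ω (z - ω) = 1 := by
      by_contra hne
      refine hg.1 (chi_of_not fun h => hne (chi_of h.1 h.2))
    have hd := hg.2
    set d := ‖z - ω‖ with hdd
    have hm : MeasurableSet {ω' : sphere (0 : Euc n) 1 | dist ω'.val ω ≤ d} :=
      (isClosed_le (by fun_prop) continuous_const).measurableSet
    calc _ ≤ ∫⁻ ω', indicator {ω' : sphere (0 : Euc n) 1 | dist ω'.val ω ≤ d}
          (fun _ => ENNReal.ofReal (((d / 7) ^ (2 * n))⁻¹)) ω' ∂(sphMeas n) := by
          apply lintegral_mono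
          intro ω'
          simp only
          by_cases h : reg ω ω'.val z = 0
          · rw [h, mul_zero]; exact zero_le
          · obtain ⟨h1, h2, h3, h4⟩ := hz _ h
            have hr : reg ω ω'.val z ≤ 1 := by
              unfold reg; exact indicator_le_self' (fun _ _ => zero_le) _
            rw [indicator_of_mem (by
              rw [mem_ofPred_eq, dist_eq_norm, norm_sub_rev]; exact h3.trans hin)]
            calc _ ≤ ENNReal.ofReal ((‖ω - ω'.val‖ ^ (2 * n))⁻¹) * 1 := by gcongr
              _ ≤ _ := by
                rw [mul_one]
                gcongr
                linarith
      _ = ENNReal.ofReal (((d / 7) ^ (2 * n))⁻¹) *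
          sphMeas n {ω' : sphere (0 : Euc n) 1 | dist ω'.val ω ≤ d} := by
          rw [lintegral_indicator_const hm]
      _ ≤ ENNReal.ofReal (((d / 7) ^ (2 * n))⁻¹) * (C * ENNReal.ofReal (d ^ (n - 1))) := by
          gcongr; exact hC _ _ hd
      _ = C * ENNReal.ofReal (7 ^ (2 * n) * (d ^ (n + 1))⁻¹) := by
          rw [mul_left_comm, ← ENNReal.ofReal_mul (by positivity)]
          congr 2
          have : 2 * n = (n - 1) + (n + 1) := by omega
          rw [div_pow, this, pow_add d]
          field_simp
      _ = _ := by
          rw [hchi1, ENNReal.ofReal_mul (by positivity), ENNReal.ofReal_pow (by norm_num)]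
          push_cast
          norm_num
          ring
  · have : ∀ ω' : sphere (0 : Euc n) 1,
        ENNReal.ofReal ((‖ω - ω'.val‖ ^ (2 * n))⁻¹) * reg ω ω'.val z = 0 := by
      intro ω'
      by_cases h : reg ω ω'.val z = 0
      · rw [h, mul_zero]
      · exfalso
        obtain ⟨h1, h2, h3, h4⟩ := hz _ h
        apply hg
        refine ⟨?_, by linarith⟩
        rw [chi_of (by linarith) (by linarith)]; exact one_ne_zero
    simp only [this, lintegral_zero]
    exact zero_le

lemma enorm_sub_sq_le (a b : ℂ) : ‖a - b‖ₑ ^ 2 ≤ 2 * ‖a‖ₑ ^ 2 + 2 * ‖b‖ₑ ^ 2 := by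
  have h : ‖a - b‖₊ ^ 2 ≤ 2 * ‖a‖₊ ^ 2 + 2 * ‖b‖₊ ^ 2 := by
    have h3 : ‖a - b‖ ≤ ‖a‖ + ‖b‖ := norm_sub_le a b
    have : ‖a - b‖ ^ 2 ≤ 2 * ‖a‖ ^ 2 + 2 * ‖b‖ ^ 2 := by
      nlinarith [norm_nonneg (a - b), norm_nonneg a, norm_nonneg b, sq_nonneg (‖a‖ - ‖b‖)]
    exact_mod_cast this
  simp only [enorm_eq_nnnorm]
  exact_mod_cast h

lemma pair_bound {n : ℕ} (u : Euc n → ℂ) (hu : Continuous u) (ω ω' : Euc n)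
    (hω : ‖ω‖ = 1) (hω' : ‖ω'‖ = 1) (h0 : 0 < ‖ω - ω'‖) (h1 : ‖ω - ω'‖ ≤ 1) :
    ‖u ω - u ω'‖ₑ ^ 2 * (ENNReal.ofReal (‖ω - ω'‖ ^ n) * volume (ball (0 : Euc n) 1)) ≤
      2 * (∫⁻ z, reg ω ω' z * ‖u ω - u z‖ₑ ^ 2) + 2 * ∫⁻ z, reg ω' ω z * ‖u ω' - u z‖ₑ ^ 2 := by
  set t := ‖ω - ω'‖ with ht
  set c : Euc n := ω + (5 * t) • ω with hc
  have hb : volume (closedBall c t) = ENNReal.ofReal (t ^ n) * volume (ball (0 : Euc n) 1) := by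
    rw [Measure.addHaar_closedBall _ _ h0.le]; simp
  have hii : inner ℝ ω' ω = 1 - t ^ 2 / 2 := by
    have := norm_sub_sq_real ω ω'
    rw [hω, hω', ← ht, real_inner_comm] at this
    linarith
  have hmem1 : ∀ z ∈ closedBall c t, reg ω ω' z = 1 := by
    intro z hz
    rw [mem_closedBall, dist_eq_norm] at hz
    unfold reg
    rw [indicator_of_mem]; · rfl
    have e : z - ω = (z - c) + (5 * t) • ω := by rw [hc]; abel
    refine ⟨h0, ?_, ?_, h1⟩
    · change ‖z - ω‖ ≤ 7 * t
      rw [e]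
      refine (norm_add_le _ _).trans ?_
      rw [norm_smul, hω, Real.norm_eq_abs, abs_of_pos (by positivity)]
      linarith
    · change t ≤ inner ℝ ω (z - ω)
      rw [e, inner_add_right, inner_smul_right, real_inner_self_eq_norm_sq, hω]
      have := neg_le_of_abs_le (abs_real_inner_le_norm ω (z - c))
      rw [hω] at this
      linarith
  have hmem2 : ∀ z ∈ closedBall c t, reg ω' ω z = 1 := by
    intro z hz
    rw [mem_closedBall, dist_eq_norm] at hz
    unfold reg
    rw [indicator_of_mem]; · rfl
    have e : z - ω' = (z - c) + (5 * t) • ω + (ω - ω') := by rw [hc]; abel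
    have hts : ‖ω' - ω‖ = t := norm_sub_rev _ _
    refine ⟨by simpa only [hts] using h0, ?_, ?_, by simpa only [hts] using h1⟩
    · change ‖z - ω'‖ ≤ 7 * ‖ω' - ω‖
      rw [e, hts]
      refine (norm_add₃_le).trans ?_
      rw [norm_smul, hω, Real.norm_eq_abs, abs_of_pos (by positivity), ← ht]
      linarith
    · change ‖ω' - ω‖ ≤ inner ℝ ω' (z - ω')
      rw [hts, e, inner_add_right, inner_add_right, inner_smul_right, inner_sub_right ω' ω ω',
        real_inner_self_eq_norm_sq, hω', hii]
      have := neg_le_of_abs_le (abs_real_inner_le_norm ω' (z - c))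
      rw [hω'] at this
      nlinarith [mul_pos h0 h0, mul_nonneg h0.le (sub_nonneg.2 h1),
        mul_nonneg (mul_nonneg h0.le h0.le) (sub_nonneg.2 h1)]
  have hpt : ∀ z, ‖u ω - u ω'‖ₑ ^ 2 ≤ 2 * ‖u ω - u z‖ₑ ^ 2 + 2 * ‖u ω' - u z‖ₑ ^ 2 := by
    intro z
    have : u ω - u ω' = (u ω - u z) - (u ω' - u z) := by ring
    rw [this]; exact enorm_sub_sq_le _ _
  have hmeas : ∀ a : ℂ, Measurable fun z => 2 * ‖a - u z‖ₑ ^ 2 := by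
    intro a
    exact (((continuous_const.sub hu).enorm.measurable).pow_const 2).const_mul 2
  calc _ = ∫⁻ z in closedBall c t, ‖u ω - u ω'‖ₑ ^ 2 := by
        rw [setLIntegral_const, hb]
    _ ≤ ∫⁻ z in closedBall c t, (2 * ‖u ω - u z‖ₑ ^ 2 + 2 * ‖u ω' - u z‖ₑ ^ 2) :=
        lintegral_mono hpt
    _ = (∫⁻ z in closedBall c t, 2 * ‖u ω - u z‖ₑ ^ 2) +
          ∫⁻ z in closedBall c t, 2 * ‖u ω' - u z‖ₑ ^ 2 := lintegral_add_left (hmeas _) _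
    _ ≤ _ := by
        rw [lintegral_const_mul' _ _ (by simp), lintegral_const_mul' _ _ (by simp)]
        apply add_le_add <;> gcongr 2 * ?_
        · calc _ = ∫⁻ z in closedBall c t, reg ω ω' z * ‖u ω - u z‖ₑ ^ 2 := by
                apply setLIntegral_congr_fun measurableSet_closedBall
                intro z hz; simp only; rw [hmem1 z hz, one_mul]
            _ ≤ _ := setLIntegral_le_lintegral _ _
        · calc _ = ∫⁻ z in closedBall c t, reg ω' ω z * ‖u ω' - u z‖ₑ ^ 2 := by
                apply setLIntegral_congr_fun measurableSet_closedBall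
                intro z hz; simp only; rw [hmem2 z hz, one_mul]
            _ ≤ _ := setLIntegral_le_lintegral _ _

lemma measurable_reg_sph {n : ℕ} :
    Measurable (fun p : (sphere (0 : Euc n) 1 × sphere (0 : Euc n) 1) × Euc n =>
      reg p.1.1.val p.1.2.val p.2) :=
  measurable_reg.comp
    (f := fun p : (sphere (0 : Euc n) 1 × sphere (0 : Euc n) 1) × Euc n =>
      (p.1.1.val, p.1.2.val, p.2))
    ((measurable_subtype_coe.comp (measurable_fst.comp measurable_fst)).prodMk
      ((measurable_subtype_coe.comp (measurable_snd.comp measurable_fst)).prodMk measurable_snd))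

/-- The auxiliary double-integral density. -/
def Tfun {n : ℕ} (u : Euc n → ℂ) (ω ω' : Euc n) : ℝ≥0∞ :=
  ∫⁻ z, ENNReal.ofReal ((‖ω - ω'‖ ^ (2 * n))⁻¹) * (reg ω ω' z * ‖u ω - u z‖ₑ ^ 2)

lemma measurable_Tint {n : ℕ} (u : Euc n → ℂ) (hu : Continuous u) :
    Measurable (fun p : (sphere (0 : Euc n) 1 × sphere (0 : Euc n) 1) × Euc n =>
      ENNReal.ofReal ((‖p.1.1.val - p.1.2.val‖ ^ (2 * n))⁻¹) *
        (reg p.1.1.val p.1.2.val p.2 * ‖u p.1.1.val - u p.2‖ₑ ^ 2)) := by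
  have h1 : Measurable (fun p : (sphere (0 : Euc n) 1 × sphere (0 : Euc n) 1) × Euc n =>
      ENNReal.ofReal ((‖p.1.1.val - p.1.2.val‖ ^ (2 * n))⁻¹)) := by fun_prop
  have h2 : Measurable (fun p : (sphere (0 : Euc n) 1 × sphere (0 : Euc n) 1) × Euc n =>
      ‖u p.1.1.val - u p.2‖ₑ ^ 2) := by
    apply Measurable.pow_const
    apply Continuous.measurable
    fun_prop
  exact h1.mul (measurable_reg_sph.mul h2)

lemma measurable_Tfun {n : ℕ} (u : Euc n → ℂ) (hu : Continuous u) :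
    Measurable (fun p : sphere (0 : Euc n) 1 × sphere (0 : Euc n) 1 => Tfun u p.1.val p.2.val) :=
  Measurable.lintegral_prod_right' (measurable_Tint u hu)

lemma T_total (n : ℕ) (hn : 3 ≤ n) : ∃ C : ℝ≥0, ∀ u : Euc n → ℂ, ContDiff ℝ (⊤ : ℕ∞) u →
    ∫⁻ ω, ∫⁻ ω', Tfun u ω.val ω'.val ∂(sphMeas n) ∂(sphMeas n) ≤
    C * ∫⁻ y in {x : Euc n | 1 ≤ ‖x‖ ∧ ‖x‖ ≤ 8}, ‖fderiv ℝ u y‖ₑ ^ 2 := by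
  obtain ⟨C, hC⟩ := bracket n hn
  obtain ⟨D, hD⟩ := cone_total n hn
  refine ⟨C * D, fun u hu => ?_⟩
  have hcu := hu.continuous
  have hle : ∀ ω : sphere (0 : Euc n) 1, ∫⁻ ω', Tfun u ω.val ω'.val ∂(sphMeas n) ≤
      C * ∫⁻ z, chi ω.val (z - ω.val) * ENNReal.ofReal ((‖z - ω.val‖ ^ (n + 1))⁻¹) *
      ‖u ω.val - u z‖ₑ ^ 2 := by
    intro ω
    unfold Tfun
    rw [lintegral_lintegral_swap, ← lintegral_const_mul' _ _ ENNReal.coe_ne_top]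
    · apply lintegral_mono
      intro z
      simp only
      have hfin : ‖u ω.val - u z‖ₑ ^ 2 ≠ ∞ := by finiteness
      have e : ∀ ω' : sphere (0 : Euc n) 1, ENNReal.ofReal ((‖ω.val - ω'.val‖ ^ (2 * n))⁻¹) *
        (reg ω.val ω'.val z * ‖u ω.val - u z‖ₑ ^ 2) =
        (ENNReal.ofReal ((‖ω.val - ω'.val‖ ^ (2 * n))⁻¹) *
        reg ω.val ω'.val z) * ‖u ω.val - u z‖ₑ ^ 2 := fun ω' => (mul_assoc _ _ _).symm
      simp only [e]
      rw [lintegral_mul_const' _ _ hfin, ← mul_assoc (C : ℝ≥0∞)]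
      gcongr
      exact hC ω.val z (norm_eq_of_mem_sphere ω)
    · apply Measurable.aemeasurable
      exact (measurable_Tint u hcu).comp
        (f := fun p : sphere (0 : Euc n) 1 × Euc n => ((ω, p.1), p.2))
        ((measurable_const.prodMk measurable_fst).prodMk measurable_snd)
  have hmono := lintegral_mono (μ := sphMeas n) hle
  refine le_trans hmono ?_
  rw [lintegral_const_mul' _ _ ENNReal.coe_ne_top]
  push_cast
  rw [mul_assoc]
  gcongr
  exact hD u hu

lemma gag_point {n : ℕ} (u : Euc n → ℂ) (hu : Continuous u) (V : ℝ≥0) (hV0 : V ≠ 0)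
    (hV : (V : ℝ≥0∞) = volume (ball (0 : Euc n) 1)) (ω ω' : sphere (0 : Euc n) 1) :
    ‖u ω.val - u ω'.val‖ₑ ^ 2 / ENNReal.ofReal (‖ω.val - ω'.val‖ ^ n) ≤
      (2 * ‖u ω.val‖ₑ ^ 2 + 2 * ‖u ω'.val‖ₑ ^ 2) +
      (((2 * V⁻¹ : ℝ≥0) : ℝ≥0∞) * Tfun u ω.val ω'.val +
        ((2 * V⁻¹ : ℝ≥0) : ℝ≥0∞) * Tfun u ω'.val ω.val) := by
  by_cases h0 : ‖ω.val - ω'.val‖ = 0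
  · have : ω.val = ω'.val := by rwa [norm_eq_zero, sub_eq_zero] at h0
    rw [this]; simp
  have h0' : 0 < ‖ω.val - ω'.val‖ := lt_of_le_of_ne (norm_nonneg _) (Ne.symm h0)
  rcases le_or_gt ‖ω.val - ω'.val‖ 1 with h1 | h1
  · refine le_trans ?_ le_add_self
    have hb := pair_bound u hu ω.val ω'.val (norm_eq_of_mem_sphere ω) (norm_eq_of_mem_sphere ω') h0' h1
    rw [← hV] at hb
    unfold Tfun
    rw [lintegral_const_mul' _ _ ENNReal.ofReal_ne_top, lintegral_const_mul' _ _ ENNReal.ofReal_ne_top,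
      norm_sub_rev ω'.val ω.val]
    set P := ∫⁻ z, reg ω.val ω'.val z * ‖u ω.val - u z‖ₑ ^ 2
    set P' := ∫⁻ z, reg ω'.val ω.val z * ‖u ω'.val - u z‖ₑ ^ 2
    set t := ‖ω.val - ω'.val‖
    have htn : ENNReal.ofReal (t ^ n) ≠ 0 := by simpa using pow_pos h0' n
    have hA : ENNReal.ofReal (t ^ n) * V ≠ 0 := mul_ne_zero htn (by simpa using hV0)
    have hA' : ENNReal.ofReal (t ^ n) * V ≠ ∞ := by finiteness
    have hx := (ENNReal.le_div_iff_mul_le (Or.inl hA) (Or.inl hA')).2 hb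
    calc _ ≤ ((2 * P + 2 * P') / (ENNReal.ofReal (t ^ n) * V)) / ENNReal.ofReal (t ^ n) := by
          gcongr
      _ = _ := by
          have e1 : ENNReal.ofReal ((t ^ (2 * n))⁻¹) =
              (ENNReal.ofReal (t ^ n))⁻¹ * (ENNReal.ofReal (t ^ n))⁻¹ := by
            rw [← ENNReal.ofReal_inv_of_pos (by positivity), ← ENNReal.ofReal_mul (by positivity),
              two_mul, pow_add, mul_inv]
          rw [e1, ENNReal.div_eq_inv_mul, ENNReal.div_eq_inv_mul,
            ENNReal.mul_inv (Or.inl htn) (Or.inl ENNReal.ofReal_ne_top), ENNReal.coe_mul,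
            ENNReal.coe_inv hV0]
          push_cast
          ring
  · refine le_trans ?_ le_self_add
    refine le_trans ?_ (enorm_sub_sq_le _ _)
    apply ENNReal.div_le_of_le_mul
    calc _ = ‖u ω.val - u ω'.val‖ₑ ^ 2 * 1 := (mul_one _).symm
      _ ≤ _ := by
        gcongr
        rw [ENNReal.one_le_ofReal]; exact one_le_pow₀ h1.le

lemma lint4 {α : Type*} [MeasurableSpace α] (μ : Measure α) (a b c d : α → ℝ≥0∞) (K : ℝ≥0∞)
    (hK : K ≠ ∞) (ha : Measurable a) (hb : Measurable b) (hc : Measurable c) :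
    ∫⁻ x, (a x + b x) + (K * c x + K * d x) ∂μ =
      (∫⁻ x, a x ∂μ + ∫⁻ x, b x ∂μ) + (K * ∫⁻ x, c x ∂μ + K * ∫⁻ x, d x ∂μ) := by
  have hab : Measurable fun x => a x + b x := ha.add hb
  rw [lintegral_add_left hab, lintegral_add_left ha, lintegral_add_left (hc.const_mul K),
    lintegral_const_mul' _ _ hK, lintegral_const_mul' _ _ hK]

lemma gag_total (n : ℕ) (hn : 3 ≤ n) : ∃ C : ℝ≥0, ∀ u : Euc n → ℂ, ContDiff ℝ (⊤ : ℕ∞) u →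
    ∫⁻ ω, ∫⁻ ω', ‖u ω.val - u ω'.val‖ₑ ^ 2 / ENNReal.ofReal (‖ω.val - ω'.val‖ ^ n)
      ∂(sphMeas n) ∂(sphMeas n) ≤
    C * (∫⁻ ω, ‖u ω.val‖ₑ ^ 2 ∂(sphMeas n) +
      ∫⁻ y in {x : Euc n | 1 ≤ ‖x‖ ∧ ‖x‖ ≤ 8}, ‖fderiv ℝ u y‖ₑ ^ 2) := by
  obtain ⟨D, hD⟩ := T_total n hn
  obtain ⟨M, hM⟩ : ∃ M : ℝ≥0, (M : ℝ≥0∞) = sphMeas n univ :=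
    ⟨(sphMeas n univ).toNNReal, ENNReal.coe_toNNReal (measure_ne_top _ _)⟩
  obtain ⟨V, hV⟩ : ∃ V : ℝ≥0, (V : ℝ≥0∞) = volume (ball (0 : Euc n) 1) :=
    ⟨_, ENNReal.coe_toNNReal measure_ball_lt_top.ne⟩
  have hV0 : V ≠ 0 := by
    intro h
    have : volume (ball (0 : Euc n) 1) ≠ 0 := (measure_ball_pos _ _ one_pos).ne'
    rw [← hV, h] at this
    exact this ENNReal.coe_zero
  refine ⟨4 * M + 2 * (2 * V⁻¹) * D, fun u hu => ?_⟩
  have hcu := hu.continuous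
  have hN : Measurable fun ω : sphere (0 : Euc n) 1 => ‖u ω.val‖ₑ ^ 2 :=
    ((hcu.comp continuous_subtype_val).enorm.measurable).pow_const 2
  have hT := measurable_Tfun u hcu
  have hT' : Measurable (fun p : sphere (0 : Euc n) 1 × sphere (0 : Euc n) 1 =>
      Tfun u p.2.val p.1.val) := hT.comp
    (f := fun p : sphere (0 : Euc n) 1 × sphere (0 : Euc n) 1 => (p.2, p.1)) measurable_swap
  set K : ℝ≥0∞ := ((2 * V⁻¹ : ℝ≥0) : ℝ≥0∞) with hK
  have hKt : K ≠ ∞ := ENNReal.coe_ne_top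
  set L := ∫⁻ ω, ‖u ω.val‖ₑ ^ 2 ∂(sphMeas n) with hL
  set TT := ∫⁻ ω, ∫⁻ ω', Tfun u ω.val ω'.val ∂(sphMeas n) ∂(sphMeas n) with hTT
  have step1 : ∀ ω : sphere (0 : Euc n) 1,
      ∫⁻ ω', ‖u ω.val - u ω'.val‖ₑ ^ 2 / ENNReal.ofReal (‖ω.val - ω'.val‖ ^ n) ∂(sphMeas n) ≤
      (2 * ‖u ω.val‖ₑ ^ 2 * M + 2 * L) + (K * ∫⁻ ω', Tfun u ω.val ω'.val ∂(sphMeas n) +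
        K * ∫⁻ ω', Tfun u ω'.val ω.val ∂(sphMeas n)) := by
    intro ω
    have hmono := lintegral_mono (μ := sphMeas n) (fun ω' : sphere (0 : Euc n) 1 =>
      gag_point u hcu V hV0 hV ω ω')
    refine le_trans hmono ?_
    clear hmono
    have hT1 : Measurable fun ω' : sphere (0 : Euc n) 1 => Tfun u ω.val ω'.val :=
      hT.comp (f := fun ω' => (ω, ω')) measurable_prodMk_left
    rw [lint4 _ _ _ _ _ _ hKt measurable_const (hN.const_mul 2) hT1,
      lintegral_const, ← hM, lintegral_const_mul' _ _ (by simp)]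
  have hmono := lintegral_mono (μ := sphMeas n) step1
  refine le_trans hmono ?_
  clear hmono
  have hI1 : Measurable fun ω : sphere (0 : Euc n) 1 => ∫⁻ ω', Tfun u ω.val ω'.val ∂(sphMeas n) :=
    Measurable.lintegral_prod_right' hT
  rw [lint4 _ _ _ _ _ _ hKt ((hN.const_mul 2).mul_const _) measurable_const hI1,
      lintegral_mul_const' _ _ ENNReal.coe_ne_top,
      lintegral_const_mul' _ _ (by simp), lintegral_const, ← hM,
      lintegral_lintegral_swap (f := fun ω ω' : sphere (0 : Euc n) 1 => Tfun u ω'.val ω.val)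
        hT'.aemeasurable, ← hL, ← hTT]
  have hTD := hD u hu
  rw [← hTT] at hTD
  set Sh := ∫⁻ y in {x : Euc n | 1 ≤ ‖x‖ ∧ ‖x‖ ≤ 8}, ‖fderiv ℝ u y‖ₑ ^ 2
  calc 2 * L * M + 2 * L * M + (K * TT + K * TT) = 4 * M * L + 2 * K * TT := by ring
    _ ≤ 4 * M * L + 2 * K * (D * Sh) := by gcongr
    _ ≤ (4 * M * L + 2 * K * (D * Sh)) + (4 * M * Sh + 2 * K * D * L) := le_self_add
    _ = _ := by rw [hK]; push_cast; ring

lemma polar_lintegral {n : ℕ} (hn : 3 ≤ n) (f : Euc n → ℝ≥0∞) (hf : Measurable f) :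
    ∫⁻ ω, (∫⁻ s in Ioi (0:ℝ), ENNReal.ofReal (s ^ (n - 1)) * f (s • ω.val)) ∂(sphMeas n) =
      ∫⁻ x, f x := by
  have hmp := (volume : Measure (Euc n)).measurePreserving_homeomorphUnitSphereProd
  have hdim : Module.finrank ℝ (Euc n) = n := by simp
  rw [hdim] at hmp
  have : Nontrivial (Euc n) := by
    apply Module.nontrivial_of_finrank_pos (R := ℝ); rw [hdim]; omega
  have hg : Measurable (fun p : sphere (0 : Euc n) 1 × Ioi (0:ℝ) => f (p.2.val • p.1.val)) :=
    hf.comp (by fun_prop)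
  have h1 := hmp.lintegral_comp hg
  have h2 : ∫⁻ a : ({0}ᶜ : Set (Euc n)), f ((homeomorphUnitSphereProd (Euc n) a).2.val •
      (homeomorphUnitSphereProd (Euc n) a).1.val) ∂(Measure.comap Subtype.val volume) = ∫⁻ x, f x := by
    have : ∀ a : ({0}ᶜ : Set (Euc n)), (homeomorphUnitSphereProd (Euc n) a).2.val •
      (homeomorphUnitSphereProd (Euc n) a).1.val = a.val := by
      intro a
      exact congrArg Subtype.val ((homeomorphUnitSphereProd (Euc n)).symm_apply_apply a)
    simp only [this]
    rw [lintegral_subtype_comap (measurableSet_singleton _).compl, restrict_compl_singleton]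
  rw [← h2, h1, lintegral_prod _ hg.aemeasurable]
  unfold sphMeas
  apply lintegral_congr
  intro ω
  unfold Measure.volumeIoiPow
  have hg' : Measurable (fun y : Ioi (0:ℝ) => f (y.val • ω.val)) := hf.comp (by fun_prop)
  change _ = ∫⁻ y : Ioi (0:ℝ), f (y.val • ω.val) ∂_
  rw [lintegral_withDensity_eq_lintegral_mul _ (by fun_prop) hg',
    ← lintegral_subtype_comap measurableSet_Ioi]
  rfl

lemma ray_bound {n : ℕ} (u : Euc n → ℂ) (hu : ContDiff ℝ (⊤ : ℕ∞) u) (hs : HasCompactSupport u)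
    (ω : Euc n) (hω : ‖ω‖ = 1) :
    ‖u ω‖ₑ ≤ ∫⁻ s in Ioi (1:ℝ), ‖fderiv ℝ u (s • ω)‖ₑ := by
  have hd : Differentiable ℝ u := hu.differentiable (by simp)
  have hc : Continuous (fderiv ℝ u) := hu.continuous_fderiv (by simp)
  obtain ⟨R, hR⟩ := hs.isCompact.isBounded.subset_closedBall (0 : Euc n)
  set R' := max R 1 + 1 with hR'
  have hR1 : 1 ≤ R' := by have := le_max_right R 1; linarith
  have hz : u (R' • ω) = 0 := by
    apply image_eq_zero_of_notMem_tsupport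
    intro h
    have := hR h
    rw [mem_closedBall, dist_zero_right, norm_smul, hω, Real.norm_eq_abs,
      abs_of_pos (by linarith)] at this
    have := le_max_left R 1; linarith
  have hder : ∀ s ∈ uIcc (1:ℝ) R', HasDerivAt (fun s : ℝ => u (s • ω))
      (fderiv ℝ u (s • ω) ω) s := by
    intro s _
    have h1 : HasDerivAt (fun s : ℝ => s • ω) ω s := by
      simpa using ((hasDerivAt_id s).smul_const ω)
    exact (hd (s • ω)).hasFDerivAt.comp_hasDerivAt s h1
  have hcont : Continuous (fun s : ℝ => fderiv ℝ u (s • ω)) :=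
    hc.comp (continuous_id.smul continuous_const)
  have hftc := intervalIntegral.integral_eq_sub_of_hasDerivAt hder
    ((hcont.clm_apply continuous_const).intervalIntegrable _ _)
  rw [hz, one_smul, zero_sub, intervalIntegral.integral_of_le hR1] at hftc
  rw [← enorm_neg, ← hftc]
  refine (enorm_integral_le_lintegral_enorm _).trans ?_
  refine le_trans (lintegral_mono fun s => ?_) (lintegral_mono_set Ioc_subset_Ioi_self)
  refine (ContinuousLinearMap.le_opENorm _ _).trans ?_
  have : ‖ω‖ₑ = 1 := by rw [← ofReal_norm, hω]; simp
  rw [this, mul_one]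

lemma L2_bound (n : ℕ) (hn : 3 ≤ n) (β : ℝ) (hβ1 : 1 - (n:ℝ)/2 < β) :
    ∃ C : ℝ≥0, ∀ u : Euc n → ℂ, ContDiff ℝ (⊤ : ℕ∞) u → HasCompactSupport u →
      ∫⁻ ω, ‖u ω.val‖ₑ ^ 2 ∂(sphMeas n) ≤
        C * ∫⁻ x : Euc n, (ENNReal.ofReal (‖x‖ ^ β) * ‖fderiv ℝ u x‖ₑ) ^ 2 := by
  set γ : ℝ := 2 * β + ((n - 1 : ℕ) : ℝ) with hγ
  have hγ1 : 1 < γ := by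
    rw [hγ, Nat.cast_sub (by omega)]; push_cast; linarith
  set B : ℝ≥0∞ := ∫⁻ s in Ioi (1:ℝ), (ENNReal.ofReal (s ^ γ))⁻¹ with hB
  have hBt : B ≠ ∞ := by
    have : B = ∫⁻ s in Ioi (1:ℝ), ENNReal.ofReal (s ^ (-γ)) := by
      apply setLIntegral_congr_fun measurableSet_Ioi
      intro s hs
      have hs0 : (0:ℝ) < s := lt_trans one_pos hs
      simp only
      rw [← ENNReal.ofReal_inv_of_pos (Real.rpow_pos_of_pos hs0 _), ← Real.rpow_neg hs0.le]
    rw [this]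
    have h : IntegrableOn (fun s : ℝ => s ^ (-γ)) (Ioi 1) :=
      integrableOn_Ioi_rpow_of_lt (by linarith) one_pos
    exact (Integrable.lintegral_lt_top h).ne
  refine ⟨B.toNNReal, fun u hu hs => ?_⟩
  rw [ENNReal.coe_toNNReal hBt]
  have hc : Continuous (fderiv ℝ u) := hu.continuous_fderiv (by simp)
  have hgm : Measurable (fun x : Euc n => (ENNReal.ofReal (‖x‖ ^ β) * ‖fderiv ℝ u x‖ₑ) ^ 2) := by
    have h1 : Measurable (fun x : Euc n => ENNReal.ofReal (‖x‖ ^ β)) := by fun_prop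
    exact (h1.mul hc.enorm.measurable).pow_const 2
  rw [← polar_lintegral hn _ hgm, ← lintegral_const_mul' _ _ hBt]
  apply lintegral_mono
  intro ω
  simp only
  have hω : ‖ω.val‖ = 1 := norm_eq_of_mem_sphere ω
  have hm : Measurable fun s : ℝ => ‖fderiv ℝ u (s • ω.val)‖ₑ :=
    (hc.comp (continuous_id.smul continuous_const)).enorm.measurable
  calc _ ≤ (∫⁻ s in Ioi (1:ℝ), ‖fderiv ℝ u (s • ω.val)‖ₑ) ^ 2 := by
        gcongr; exact ray_bound u hu hs _ hω
    _ ≤ B * ∫⁻ s in Ioi (1:ℝ), ENNReal.ofReal (s ^ γ) * ‖fderiv ℝ u (s • ω.val)‖ₑ ^ 2 := by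
        refine cs_weight _ _ _ hm.aemeasurable (by fun_prop) ?_
        filter_upwards [ae_restrict_mem measurableSet_Ioi] with s hs
        refine ⟨?_, ENNReal.ofReal_ne_top⟩
        simpa using Real.rpow_pos_of_pos (lt_trans one_pos hs) _
    _ = B * ∫⁻ s in Ioi (1:ℝ), ENNReal.ofReal (s ^ (n - 1)) *
          (ENNReal.ofReal (‖s • ω.val‖ ^ β) * ‖fderiv ℝ u (s • ω.val)‖ₑ) ^ 2 := by
        congr 1
        apply setLIntegral_congr_fun measurableSet_Ioi
        intro s hs
        have hs0 : (0:ℝ) < s := lt_trans one_pos hs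
        simp only
        rw [norm_smul, hω, mul_one, Real.norm_eq_abs, abs_of_pos hs0, mul_pow, ← mul_assoc,
          ← ENNReal.ofReal_pow (by positivity), ← ENNReal.ofReal_mul (by positivity)]
        congr 2
        rw [hγ, Real.rpow_add hs0, Real.rpow_natCast, mul_comm 2 β, Real.rpow_mul hs0.le,
          Real.rpow_two, mul_comm]
    _ ≤ _ := by
        gcongr B * ?_
        exact lintegral_mono_set (Ioi_subset_Ioi (zero_le_one' ℝ))

lemma shell_bound (n : ℕ) (β : ℝ) :
    ∃ C : ℝ≥0, ∀ g : Euc n → ℝ≥0∞,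
      ∫⁻ y in {x : Euc n | 1 ≤ ‖x‖ ∧ ‖x‖ ≤ 8}, g y ^ 2 ≤
        C * ∫⁻ x : Euc n, (ENNReal.ofReal (‖x‖ ^ β) * g x) ^ 2 := by
  set m : ℝ := min 1 (8 ^ β) with hm
  have hm0 : 0 < m := lt_min one_pos (Real.rpow_pos_of_pos (by norm_num) _)
  refine ⟨Real.toNNReal ((m ^ 2)⁻¹), fun g => ?_⟩
  have hms : MeasurableSet {x : Euc n | 1 ≤ ‖x‖ ∧ ‖x‖ ≤ 8} :=
    ((isClosed_le (by fun_prop) (by fun_prop)).and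
      (isClosed_le (by fun_prop) (by fun_prop))).measurableSet
  rw [← lintegral_const_mul' _ _ ENNReal.coe_ne_top]
  refine le_trans (setLIntegral_mono' hms ?_) (setLIntegral_le_lintegral _ _)
  rintro x ⟨h1, h8⟩
  have hmx : m ≤ ‖x‖ ^ β := by
    rcases le_or_gt 0 β with hb | hb
    · exact (min_le_left _ _).trans (Real.one_le_rpow h1 hb)
    · exact (min_le_right _ _).trans (Real.rpow_le_rpow_of_nonpos (by linarith) h8 hb.le)
  change _ ≤ ENNReal.ofReal _ * _
  rw [mul_pow, ← mul_assoc, ← ENNReal.ofReal_pow (by positivity), ← ENNReal.ofReal_mul (by positivity)]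
  calc g x ^ 2 = 1 * g x ^ 2 := (one_mul _).symm
    _ ≤ _ := by
      gcongr
      rw [ENNReal.one_le_ofReal, ← div_eq_inv_mul, one_le_div (by positivity)]
      gcongr


/-- The estimate at radius one. -/
theorem unit_bound (n : ℕ) (hn : 3 ≤ n) (β : ℝ) (hβ1 : 1 - (n:ℝ)/2 < β) :
    ∃ C : ℝ≥0, ∀ u : Euc n → ℂ, ContDiff ℝ (⊤ : ℕ∞) u → HasCompactSupport u →
      HsphNorm (1/2) (fun ω => u ω.val) ≤
        (C : ℝ≥0∞) * wL2 β (fun x => (‖fderiv ℝ u x‖₊ : ℝ≥0∞)) := by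
  obtain ⟨B, hB⟩ := L2_bound n hn β hβ1
  obtain ⟨G, hG⟩ := gag_total n hn
  obtain ⟨D, hD⟩ := shell_bound n β
  refine ⟨B ^ (1/2 : ℝ) + (G * (B + D)) ^ (1/2 : ℝ), fun u hu hc => ?_⟩
  have h1 := hB u hu hc
  have h2 := hG u hu
  have h3 := hD (fun y => ‖fderiv ℝ u y‖ₑ)
  set W := ∫⁻ x, (ENNReal.ofReal (‖x‖ ^ β) * ‖fderiv ℝ u x‖ₑ) ^ 2 with hW
  set L := ∫⁻ ω, ‖u ω.val‖ₑ ^ 2 ∂(sphMeas n) with hL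
  set Sh := ∫⁻ y in {x : Euc n | 1 ≤ ‖x‖ ∧ ‖x‖ ≤ 8}, ‖fderiv ℝ u y‖ₑ ^ 2 with hSh
  have hw : wL2 β (fun x => (‖fderiv ℝ u x‖₊ : ℝ≥0∞)) = W ^ (1/2 : ℝ) := by
    unfold wL2
    simp only [ENNReal.rpow_two, ← enorm_eq_nnnorm]
    rfl
  have hl : L2sph (fun ω : sphere (0 : Euc n) 1 => u ω.val) = L ^ (1/2 : ℝ) := by
    unfold L2sph
    simp only [ENNReal.rpow_two, ← enorm_eq_nnnorm]
    rfl
  have he : (n : ℝ) - 1 + 2 * (1/2) = n := by ring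
  have h4 : (∫⁻ ω, ∫⁻ ω', ‖u ω.val - u ω'.val‖ₑ ^ 2 /
      ENNReal.ofReal (‖ω.val - ω'.val‖ ^ n) ∂(sphMeas n) ∂(sphMeas n)) ≤
      ((G * (B + D) : ℝ≥0) : ℝ≥0∞) * W := by
    refine h2.trans ?_
    calc (G : ℝ≥0∞) * (L + Sh) ≤ G * (B * W + D * W) := by
          gcongr G * ?_
          exact add_le_add h1 h3
      _ = _ := by push_cast; ring
  unfold HsphNorm
  rw [hl, hw, if_neg (by norm_num)]
  simp only [he, ENNReal.rpow_two, ← enorm_eq_nnnorm, Real.rpow_natCast, Subtype.dist_eq, dist_eq_norm]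
  rw [ENNReal.coe_add, add_mul, ENNReal.coe_rpow_of_nonneg _ (by norm_num : (0:ℝ) ≤ 1/2),
    ENNReal.coe_rpow_of_nonneg _ (by norm_num : (0:ℝ) ≤ 1/2),
    ← ENNReal.mul_rpow_of_nonneg _ _ (by norm_num : (0:ℝ) ≤ 1/2),
    ← ENNReal.mul_rpow_of_nonneg _ _ (by norm_num : (0:ℝ) ≤ 1/2)]
  exact add_le_add (ENNReal.rpow_le_rpow h1 (by norm_num)) (ENNReal.rpow_le_rpow h4 (by norm_num))

/-- Scaling of the weighted norm. -/
theorem wL2_scale {n : ℕ} (β : ℝ) (u : Euc n → ℂ) (hu : ContDiff ℝ (⊤ : ℕ∞) u) (r : ℝ)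
    (hr : 0 < r) :
    wL2 β (fun x => (‖fderiv ℝ (fun x => u (r • x)) x‖₊ : ℝ≥0∞)) =
      ENNReal.ofReal (r ^ (1 - (n:ℝ)/2 - β)) * wL2 β (fun x => (‖fderiv ℝ u x‖₊ : ℝ≥0∞)) := by
  have hcont : Continuous (fderiv ℝ u) := hu.continuous_fderiv (by simp)
  have hm1 : Measurable fun x : Euc n => ‖fderiv ℝ u x‖ₑ := hcont.enorm.measurable
  have hm2 : Measurable fun x : Euc n => ENNReal.ofReal (‖x‖ ^ β) :=
    (measurable_norm.pow_const β).ennreal_ofReal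
  have hm : Measurable fun x : Euc n => (ENNReal.ofReal (‖x‖ ^ β) * ‖fderiv ℝ u x‖ₑ) ^ 2 :=
    (hm2.mul hm1).pow_const 2
  unfold wL2
  simp only [ENNReal.rpow_two, ← enorm_eq_nnnorm]
  have key : ∀ x : Euc n, (ENNReal.ofReal (‖x‖ ^ β) * ‖fderiv ℝ (fun x => u (r • x)) x‖ₑ) ^ 2 =
      ENNReal.ofReal (r ^ (2 - 2 * β)) *
        (fun x : Euc n => (ENNReal.ofReal (‖x‖ ^ β) * ‖fderiv ℝ u x‖ₑ) ^ 2) (r • x) := by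
    intro x
    have e1 : fderiv ℝ (fun x => u (r • x)) x = r • fderiv ℝ u (r • x) := fderiv_comp_smul r
    have e2 : ‖r‖ₑ = ENNReal.ofReal r := by
      rw [← ofReal_norm, Real.norm_of_nonneg hr.le]
    have e3 : ‖r • x‖ ^ β = r ^ β * ‖x‖ ^ β := by
      rw [norm_smul, Real.norm_of_nonneg hr.le, Real.mul_rpow hr.le (norm_nonneg _)]
    have e4 : ENNReal.ofReal (r ^ (2 - 2 * β)) * (ENNReal.ofReal (r ^ β)) ^ 2 =
        ENNReal.ofReal r ^ 2 := by
      rw [← ENNReal.ofReal_pow (by positivity), ← ENNReal.ofReal_pow hr.le,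
        ← ENNReal.ofReal_mul (by positivity), ← Real.rpow_natCast (r ^ β), ← Real.rpow_mul hr.le,
        ← Real.rpow_add hr, ← Real.rpow_natCast r 2]
      congr 2
      push_cast
      ring
    simp only [e1, enorm_smul, e2, e3]
    rw [ENNReal.ofReal_mul (by positivity), mul_pow, mul_pow, mul_pow, mul_pow, ← e4]
    ring
  rw [lintegral_congr key, lintegral_const_mul' _ _ ENNReal.ofReal_ne_top,
    lintegral_smul_euc _ hm hr, ← mul_assoc, ← ENNReal.ofReal_mul (by positivity),
    ENNReal.mul_rpow_of_nonneg _ _ (by norm_num : (0:ℝ) ≤ 1/2),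
    ENNReal.ofReal_rpow_of_nonneg (by positivity) (by norm_num)]
  congr 2
  rw [← Real.rpow_natCast, ← Real.rpow_neg hr.le, ← Real.rpow_add hr, ← Real.rpow_mul hr.le]
  congr 1
  ring

/-- Weighted trace estimate at `α = 1`: for `n ≥ 3` and `β ∈ (1 - n/2, n/2)`,
`‖ r^{n/2-1+β} u ‖_{L^∞_r H^{1/2}_ω} ≲ ‖ |x|^β ∇u ‖_{L²(ℝⁿ)}` for `u ∈ C_0^∞(ℝⁿ)`. -/
theorem weighted_trace_alpha_one (n : ℕ) (hn : 3 ≤ n) (β : ℝ)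
    (hβ1 : 1 - (n:ℝ)/2 < β) (hβ2 : β < (n:ℝ)/2) :
    ∃ C : ℝ≥0, ∀ u : Euc n → ℂ, ContDiff ℝ (⊤ : ℕ∞) u → HasCompactSupport u →
      ∀ r : ℝ, 0 < r →
        ENNReal.ofReal (r ^ ((n:ℝ)/2 - 1 + β)) *
            HsphNorm (1/2) (fun ω => u (r • ω.val)) ≤
          (C : ℝ≥0∞) * wL2 β (fun x => (‖fderiv ℝ u x‖₊ : ℝ≥0∞)) := by
  obtain ⟨C, hC⟩ := unit_bound n hn β hβ1
  refine ⟨C, fun u hu hc r hr => ?_⟩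
  have hv : ContDiff ℝ (⊤ : ℕ∞) (fun x : Euc n => u (r • x)) :=
    hu.comp (contDiff_const_smul r)
  have hcv : HasCompactSupport (fun x : Euc n => u (r • x)) := hc.comp_smul hr.ne'
  have h := hC _ hv hcv
  rw [wL2_scale β u hu r hr] at h
  have e : ENNReal.ofReal (r ^ ((n:ℝ)/2 - 1 + β)) * ENNReal.ofReal (r ^ (1 - (n:ℝ)/2 - β)) = 1 := by
    rw [← ENNReal.ofReal_mul (by positivity), ← Real.rpow_add hr]
    have : (n:ℝ)/2 - 1 + β + (1 - (n:ℝ)/2 - β) = 0 := by ring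
    rw [this]
    simp
  calc _ ≤ ENNReal.ofReal (r ^ ((n:ℝ)/2 - 1 + β)) * _ := mul_le_mul_right h _
    _ = (ENNReal.ofReal (r ^ ((n:ℝ)/2 - 1 + β)) * ENNReal.ofReal (r ^ (1 - (n:ℝ)/2 - β))) *
        (C * wL2 β (fun x => (‖fderiv ℝ u x‖₊ : ℝ≥0∞))) := by ring
    _ = _ := by rw [e, one_mul]
end
end
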